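/- arXiv:2203.04191 — 3 statements merged into one kernel-verified Lean document; each statement's English description precedes it below -/
import Mathlib

section
/- Let m ∈ ℕ and α ∈ (0,1]. Let f : ℝ² → ℝ be such that f ∘ c ∈ C^{m+1,α}(ℝ) for every c ∈ C^∞(ℝ, ℝ²). Then for every x ∈ ℝ the partial derivative ∂₂f(x,0) = (d/ds)|_{s=0} f(x,s) exists, and the function x ↦ ∂₂f(x,0) belongs to C^{m,α}(ℝ). -/
/-- The local Hölder–Lipschitz class `C^{m,α}(ℝ)`: `C^m` functions whose `m`-th derivative is
locally `α`-Hölder. -/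
def HolderClassR (m : ℕ) (α : ℝ) (f : ℝ → ℝ) : Prop :=
  ContDiff ℝ m f ∧
    ∀ K : Set ℝ, IsCompact K →
      ∃ C : ℝ, ∀ x h : ℝ, x ∈ K → x + h ∈ K → h ≠ 0 →
        |iteratedDeriv m f (x + h) - iteratedDeriv m f x| ≤ C * |h| ^ α

open Polynomial in
lemma interp_aux (n k : ℕ) : ∃ a : ℕ → ℝ, ∀ D : ℝ[X], D.natDegree ≤ n → ∀ h : ℝ,
    D.coeff k * h ^ k = ∑ i ∈ Finset.range (n + 1), a i * D.eval (h * ((i : ℝ) + 1)) := by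
  refine ⟨fun i => (Lagrange.basis (Finset.range (n + 1)) (fun i : ℕ => (i : ℝ) + 1) i).coeff k, ?_⟩
  have key : ∀ D : ℝ[X], D.natDegree ≤ n → D.coeff k = ∑ i ∈ Finset.range (n + 1),
      (Lagrange.basis (Finset.range (n + 1)) (fun i : ℕ => (i : ℝ) + 1) i).coeff k
        * D.eval ((i : ℝ) + 1) := by
    intro D hD
    have h1 : D.degree < (Finset.range (n + 1)).card := by
      rw [Finset.card_range]
      refine lt_of_le_of_lt degree_le_natDegree ?_
      exact_mod_cast Nat.lt_succ_of_le hD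
    have h2 : Set.InjOn (fun i : ℕ => (i : ℝ) + 1) (Finset.range (n + 1)) := by
      intro i _ j _ hij
      simpa using hij
    conv_lhs => rw [Lagrange.eq_interpolate h2 h1]
    rw [Lagrange.interpolate_apply, finsetSum_coeff]
    refine Finset.sum_congr rfl fun i _ => ?_
    rw [coeff_C_mul, mul_comm]
  intro D hD h
  have := key (D.comp (C h * X)) (by
    refine natDegree_comp_le.trans ?_
    calc D.natDegree * (C h * X).natDegree ≤ D.natDegree * 1 :=
          Nat.mul_le_mul le_rfl ((natDegree_C_mul_le h X).trans natDegree_X_le)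
      _ ≤ n := by simpa using hD)
  rw [comp_C_mul_X_coeff] at this
  rw [this]
  refine Finset.sum_congr rfl fun i _ => ?_
  simp [eval_comp]

open Polynomial in
lemma antideriv_aux (n : ℕ) (Q : ℝ[X]) (hQ : Q.natDegree ≤ n) (c : ℝ) :
    ∃ R : ℝ[X], R.natDegree ≤ n + 1 ∧ derivative R = Q ∧ R.eval 0 = c := by
  refine ⟨C c + ∑ i ∈ Finset.range (n + 1), C (Q.coeff i / (i + 1)) * X ^ (i + 1), ?_, ?_, ?_⟩
  · refine natDegree_add_le_of_degree_le (by simp) ?_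
    refine natDegree_sum_le_of_forall_le _ _ fun i hi => ?_
    refine (natDegree_C_mul_X_pow_le _ _).trans ?_
    have := Finset.mem_range.1 hi
    omega
  · conv_rhs => rw [Q.as_sum_range_C_mul_X_pow' (Nat.lt_succ_of_le hQ)]
    simp only [derivative_add, derivative_C, zero_add, derivative_sum]
    refine Finset.sum_congr rfl fun i _ => ?_
    rw [derivative_C_mul_X_pow]
    have : ((i : ℝ) + 1) ≠ 0 := by positivity
    simp only [Nat.cast_add, Nat.cast_one, Nat.add_sub_cancel]
    rw [div_mul_cancel₀ _ this]
  · simp [eval_finsetSum]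

open Polynomial in
lemma taylor_aux (α : ℝ) (hα : 0 < α) (n : ℕ) : ∀ φ : ℝ → ℝ, HolderClassR n α φ →
    ∃ C : ℝ, 0 ≤ C ∧ ∀ τ ∈ Set.Icc (0 : ℝ) 1, ∃ Q : ℝ[X], Q.natDegree ≤ n ∧
      ∀ t : ℝ, |t| ≤ 1 → |φ (τ + t) - Q.eval t| ≤ C * |t| ^ ((n : ℝ) + α) := by
  induction n with
  | zero =>
    intro φ hφ
    obtain ⟨C, hC⟩ := hφ.2 (Set.Icc (-1) 2) isCompact_Icc
    refine ⟨max C 0, le_max_right _ _, fun τ hτ => ⟨Polynomial.C (φ τ), by simp, fun t ht => ?_⟩⟩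
    have ht' := abs_le.1 ht
    rcases eq_or_ne t 0 with rfl | h0
    · simp only [add_zero, eval_C, sub_self, abs_zero]
      positivity
    have := hC τ t ⟨by linarith [hτ.1], by linarith [hτ.2]⟩
      ⟨by linarith [hτ.1], by linarith [hτ.2]⟩ h0
    simp only [iteratedDeriv_zero] at this
    simp only [eval_C, Nat.cast_zero, zero_add]
    refine this.trans ?_
    gcongr
    exact le_max_left _ _
  | succ n ih =>
    intro φ hφ
    have h1 : Differentiable ℝ φ ∧ ContDiff ℝ n (deriv φ) := by
      have h := hφ.1
      rw [Nat.cast_add, Nat.cast_one, contDiff_succ_iff_deriv] at h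
      exact ⟨h.1, h.2.2⟩
    obtain ⟨C, hC0, hC⟩ := ih (deriv φ) ⟨h1.2, fun K hK => by
      obtain ⟨C, hC⟩ := hφ.2 K hK
      refine ⟨C, ?_⟩
      simpa only [iteratedDeriv_succ'] using hC⟩
    refine ⟨C, hC0, fun τ hτ => ?_⟩
    obtain ⟨Q, hQd, hQ⟩ := hC τ hτ
    obtain ⟨R, hRd, hRQ, hR0⟩ := antideriv_aux n Q hQd (φ τ)
    refine ⟨R, hRd, fun t ht => ?_⟩
    have hder : ∀ s ∈ Set.uIcc 0 t, HasDerivWithinAt (fun s => φ (τ + s) - R.eval s)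
        (deriv φ (τ + s) - Q.eval s) (Set.uIcc 0 t) s := by
      intro s _
      have ha : HasDerivAt (fun s => φ (τ + s)) (deriv φ (τ + s)) s := by
        have := (h1.1 (τ + s)).hasDerivAt.comp_const_add τ s
        exact this
      have hb := R.hasDerivAt s
      rw [hRQ] at hb
      exact (ha.sub hb).hasDerivWithinAt
    have habs : ∀ s ∈ Set.uIcc 0 t, |s| ≤ |t| := by
      intro s hs
      have := Set.abs_sub_left_of_mem_uIcc hs
      simpa using this
    have := Convex.norm_image_sub_le_of_norm_hasDerivWithin_le (C := C * |t| ^ ((n : ℝ) + α)) hder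
      (by
        intro s hs
        rw [Real.norm_eq_abs]
        refine (hQ s ((habs s hs).trans ht)).trans ?_
        have := habs s hs
        gcongr) (convex_uIcc 0 t) Set.left_mem_uIcc Set.right_mem_uIcc
    simp only [add_zero, hR0, sub_self, sub_zero, Real.norm_eq_abs] at this
    refine this.trans (le_of_eq ?_)
    rw [mul_assoc]
    congr 1
    push_cast
    rcases eq_or_ne t 0 with rfl | h0
    · have : (n : ℝ) + 1 + α ≠ 0 := by positivity
      simp [Real.zero_rpow this]
    · rw [show (n : ℝ) + 1 + α = (n + α) + 1 by ring, Real.rpow_add_one (by positivity)]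

lemma smooth_series_aux (A : ℕ → ℝ → ℝ) (hA : ∀ n, ContDiff ℝ (⊤ : ℕ∞) (A n))
    (η : ℕ → ℝ) (hη : ∀ n, 0 < η n)
    (hb : ∀ n, ∀ i ≤ n, ∀ t, η n * ‖iteratedFDeriv ℝ i (A n) t‖ ≤ (1 / 2) ^ n)
    (w : ℕ → ℝ) (W : ℝ) (hw : ∀ n, |w n| ≤ W) :
    ContDiff ℝ (⊤ : ℕ∞) fun t => ∑' n, (w n * η n) • A n t := by
  refine contDiff_tsum_of_eventually (v := fun _ n => W * (1 / 2) ^ n)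
    (fun n => ContDiff.const_smul (w n * η n) (hA n))
    (fun k _ => (summable_geometric_two).mul_left W) ?_
  intro k _
  rw [Nat.cofinite_eq_atTop]
  filter_upwards [Filter.eventually_ge_atTop k] with n hn t
  rw [iteratedFDeriv_const_smul_apply' (((hA n).of_le (by exact_mod_cast le_top)).contDiffAt),
    norm_smul, Real.norm_eq_abs, abs_mul, abs_of_pos (hη n), mul_assoc]
  exact mul_le_mul (hw n) (hb n k hn t) (mul_nonneg (hη n).le (norm_nonneg _))
    ((abs_nonneg _).trans (hw n))

lemma bound_aux (A : ℝ → ℝ) (hA : ContDiff ℝ (⊤ : ℕ∞) A) (hc : HasCompactSupport A) (n : ℕ) :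
    ∃ C : ℝ, 0 ≤ C ∧ ∀ i ≤ n, ∀ t, ‖iteratedFDeriv ℝ i A t‖ ≤ C := by
  have h : ∀ i : ℕ, ∃ C : ℝ, ∀ t, ‖iteratedFDeriv ℝ i A t‖ ≤ C := fun i =>
    Continuous.bounded_above_of_compact_support
      (hA.continuous_iteratedFDeriv (by exact_mod_cast le_top)) (hc.iteratedFDeriv i)
  choose C hC using h
  have h0 : ∀ i, 0 ≤ C i := fun i => (norm_nonneg _).trans (hC i 0)
  refine ⟨∑ i ∈ Finset.range (n + 1), C i, Finset.sum_nonneg fun i _ => h0 i, fun i hi t => ?_⟩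
  refine (hC i t).trans ?_
  exact Finset.single_le_sum (f := C) (fun i _ => h0 i) (Finset.mem_range.2 (Nat.lt_succ_of_le hi))

lemma sep_aux {a b t : ℝ} (ha : 0 < a) (hb : 0 < b) (h : 2 * a ≤ b ∨ 2 * b ≤ a)
    (h1 : |t - a| ≤ a / 8) (h2 : |t - b| < b / 4) : False := by
  rw [abs_le] at h1
  rw [abs_lt] at h2
  rcases h with h | h <;> linarith [h1.1, h1.2, h2.1, h2.2]

lemma curve_aux : ∃ τ ρ η : ℕ → ℝ, (∀ n, τ n ∈ Set.Icc (0 : ℝ) 1) ∧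
    (∀ n, 0 < ρ n ∧ ρ n ≤ 1) ∧ (∀ n, 0 < η n) ∧
    ∀ (ξ : ℕ → ℝ) (_ : ∀ n, |ξ n| ≤ 1) (x v1 v2 : ℝ), ∃ c : ℝ → ℝ × ℝ,
      ContDiff ℝ (⊤ : ℕ∞) c ∧ ∀ n t, |t| ≤ ρ n →
        c (τ n + t) = (x + η n * ξ n + η n * t * v1, η n * t * v2) := by
  let τ : ℕ → ℝ := fun n => (1 / 2) ^ n
  have hτ : ∀ n, 0 < τ n := fun n => by positivity
  have hτ1 : ∀ n, τ n ≤ 1 := fun n => pow_le_one₀ (by norm_num) (by norm_num)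
  let b : ∀ n, ContDiffBump (τ n) := fun n =>
    ⟨τ n / 8, τ n / 4, by have := hτ n; positivity, by have := hτ n; linarith⟩
  let A : ℕ → ℝ → ℝ := fun n t => b n t
  let B : ℕ → ℝ → ℝ := fun n t => b n t * (t - τ n)
  have hA : ∀ n, ContDiff ℝ (⊤ : ℕ∞) (A n) := fun n => (b n).contDiff
  have hB : ∀ n, ContDiff ℝ (⊤ : ℕ∞) (B n) := fun n =>
    (b n).contDiff.mul (contDiff_id.sub contDiff_const)
  have hAc : ∀ n, HasCompactSupport (A n) := fun n => (b n).hasCompactSupport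
  have hBc : ∀ n, HasCompactSupport (B n) := fun n => (b n).hasCompactSupport.mul_right
  choose CA hCA0 hCA using fun n => bound_aux (A n) (hA n) (hAc n) n
  choose CB hCB0 hCB using fun n => bound_aux (B n) (hB n) (hBc n) n
  let η : ℕ → ℝ := fun n => (1 / 2) ^ n / (1 + CA n + CB n)
  have hd : ∀ n, 0 < 1 + CA n + CB n := fun n => by
    have := hCA0 n
    have := hCB0 n
    positivity
  have hη : ∀ n, 0 < η n := fun n => div_pos (by positivity) (hd n)
  have hη' : ∀ n, η n * (1 + CA n + CB n) = (1 / 2) ^ n := fun n =>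
    div_mul_cancel₀ _ (hd n).ne'
  have hbA : ∀ n, ∀ i ≤ n, ∀ t, η n * ‖iteratedFDeriv ℝ i (A n) t‖ ≤ (1 / 2) ^ n := by
    intro n i hi t
    rw [← hη' n]
    exact mul_le_mul_of_nonneg_left (by linarith [hCA n i hi t, hCB0 n]) (hη n).le
  have hbB : ∀ n, ∀ i ≤ n, ∀ t, η n * ‖iteratedFDeriv ℝ i (B n) t‖ ≤ (1 / 2) ^ n := by
    intro n i hi t
    rw [← hη' n]
    exact mul_le_mul_of_nonneg_left (by linarith [hCB n i hi t, hCA0 n]) (hη n).le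
  refine ⟨τ, fun n => τ n / 8, η, fun n => ⟨(hτ n).le, hτ1 n⟩,
    fun n => ⟨by have := hτ n; positivity, by linarith [hτ1 n]⟩, hη, ?_⟩
  intro ξ hξ x v1 v2
  refine ⟨fun t => (x + ∑' n, (ξ n * η n) • A n t + ∑' n, (v1 * η n) • B n t,
    ∑' n, (v2 * η n) • B n t), ?_, ?_⟩
  · have h1 := smooth_series_aux A hA η hη hbA ξ 1 hξ
    have h2 := smooth_series_aux B hB η hη hbB (fun _ => v1) |v1| (fun _ => le_rfl)
    have h3 := smooth_series_aux B hB η hη hbB (fun _ => v2) |v2| (fun _ => le_rfl)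
    exact ((contDiff_const.add h1).add h2).prodMk h3
  · intro n t ht
    have hz : ∀ k, k ≠ n → A k (τ n + t) = 0 := by
      intro k hk
      refine (b k).zero_of_le_dist ?_
      by_contra hlt
      rw [not_le, Real.dist_eq] at hlt
      refine sep_aux (hτ n) (hτ k) ?_ (t := τ n + t) (by simpa using ht) hlt
      rcases lt_or_gt_of_ne hk with h | h
      · left
        have : τ n ≤ τ (k + 1) := pow_le_pow_of_le_one (by norm_num) (by norm_num) h
        have h2 : τ (k + 1) = τ k * (1 / 2) := pow_succ _ _
        linarith
      · right
        have : τ k ≤ τ (n + 1) := pow_le_pow_of_le_one (by norm_num) (by norm_num) h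
        have h2 : τ (n + 1) = τ n * (1 / 2) := pow_succ _ _
        linarith
    have hzB : ∀ k, k ≠ n → B k (τ n + t) = 0 := by
      intro k hk
      have := hz k hk
      simp only [A] at this
      simp only [B, this, zero_mul]
    have h1 : A n (τ n + t) = 1 := by
      refine (b n).one_of_mem_closedBall ?_
      rw [Metric.mem_closedBall, Real.dist_eq]
      simpa using ht
    have hB1 : B n (τ n + t) = t := by
      simp only [A] at h1
      simp only [B, h1]
      ring
    have e1 : ∑' k, (ξ k * η k) • A k (τ n + t) = ξ n * η n := by
      rw [tsum_eq_single n (fun k hk => by rw [hz k hk, smul_zero]), h1, smul_eq_mul, mul_one]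
    have e2 : ∀ v : ℝ, ∑' k, (v * η k) • B k (τ n + t) = v * η n * t := by
      intro v
      rw [tsum_eq_single n (fun k hk => by rw [hzB k hk, smul_zero]), hB1, smul_eq_mul]
    simp only [e1, e2]
    ext <;> simp <;> ring

open Polynomial in
lemma line_aux (m : ℕ) (α : ℝ) (hα : 0 < α) (f : ℝ × ℝ → ℝ)
    (hf : ∀ c : ℝ → ℝ × ℝ, ContDiff ℝ (⊤ : ℕ∞) c → HolderClassR (m + 1) α (f ∘ c))
    (v1 v2 x0 : ℝ) : ∃ δ M : ℝ, 0 < δ ∧ 0 ≤ M ∧ ∀ x : ℝ, |x - x0| ≤ δ →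
      ∃ Q : ℝ[X], Q.natDegree ≤ m + 1 ∧ ∀ t : ℝ, |t| ≤ δ →
        |f (x + t * v1, t * v2) - Q.eval t| ≤ M * |t| ^ ((m : ℝ) + 1 + α) := by
  obtain ⟨τ, ρ, η, hτ, hρ, hη, hc⟩ := curve_aux
  by_contra hcon
  push Not at hcon
  have hd : ∀ n, 0 < η n * ρ n := fun n => mul_pos (hη n) (hρ n).1
  choose x hx hQ using fun n : ℕ => hcon (η n * ρ n) (n * (1 / η n) ^ ((m : ℝ) + 1 + α)) (hd n)
    (by have := hη n; positivity)
  obtain ⟨c, hcs, hce⟩ := hc (fun n => (x n - x0) / η n) (fun n => by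
    rw [abs_div, abs_of_pos (hη n), div_le_one (hη n)]
    refine (hx n).trans ?_
    exact mul_le_of_le_one_right (hη n).le (hρ n).2) x0 v1 v2
  obtain ⟨C, hC0, hC⟩ := taylor_aux α hα (m + 1) _ (hf c hcs)
  obtain ⟨n, hn⟩ := exists_nat_ge C
  obtain ⟨Q, hQd, hQt⟩ := hC (τ n) (hτ n)
  obtain ⟨t, ht, hlt⟩ := hQ n (Q.comp (Polynomial.C (1 / η n) * X)) (by
    refine natDegree_comp_le.trans ?_
    calc Q.natDegree * (Polynomial.C (1 / η n) * X).natDegree ≤ Q.natDegree * 1 :=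
          Nat.mul_le_mul le_rfl ((natDegree_C_mul_le _ X).trans natDegree_X_le)
      _ ≤ m + 1 := by simpa using hQd)
  have hηn := hη n
  have ht1 : |t / η n| ≤ ρ n := by
    rw [abs_div, abs_of_pos hηn, div_le_iff₀ hηn, mul_comm]
    exact ht
  have h1 := hQt (t / η n) (ht1.trans (hρ n).2)
  rw [Function.comp_apply, hce n _ ht1] at h1
  have e1 : x0 + η n * ((x n - x0) / η n) + η n * (t / η n) * v1 = x n + t * v1 := by
    field_simp
    ring
  have e2 : η n * (t / η n) * v2 = t * v2 := by
    field_simp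
  rw [e1, e2] at h1
  have e3 : (Q.comp (Polynomial.C (1 / η n) * X)).eval t = Q.eval (t / η n) := by
    rw [eval_comp]
    simp only [eval_mul, eval_C, eval_X]
    congr 1
    ring
  rw [e3] at hlt
  have e4 : |t / η n| ^ (((m + 1 : ℕ) : ℝ) + α) = (1 / η n) ^ ((m : ℝ) + 1 + α) *
      |t| ^ ((m : ℝ) + 1 + α) := by
    rw [← Real.mul_rpow (by positivity) (abs_nonneg _), abs_div, abs_of_pos hηn]
    push_cast
    congr 1
    ring
  rw [e4] at h1
  have : C * ((1 / η n) ^ ((m : ℝ) + 1 + α) * |t| ^ ((m : ℝ) + 1 + α)) ≤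
      n * (1 / η n) ^ ((m : ℝ) + 1 + α) * |t| ^ ((m : ℝ) + 1 + α) := by
    rw [mul_assoc]
    gcongr
  linarith

lemma deriv_aux (F G : ℝ → ℝ) (g' x C p : ℝ) (hp : 1 < p) (hG : HasDerivAt G g' x)
    (hx : F x = G x) (h : ∀ᶠ y in nhds x, y ≠ x → |F y - G y| ≤ C * |y - x| ^ p) :
    HasDerivAt F g' x := by
  have hE : HasDerivAt (fun y => F y - G y) 0 x := by
    rw [hasDerivAt_iff_tendsto_slope]
    have hlim : Filter.Tendsto (fun y => C * |y - x| ^ (p - 1)) (nhdsWithin x {x}ᶜ) (nhds 0) := by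
      have : ContinuousAt (fun y => C * |y - x| ^ (p - 1)) x := by
        refine ContinuousAt.mul continuousAt_const ?_
        refine ContinuousAt.rpow_const (by fun_prop) (Or.inr (by linarith))
      have h2 := this.tendsto
      simp only [sub_self, abs_zero] at h2
      rw [Real.zero_rpow (by linarith), mul_zero] at h2
      exact h2.mono_left nhdsWithin_le_nhds
    refine squeeze_zero_norm' ?_ hlim
    filter_upwards [nhdsWithin_le_nhds h, self_mem_nhdsWithin] with y hy hne
    have hne' : y ≠ x := hne
    have hpos : 0 < |y - x| := abs_pos.2 (sub_ne_zero.2 hne')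
    rw [slope_def_field, hx, sub_self, sub_zero, Real.norm_eq_abs, abs_div, div_le_iff₀ hpos,
      mul_assoc, ← Real.rpow_add_one hpos.ne']
    simpa using hy hne'
  have := hE.add hG
  rw [zero_add] at this
  have he : ((fun y => F y - G y) + G) = F := by
    funext y
    simp
  rwa [he] at this

open Polynomial in
lemma local_poly_aux (m : ℕ) (α : ℝ) (hα : 0 < α) (f : ℝ × ℝ → ℝ)
    (hf : ∀ c : ℝ → ℝ × ℝ, ContDiff ℝ (⊤ : ℕ∞) c → HolderClassR (m + 1) α (f ∘ c))
    (x0 : ℝ) : ∃ (δ M : ℝ) (P : ℝ → ℝ[X]), 0 < δ ∧ 0 ≤ M ∧ ∀ x : ℝ, |x - x0| ≤ δ →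
      (P x).natDegree ≤ m ∧ ∀ h : ℝ, h ≠ 0 → |h| ≤ δ → |x + h - x0| ≤ δ →
        |deriv (fun s => f (x + h, s)) 0 - (P x).eval h| ≤ M * |h| ^ ((m : ℝ) + α) := by
  obtain ⟨a, ha⟩ := interp_aux (m + 1) 1
  obtain ⟨dv, Mv, hdv, hMv, hv⟩ := line_aux m α hα f hf 0 1 x0
  choose d Mj hd hMj hj using fun j : ℕ => line_aux m α hα f hf 1 ((j : ℝ) + 1) x0
  choose! Qv hQvd hQv using hv
  choose! Q hQd hQ using hj
  have hasum : ∑ i ∈ Finset.range (m + 1 + 1), a i = 0 := by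
    have := ha 1 (by simp) 1
    simpa [coeff_one] using this.symm
  have hev : ∀ᶠ δ in nhdsWithin (0 : ℝ) (Set.Ioi 0),
      (∀ j ∈ Finset.range (m + 1 + 1), δ ≤ d j) ∧ δ * (m + 2) ≤ dv ∧ 0 < δ := by
    refine Filter.Eventually.and ?_ (Filter.Eventually.and ?_ self_mem_nhdsWithin)
    · rw [Filter.eventually_all_finset]
      intro j _
      exact nhdsWithin_le_nhds (Iic_mem_nhds (hd j))
    · have : 0 < dv / (m + 2) := by positivity
      filter_upwards [nhdsWithin_le_nhds (Iic_mem_nhds this)] with δ hδ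
      rwa [Set.mem_Iic, le_div_iff₀ (by positivity)] at hδ
  obtain ⟨δ, hδd, hδv, hδ⟩ := hev.exists
  have hδv' : δ ≤ dv := by
    refine le_trans ?_ hδv
    nlinarith [Nat.cast_nonneg (α := ℝ) m]
  have hg : ∀ z, |z - x0| ≤ δ → deriv (fun s => f (z, s)) 0 = (Qv z).coeff 1 := by
    intro z hz
    have hz' := hz.trans hδv'
    refine HasDerivAt.deriv ?_
    refine deriv_aux _ (fun s => (Qv z).eval s) _ _ Mv ((m : ℝ) + 1 + α)
      (by linarith [Nat.cast_nonneg (α := ℝ) m]) ?_ ?_ ?_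
    · have := (Qv z).hasDerivAt 0
      rw [← coeff_zero_eq_eval_zero, coeff_derivative] at this
      simpa using this
    · have := hQv z hz' 0 (by simpa using hdv.le)
      rw [abs_zero, Real.zero_rpow (by positivity), mul_zero Mv] at this
      have := abs_nonpos_iff.1 this
      rw [mul_zero, zero_mul, add_zero] at this
      exact sub_eq_zero.1 this
    · filter_upwards [Metric.closedBall_mem_nhds (0 : ℝ) hdv] with s hs _
      rw [Metric.mem_closedBall, Real.dist_eq, sub_zero] at hs
      have := hQv z hz' s hs
      simpa using this
  set e : ℝ := (m : ℝ) + 1 + α with he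
  have he0 : 0 < e := by positivity
  let R : ℝ → ℝ[X] := fun x => ∑ j ∈ Finset.range (m + 1 + 1), Polynomial.C (a j) * Q j x
  refine ⟨δ, ∑ j ∈ Finset.range (m + 1 + 1), |a j| * (Mv * ((j : ℝ) + 1) ^ e + Mj j),
    fun x => (R x).divX, hδ, ?_, ?_⟩
  · refine Finset.sum_nonneg fun j _ => ?_
    have := hMj j
    positivity
  intro x hx
  constructor
  · rw [natDegree_divX_eq_natDegree_tsub_one]
    have : (R x).natDegree ≤ m + 1 := by
      refine natDegree_sum_le_of_forall_le _ _ fun j hj => ?_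
      exact (natDegree_C_mul_le _ _).trans (hQd j x (hx.trans (hδd j hj)))
    omega
  intro h h0 hh hxh
  have hR0 : (R x).coeff 0 = 0 := by
    simp only [R, finsetSum_coeff, coeff_C_mul]
    have hz : (∑ j ∈ Finset.range (m + 1 + 1), a j) * f (x, 0) = 0 := by rw [hasum, zero_mul]
    rw [← hz, Finset.sum_mul]
    refine Finset.sum_congr rfl fun j hj => ?_
    have := hQ j x (hx.trans (hδd j hj)) 0 (by simpa using (hd j).le)
    rw [abs_zero, Real.zero_rpow (by positivity), mul_zero (Mj j)] at this
    have := abs_nonpos_iff.1 this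
    simp only [zero_mul, add_zero] at this
    rw [coeff_zero_eq_eval_zero]
    congr 1
    linarith
  have hRe : (R x).eval h = (R x).divX.eval h * h := by
    conv_lhs => rw [← divX_mul_X_add (R x), hR0]
    simp
  have hRs : (R x).eval h = ∑ j ∈ Finset.range (m + 1 + 1), a j * (Q j x).eval h := by
    simp [R, eval_finsetSum]
  have hgs := ha (Qv (x + h)) (hQvd _ (hxh.trans hδv')) h
  rw [← hg _ hxh, pow_one] at hgs
  have hpos : 0 < |h| := abs_pos.2 h0
  have main : |deriv (fun s => f (x + h, s)) 0 * h - (R x).eval h| ≤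
      (∑ j ∈ Finset.range (m + 1 + 1), |a j| * (Mv * ((j : ℝ) + 1) ^ e + Mj j)) * |h| ^ e := by
    rw [hgs, hRs, ← Finset.sum_sub_distrib, Finset.sum_mul]
    refine (Finset.abs_sum_le_sum_abs _ _).trans (Finset.sum_le_sum fun j hj => ?_)
    rw [← mul_sub, abs_mul, mul_assoc]
    refine mul_le_mul_of_nonneg_left ?_ (abs_nonneg _)
    have hj1 : (j : ℝ) ≤ m + 1 := by
      have := Finset.mem_range.1 hj
      exact_mod_cast Nat.lt_succ_iff.1 this
    have hjp : (0 : ℝ) < (j : ℝ) + 1 := by positivity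
    have habs : |h * ((j : ℝ) + 1)| = |h| * ((j : ℝ) + 1) := by
      rw [abs_mul, abs_of_pos hjp]
    have A1 := hQv (x + h) (hxh.trans hδv') (h * ((j : ℝ) + 1)) (by
      rw [habs]
      refine le_trans ?_ hδv
      exact mul_le_mul hh (by linarith) hjp.le hδ.le)
    have A2 := hQ j x (hx.trans (hδd j hj)) h (hh.trans (hδd j hj))
    rw [habs, Real.mul_rpow hpos.le hjp.le] at A1
    simp only [mul_zero, add_zero, mul_one] at A1 A2
    rw [abs_le] at A1 A2 ⊢
    constructor <;> nlinarith [A1.1, A1.2, A2.1, A2.2]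
  rw [hRe, ← sub_mul, abs_mul, show e = (m + α) + 1 by rw [he]; ring,
    Real.rpow_add_one hpos.ne', ← mul_assoc] at main
  rw [show (m : ℝ) + α + 1 = e by rw [he]; ring] at main
  exact le_of_mul_le_mul_right main hpos

open Polynomial in
lemma local_coeff_aux (m : ℕ) (α : ℝ) (hα : 0 < α) (g : ℝ → ℝ) (x0 : ℝ)
    (hP : ∃ (δ M : ℝ) (P : ℝ → ℝ[X]), 0 < δ ∧ 0 ≤ M ∧ ∀ x : ℝ, |x - x0| ≤ δ →
      (P x).natDegree ≤ m ∧ ∀ h : ℝ, h ≠ 0 → |h| ≤ δ → |x + h - x0| ≤ δ →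
        |g (x + h) - (P x).eval h| ≤ M * |h| ^ ((m : ℝ) + α)) :
    ∃ (δ : ℝ) (P : ℝ → ℝ[X]), 0 < δ ∧ (∀ x, |x - x0| < δ → (P x).natDegree ≤ m) ∧
      (∀ x, |x - x0| < δ → g x = (P x).coeff 0) ∧
      ∀ k : ℕ, ∃ C : ℝ, 0 ≤ C ∧ ∀ x y, |x - x0| < δ → |y - x0| < δ → y ≠ x →
        |(P y).coeff k - (taylor (y - x) (P x)).coeff k| ≤ C * |y - x| ^ ((m : ℝ) + α - k) := by
  obtain ⟨δ, M, P, hδ, hM, hP⟩ := hP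
  have hmn : (0 : ℝ) ≤ m := Nat.cast_nonneg m
  set ε : ℝ := δ / (2 * m + 6) with hε
  have hεp : 0 < ε := by positivity
  have hεδ : ε * (2 * m + 6) = δ := div_mul_cancel₀ _ (by positivity)
  have hle : ε ≤ δ := by nlinarith
  have hcoef : ∀ k : ℕ, ∃ C : ℝ, 0 ≤ C ∧ ∀ x y, |x - x0| < ε → |y - x0| < ε → y ≠ x →
        |(P y).coeff k - (taylor (y - x) (P x)).coeff k| ≤ C * |y - x| ^ ((m : ℝ) + α - k) := by
    intro k
    obtain ⟨b, hb⟩ := interp_aux m k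
    refine ⟨∑ i ∈ Finset.range (m + 1), |b i| * (2 * M * ((m : ℝ) + 2) ^ ((m : ℝ) + α)),
      Finset.sum_nonneg fun i _ => by positivity, ?_⟩
    intro x y hx hy hxy
    set h := y - x with hh
    have h0 : h ≠ 0 := sub_ne_zero.2 hxy
    have hpos : 0 < |h| := abs_pos.2 h0
    have hh2 : |h| ≤ 2 * ε := by
      rw [abs_lt] at hx hy
      rw [abs_le]
      constructor <;> linarith [hx.1, hx.2, hy.1, hy.2]
    have hPx := hP x (hx.le.trans hle)
    have hPy := hP y (hy.le.trans hle)
    have hD := hb (P y - taylor h (P x)) (by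
      refine (natDegree_sub_le _ _).trans (max_le hPy.1 ?_)
      rw [natDegree_taylor]
      exact hPx.1) h
    have hDb : |(P y - taylor h (P x)).coeff k * h ^ k| ≤
        (∑ i ∈ Finset.range (m + 1), |b i| * (2 * M * ((m : ℝ) + 2) ^ ((m : ℝ) + α)))
          * |h| ^ ((m : ℝ) + α) := by
      rw [hD, Finset.sum_mul]
      refine (Finset.abs_sum_le_sum_abs _ _).trans (Finset.sum_le_sum fun i hi => ?_)
      rw [abs_mul, mul_assoc]
      refine mul_le_mul_of_nonneg_left ?_ (abs_nonneg _)
      have him : (i : ℝ) ≤ m := by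
        have := Finset.mem_range.1 hi
        exact_mod_cast Nat.lt_succ_iff.1 this
      have hi0 : (0 : ℝ) ≤ i := Nat.cast_nonneg i
      rw [eval_sub, taylor_eval]
      have ez : x + (h * ((i : ℝ) + 1) + h) = y + h * ((i : ℝ) + 1) := by
        rw [hh]
        ring
      have a1 : |h * ((i : ℝ) + 1)| = |h| * ((i : ℝ) + 1) := by
        rw [abs_mul, abs_of_pos (a := (i : ℝ) + 1) (by positivity)]
      have a2 : |h * ((i : ℝ) + 1) + h| = |h| * ((i : ℝ) + 2) := by
        rw [show h * ((i : ℝ) + 1) + h = h * (i + 2) by ring, abs_mul,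
          abs_of_pos (a := (i : ℝ) + 2) (by positivity)]
      have b1 : |h| * ((i : ℝ) + 2) ≤ δ := by
        calc |h| * ((i : ℝ) + 2) ≤ (2 * ε) * (m + 2) := by gcongr
          _ ≤ δ := by nlinarith
      have b0 : |h| * ((i : ℝ) + 1) ≤ δ := by nlinarith
      have b2 : |y + h * ((i : ℝ) + 1) - x0| ≤ δ := by
        calc |y + h * ((i : ℝ) + 1) - x0| = |(y - x0) + h * ((i : ℝ) + 1)| := by ring_nf
          _ ≤ |y - x0| + |h| * ((i : ℝ) + 1) := by
            rw [← a1]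
            exact abs_add_le _ _
          _ ≤ ε + (2 * ε) * (m + 1) := by gcongr
          _ ≤ δ := by nlinarith
      have c1 := hPx.2 (h * ((i : ℝ) + 1) + h) (by
        rw [← abs_pos, a2]
        positivity) (by rwa [a2]) (by rwa [ez])
      have c2 := hPy.2 (h * ((i : ℝ) + 1)) (by
        rw [← abs_pos, a1]
        positivity) (by rwa [a1]) b2
      rw [ez, a2] at c1
      rw [a1] at c2
      have d1 : M * (|h| * ((i : ℝ) + 2)) ^ ((m : ℝ) + α) ≤
          M * (((m : ℝ) + 2) ^ ((m : ℝ) + α) * |h| ^ ((m : ℝ) + α)) := by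
        rw [← Real.mul_rpow (by positivity) hpos.le, mul_comm |h|]
        gcongr
      have d2 : M * (|h| * ((i : ℝ) + 1)) ^ ((m : ℝ) + α) ≤
          M * (((m : ℝ) + 2) ^ ((m : ℝ) + α) * |h| ^ ((m : ℝ) + α)) := by
        rw [← Real.mul_rpow (by positivity) hpos.le, mul_comm |h|]
        gcongr
        linarith
      have c1' := abs_le.1 (c1.trans d1)
      have c2' := abs_le.1 (c2.trans d2)
      rw [abs_le]
      constructor <;> linarith [c1'.1, c1'.2, c2'.1, c2'.2]
    rw [coeff_sub, abs_mul, abs_pow] at hDb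
    rw [Real.rpow_sub hpos, Real.rpow_natCast, ← mul_div_assoc, le_div_iff₀ (by positivity)]
    exact hDb
  refine ⟨ε, P, hεp, fun x hx => (hP x (hx.le.trans hle)).1, ?_, hcoef⟩
  intro y hy
  obtain ⟨C, hC0, hC⟩ := hcoef 0
  have hlim : Filter.Tendsto (fun x => (M + C) * |y - x| ^ ((m : ℝ) + α))
      (nhdsWithin y {y}ᶜ) (nhds 0) := by
    have : ContinuousAt (fun x => (M + C) * |y - x| ^ ((m : ℝ) + α)) y := by
      refine ContinuousAt.mul continuousAt_const ?_
      exact ContinuousAt.rpow_const (by fun_prop) (Or.inr (by positivity))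
    have h2 := this.tendsto
    simp only [sub_self, abs_zero] at h2
    rw [Real.zero_rpow (by positivity), mul_zero] at h2
    exact h2.mono_left nhdsWithin_le_nhds
  have hopen : ∀ᶠ x in nhds y, |x - x0| < ε := by
    have : ContinuousAt (fun x => |x - x0|) y := by fun_prop
    exact this.eventually (gt_mem_nhds hy)
  have hfin : |g y - (P y).coeff 0| ≤ 0 := by
    refine ge_of_tendsto hlim ?_
    filter_upwards [nhdsWithin_le_nhds hopen, self_mem_nhdsWithin] with x hx hne
    have hne' : y ≠ x := fun h => hne h.symm
    have h1 := hC x y hx hy hne'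
    rw [taylor_coeff_zero, Nat.cast_zero, sub_zero] at h1
    have hyx : |y - x| ≤ δ := by
      have hx' := abs_lt.1 hx
      have hy' := abs_lt.1 hy
      rw [abs_le]
      constructor <;> nlinarith [hx'.1, hx'.2, hy'.1, hy'.2]
    have h2 := (hP x (hx.le.trans hle)).2 (y - x) (sub_ne_zero.2 hne') hyx
      (by rw [add_sub_cancel]; exact hy.le.trans hle)
    rw [add_sub_cancel] at h2
    rw [abs_le] at h1 h2 ⊢
    constructor <;> linarith [h1.1, h1.2, h2.1, h2.2]
  have := abs_nonpos_iff.1 hfin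
  linarith

open Polynomial in
lemma local_res_aux (m : ℕ) (α : ℝ) (hα : 0 < α) (g : ℝ → ℝ) (x0 : ℝ)
    (hP : ∃ (δ M : ℝ) (P : ℝ → ℝ[X]), 0 < δ ∧ 0 ≤ M ∧ ∀ x : ℝ, |x - x0| ≤ δ →
      (P x).natDegree ≤ m ∧ ∀ h : ℝ, h ≠ 0 → |h| ≤ δ → |x + h - x0| ≤ δ →
        |g (x + h) - (P x).eval h| ≤ M * |h| ^ ((m : ℝ) + α)) :
    ∃ δ C : ℝ, 0 < δ ∧ 0 ≤ C ∧
      (∀ k < m, ∀ x, |x - x0| < δ → DifferentiableAt ℝ (iteratedDeriv k g) x) ∧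
      ∀ x y, |x - x0| < δ → |y - x0| < δ →
        |iteratedDeriv m g y - iteratedDeriv m g x| ≤ C * |y - x| ^ α := by
  obtain ⟨δ, P, hδ, hdeg, hg, hco⟩ := local_coeff_aux m α hα g x0 hP
  have hopen : ∀ y, |y - x0| < δ → ∀ᶠ x in nhds y, |x - x0| < δ := by
    intro y hy
    have : ContinuousAt (fun x => |x - x0|) y := by fun_prop
    exact this.eventually (gt_mem_nhds hy)
  have hder : ∀ k < m, ∀ x, |x - x0| < δ →
      HasDerivAt (fun y => (P y).coeff k) (((k : ℝ) + 1) * (P x).coeff (k + 1)) x := by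
    intro k hk x hx
    obtain ⟨C, hC0, hC⟩ := hco k
    have hkm : (k : ℝ) + 1 ≤ m := by exact_mod_cast hk
    refine deriv_aux _ (fun y => (taylor (y - x) (P x)).coeff k) _ _ C ((m : ℝ) + α - k)
      (by linarith) ?_ ?_ ?_
    · simp only [taylor_coeff]
      have h1 := ((hasseDeriv k (P x)).hasDerivAt (x - x)).comp_sub_const x x
      rw [sub_self, ← coeff_zero_eq_eval_zero, coeff_derivative, hasseDeriv_coeff, Nat.cast_zero,
        zero_add, zero_add, mul_one, add_comm 1 k, Nat.choose_succ_self_right] at h1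
      exact_mod_cast h1
    · simp
    · filter_upwards [hopen x hx] with y hy hne
      exact hC x y hx hy hne
  have hit : ∀ k ≤ m, ∀ x, |x - x0| < δ →
      iteratedDeriv k g x = (k.factorial : ℝ) * (P x).coeff k := by
    intro k
    induction k with
    | zero =>
      intro _ x hx
      simpa using hg x hx
    | succ k ih =>
      intro hk x hx
      rw [iteratedDeriv_succ]
      have he : iteratedDeriv k g =ᶠ[nhds x] fun y => (k.factorial : ℝ) * (P y).coeff k := by
        filter_upwards [hopen x hx] with y hy
        exact ih (by omega) y hy
      rw [he.deriv_eq, ((hder k (by omega) x hx).const_mul _).deriv, Nat.factorial_succ]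
      push_cast
      ring
  obtain ⟨C, hC0, hC⟩ := hco m
  refine ⟨δ, m.factorial * C, hδ, by positivity, ?_, ?_⟩
  · intro k hk x hx
    have he : iteratedDeriv k g =ᶠ[nhds x] fun y => (k.factorial : ℝ) * (P y).coeff k := by
      filter_upwards [hopen x hx] with y hy
      exact hit k hk.le y hy
    exact he.differentiableAt_iff.2 ((hder k hk x hx).const_mul _).differentiableAt
  · intro x y hx hy
    rcases eq_or_ne y x with rfl | hne
    · simp only [sub_self, abs_zero]
      positivity
    have h1 := hC x y hx hy hne
    have h2 : (taylor (y - x) (P x)).coeff m = (P x).coeff m := by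
      rw [taylor_coeff]
      have hd : (hasseDeriv m (P x)).natDegree ≤ 0 := by
        refine (natDegree_hasseDeriv_le _ _).trans ?_
        have := hdeg x hx
        omega
      rw [eq_C_of_natDegree_le_zero hd, eval_C, hasseDeriv_coeff]
      simp
    rw [h2, show (m : ℝ) + α - m = α by ring] at h1
    rw [hit m le_rfl x hx, hit m le_rfl y hy, ← mul_sub, abs_mul,
      abs_of_nonneg (by positivity : (0 : ℝ) ≤ m.factorial), mul_assoc]
    gcongr

lemma global_aux (α : ℝ) (hα : 0 < α) (G : ℝ → ℝ) (hG : Continuous G)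
    (hloc : ∀ x0, ∃ δ C : ℝ, 0 < δ ∧ 0 ≤ C ∧ ∀ x y, |x - x0| < δ → |y - x0| < δ →
        |G y - G x| ≤ C * |y - x| ^ α) (K : Set ℝ) (hK : IsCompact K) :
    ∃ C : ℝ, ∀ p ∈ K ×ˢ K, |G p.2 - G p.1| ≤ C * |p.2 - p.1| ^ α := by
  refine (hK.prod hK).induction_on
    (p := fun S => ∃ C : ℝ, ∀ p ∈ S, |G p.2 - G p.1| ≤ C * |p.2 - p.1| ^ α) ?_ ?_ ?_ ?_
  · exact ⟨0, by simp⟩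
  · rintro s t hst ⟨C, hC⟩
    exact ⟨C, fun p hp => hC p (hst hp)⟩
  · rintro s t ⟨C, hC⟩ ⟨D, hD⟩
    refine ⟨max C D, ?_⟩
    rintro p (hp | hp)
    · refine (hC p hp).trans ?_
      gcongr
      exact le_max_left _ _
    · refine (hD p hp).trans ?_
      gcongr
      exact le_max_right _ _
  · rintro ⟨x, y⟩ _
    rcases eq_or_ne y x with rfl | hne
    · obtain ⟨δ, C, hδ, _, hC⟩ := hloc y
      refine ⟨Metric.ball y δ ×ˢ Metric.ball y δ, mem_nhdsWithin_of_mem_nhds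
        (prod_mem_nhds (Metric.ball_mem_nhds _ hδ) (Metric.ball_mem_nhds _ hδ)), C, ?_⟩
      rintro ⟨u, v⟩ ⟨hu, hv⟩
      exact hC u v hu hv
    · have hpos : 0 < |y - x| := abs_pos.2 (sub_ne_zero.2 hne)
      have hcont : ContinuousAt (fun p : ℝ × ℝ => |G p.2 - G p.1| / |p.2 - p.1| ^ α) (x, y) := by
        refine ContinuousAt.div (by fun_prop) ?_ (by positivity)
        exact ContinuousAt.rpow_const (by fun_prop) (Or.inr hα.le)
      have hne' : ∀ᶠ p : ℝ × ℝ in nhds (x, y), 0 < |p.2 - p.1| := by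
        have : ContinuousAt (fun p : ℝ × ℝ => |p.2 - p.1|) (x, y) := by fun_prop
        exact this.eventually (lt_mem_nhds hpos)
      have hb := hcont.eventually (gt_mem_nhds (lt_add_one _))
      refine ⟨_, mem_nhdsWithin_of_mem_nhds (hb.and hne'),
        |G y - G x| / |y - x| ^ α + 1, ?_⟩
      · rintro p ⟨h1, h2⟩
        have h3 : 0 < |p.2 - p.1| ^ α := by positivity
        exact ((div_lt_iff₀ h3).1 h1).le

/-- **Proposition 3.11.** If `f : ℝ² → ℝ` satisfies `f ∘ c ∈ C^{m+1,α}(ℝ)` for all smooth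
curves `c : ℝ → ℝ²`, then `∂₂ f(·,0)` exists and belongs to `C^{m,α}(ℝ)`. -/
theorem holder_induction_step (m : ℕ) (α : ℝ) (hα : α ∈ Set.Ioc (0 : ℝ) 1) (f : ℝ × ℝ → ℝ)
    (hf : ∀ c : ℝ → ℝ × ℝ, ContDiff ℝ (⊤ : ℕ∞) c → HolderClassR (m + 1) α (f ∘ c)) :
    (∀ x : ℝ, DifferentiableAt ℝ (fun s => f (x, s)) 0) ∧
      HolderClassR m α (fun x => deriv (fun s => f (x, s)) 0) := by
  have hα0 : 0 < α := hα.1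
  refine ⟨fun x => ?_, ?_⟩
  · have h := (hf (fun s => (x, s)) (contDiff_const.prodMk contDiff_id)).1
    exact (h.differentiable (by simp)).differentiableAt
  set g : ℝ → ℝ := fun x => deriv (fun s => f (x, s)) 0 with hg
  choose δ C hδ hC hdiff hhol using fun x0 =>
    local_res_aux m α hα0 g x0 (local_poly_aux m α hα0 f hf x0)
  have hd : ∀ k < m, Differentiable ℝ (iteratedDeriv k g) := fun k hk x =>
    hdiff x k hk x (by simpa using hδ x)
  have hcont : Continuous (iteratedDeriv m g) := by
    rw [continuous_iff_continuousAt]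
    intro x
    rw [ContinuousAt, tendsto_iff_norm_sub_tendsto_zero]
    have hlim : Filter.Tendsto (fun y => C x * |y - x| ^ α) (nhds x) (nhds 0) := by
      have : ContinuousAt (fun y => C x * |y - x| ^ α) x := by
        refine ContinuousAt.mul continuousAt_const ?_
        exact ContinuousAt.rpow_const (by fun_prop) (Or.inr hα0.le)
      have h2 := this.tendsto
      simp only [sub_self, abs_zero] at h2
      rwa [Real.zero_rpow hα0.ne', mul_zero] at h2
    refine squeeze_zero' (Filter.Eventually.of_forall fun _ => norm_nonneg _) ?_ hlim
    filter_upwards [Metric.ball_mem_nhds x (hδ x)] with y hy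
    exact hhol x x y (by simpa using hδ x) hy
  refine ⟨contDiff_nat_iff_iteratedDeriv.2 ⟨fun k hk => ?_, hd⟩, fun K hK => ?_⟩
  · rcases hk.lt_or_eq with h | rfl
    · exact (hd k h).continuous
    · exact hcont
  · obtain ⟨D, hD⟩ := global_aux α hα0 _ hcont
      (fun x0 => ⟨δ x0, C x0, hδ x0, hC x0, hhol x0⟩) K hK
    refine ⟨D, fun x h hx hxh _ => ?_⟩
    have := hD (x, x + h) ⟨hx, hxh⟩
    simpa using this
end

section
/- Let m ≥ 1 be an integer and f : ℝ → ℝ a function. Then f ∘ g ∈ Λ_{m+1}(ℝ) for every g ∈ Λ_{m+1}(ℝ) if and only if f ∈ Z^{m,1}(ℝ). -/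
/-- The local Zygmund class `Z^{m,1}(ℝ)`: `C^m` functions whose `m`-th derivative satisfies a
Zygmund (second difference) estimate on every compact set. -/
def ZygmundClassR (m : ℕ) (f : ℝ → ℝ) : Prop :=
  ContDiff ℝ m f ∧
    ∀ K : Set ℝ, IsCompact K →
      ∃ C : ℝ, ∀ x h : ℝ, x ∈ K → x + h ∈ K → x - h ∈ K → h ≠ 0 →
        |iteratedDeriv m f (x + h) - 2 * iteratedDeriv m f x + iteratedDeriv m f (x - h)|
          ≤ C * |h|

/-- The global Zygmund space `Λ_{m+1}(ℝ)`: `C^m` functions with bounded derivatives up to order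
`m` whose `m`-th derivative satisfies a global Zygmund estimate. -/
def GlobalZygmund (m : ℕ) (g : ℝ → ℝ) : Prop :=
  ContDiff ℝ m g ∧
    (∀ j ≤ m, ∃ M : ℝ, ∀ x : ℝ, |iteratedDeriv j g x| ≤ M) ∧
    ∃ C : ℝ, ∀ x h : ℝ, h ≠ 0 →
      |iteratedDeriv m g (x + h) - 2 * iteratedDeriv m g x + iteratedDeriv m g (x - h)|
        ≤ C * |h|

/-- The exponent `2/3` modulus. -/
noncomputable def zmod (t : ℝ) : ℝ := |t| ^ (2 / 3 : ℝ)

lemma zmod_nonneg (t : ℝ) : 0 ≤ zmod t := Real.rpow_nonneg (abs_nonneg t) _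

lemma le_zmod {t : ℝ} (ht : |t| ≤ 1) : |t| ≤ zmod t := by
  have := Real.rpow_le_rpow_of_exponent_ge' (abs_nonneg t) ht (by norm_num : (0:ℝ) ≤ 2/3)
    (by norm_num : (2/3 : ℝ) ≤ 1)
  simpa [zmod] using this

lemma one_le_zmod {t : ℝ} (ht : 1 ≤ |t|) : 1 ≤ zmod t :=
  Real.one_le_rpow ht (by norm_num)

lemma zmod_mono {s t : ℝ} (h : |s| ≤ |t|) : zmod s ≤ zmod t :=
  Real.rpow_le_rpow (abs_nonneg s) h (by norm_num)

lemma zmod_mul (s t : ℝ) : zmod (s * t) = zmod s * zmod t := by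
  unfold zmod
  rw [abs_mul, Real.mul_rpow (abs_nonneg s) (abs_nonneg t)]

lemma zmod_two : zmod 2 ≤ 1.6 := by
  unfold zmod
  rw [abs_of_pos (by norm_num : (0:ℝ) < 2)]
  have h : (1.6 : ℝ) = ((1.6 : ℝ) ^ (3/2 : ℝ)) ^ (2/3 : ℝ) := by
    rw [← Real.rpow_mul (by norm_num)]; norm_num
  rw [h]
  apply Real.rpow_le_rpow (by norm_num) _ (by norm_num)
  have h2 : ((1.6 : ℝ) ^ (3/2 : ℝ)) ^ 2 = 1.6 ^ 3 := by
    rw [← Real.rpow_natCast, ← Real.rpow_mul (by norm_num), ← Real.rpow_natCast]; norm_num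
  have h3 : 0 ≤ (1.6 : ℝ) ^ (3/2 : ℝ) := by positivity
  nlinarith

lemma zmod_sq {t : ℝ} (ht : |t| ≤ 1) : zmod t * zmod t ≤ |t| := by
  unfold zmod
  rw [← Real.rpow_add_of_nonneg (abs_nonneg t) (by norm_num) (by norm_num)]
  have := Real.rpow_le_rpow_of_exponent_ge' (abs_nonneg t) ht (by norm_num : (0:ℝ) ≤ 1)
    (by norm_num : (1 : ℝ) ≤ 2/3 + 2/3)
  simpa using this

lemma zmod_zmod {t : ℝ} (ht : |t| ≤ 1) : zmod (t * zmod t) ≤ |t| := by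
  rw [zmod_mul]
  have h : zmod (zmod t) ≤ |t| ^ (1/3 : ℝ) := by
    have e : zmod (zmod t) = |t| ^ (4/9 : ℝ) := by
      have : zmod (zmod t) = (zmod t) ^ (2/3 : ℝ) := by
        change |zmod t| ^ (2/3 : ℝ) = _
        rw [abs_of_nonneg (zmod_nonneg t)]
      rw [this]
      unfold zmod
      rw [← Real.rpow_mul (abs_nonneg t)]; norm_num
    rw [e]
    exact Real.rpow_le_rpow_of_exponent_ge' (abs_nonneg t) ht (by norm_num) (by norm_num)
  calc zmod t * zmod (zmod t) ≤ zmod t * |t| ^ (1/3 : ℝ) :=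
        mul_le_mul_of_nonneg_left h (zmod_nonneg t)
    _ = |t| := by
        unfold zmod
        rw [← Real.rpow_add_of_nonneg (abs_nonneg t) (by norm_num) (by norm_num)]
        norm_num

/-- Zygmund functions are Hölder. -/
lemma holder_pt {F : ℝ → ℝ} {x M C : ℝ} (hC0 : 0 ≤ C)
    (hM : ∀ t, |t - x| ≤ 2 → |F t| ≤ M)
    (hC : ∀ t h, |t - x| ≤ 2 → |t + h - x| ≤ 2 → |t - h - x| ≤ 2 →
      |F (t + h) - 2 * F t + F (t - h)| ≤ C * |h|) :
    ∀ h, |h| ≤ 2 → |F (x + h) - F x| ≤ (2 * M + 3 * C) * zmod h := by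
  have hx := hM x (by simp)
  have hM0 : 0 ≤ M := (abs_nonneg _).trans hx
  have key : ∀ n : ℕ, ∀ h, |h| ≤ 2 → 1 ≤ 2 ^ n * |h| →
      |F (x + h) - F x| ≤ (2 * M + 3 * C) * zmod h := by
    intro n
    induction n with
    | zero =>
      intro h h2 h1
      have h3 := one_le_zmod (t := h) (by simpa using h1)
      have h4 := hM (x + h) (by simpa using h2)
      have h5 : |F (x + h) - F x| ≤ 2 * M := by
        rw [abs_le] at *; constructor <;> linarith
      nlinarith
    | succ n ih =>
      intro h h2 h1
      by_cases hh : 1 ≤ |h|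
      · have h3 := one_le_zmod (t := h) hh
        have h4 := hM (x + h) (by simpa using h2)
        have h5 : |F (x + h) - F x| ≤ 2 * M := by
          rw [abs_le] at *; constructor <;> linarith
        nlinarith
      · push Not at hh
        have e : |2 * h| = 2 * |h| := by rw [abs_mul]; norm_num
        have i1 := ih (2 * h) (by rw [e]; linarith) (by rw [e]; rw [pow_succ] at h1; linarith)
        have i2 := hC (x + h) h (by simpa using h2)
          (by rw [show x + h + h - x = 2 * h by ring, e]; linarith)
          (by simp)
        rw [show x + h + h = x + 2 * h by ring, show x + h - h = x by ring] at i2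
        rw [zmod_mul] at i1
        have i3 := le_zmod hh.le
        have i4 := zmod_two
        have i5 := zmod_nonneg h
        have i6 : (2 * M + 3 * C) * (zmod 2 * zmod h) ≤ (2 * M + 3 * C) * (1.6 * zmod h) := by
          gcongr
        have i7 : C * |h| ≤ C * zmod h := by gcongr
        have i8 : 0 ≤ M * zmod h := by positivity
        have i9 : 0 ≤ C * zmod h := by positivity
        rw [abs_le] at *
        constructor <;> linarith
  intro h h2
  by_cases h0 : h = 0
  · subst h0; simp; have := zmod_nonneg 0; positivity
  · obtain ⟨n, hn⟩ := pow_unbounded_of_one_lt (1 / |h|) (by norm_num : (1:ℝ) < 2)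
    have : 0 < |h| := abs_pos.2 h0
    exact key n h h2 (by rw [div_lt_iff₀ this] at hn; exact hn.le)

/-- The algebra of bounded, Hölder, Zygmund functions. -/
structure ZA (u : ℝ → ℝ) : Prop where
  bdd : ∃ M, ∀ x, |u x| ≤ M
  hol : ∃ K, ∀ x y, |u x - u y| ≤ K * zmod (x - y)
  zyg : ∃ C, ∀ x h, |u (x + h) - 2 * u x + u (x - h)| ≤ C * |h|

/-- It suffices to check Hölder and Zygmund bounds at small scale. -/
lemma ZA.mk' {u : ℝ → ℝ} {M K C : ℝ} (hM : ∀ x, |u x| ≤ M)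
    (hK : ∀ x y, |x - y| ≤ 1 → |u x - u y| ≤ K * zmod (x - y))
    (hC : ∀ x h, |h| ≤ 1 → |u (x + h) - 2 * u x + u (x - h)| ≤ C * |h|) : ZA u := by
  have hM0 : 0 ≤ M := (abs_nonneg _).trans (hM 0)
  refine ⟨⟨M, hM⟩, ⟨max K (2 * M), fun x y => ?_⟩, ⟨max C (4 * M), fun x h => ?_⟩⟩
  · rcases le_total |x - y| 1 with h | h
    · exact (hK x y h).trans (mul_le_mul_of_nonneg_right (le_max_left _ _) (zmod_nonneg _))
    · refine le_trans ?_ (mul_le_mul_of_nonneg_right (le_max_right _ _) (zmod_nonneg _))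
      have h1 := one_le_zmod h
      have h2 := hM x
      have h3 := hM y
      have h4 : 2 * M * 1 ≤ 2 * M * zmod (x - y) := by gcongr
      rw [abs_le] at *; constructor <;> linarith
  · rcases le_total |h| 1 with h1 | h1
    · exact (hC x h h1).trans (mul_le_mul_of_nonneg_right (le_max_left _ _) (abs_nonneg _))
    · refine le_trans ?_ (mul_le_mul_of_nonneg_right (le_max_right _ _) (abs_nonneg _))
      have h2 := hM x
      have h3 := hM (x + h)
      have h5 := hM (x - h)
      have h4 : 4 * M * 1 ≤ 4 * M * |h| := by gcongr
      rw [abs_le (b := M)] at *; rw [abs_le]; constructor <;> linarith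

lemma ZA.of_lip {u : ℝ → ℝ} {M L : ℝ} (hM : ∀ x, |u x| ≤ M)
    (hL : ∀ x y, |u x - u y| ≤ L * |x - y|) : ZA u := by
  have hL0 : 0 ≤ L := by
    have := (abs_nonneg _).trans (hL 1 0); simpa using this
  refine ZA.mk' (K := L) (C := 2 * L) hM (fun x y h => (hL x y).trans ?_) (fun x h _ => ?_)
  · have := le_zmod h; gcongr
  · have h1 := hL (x + h) x
    have h2 := hL (x - h) x
    simp only [add_sub_cancel_left, sub_sub_cancel_left, abs_neg] at h1 h2
    rw [abs_le] at h1 h2 ⊢; constructor <;> linarith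

lemma ZA.const (c : ℝ) : ZA (fun _ => c) :=
  ZA.of_lip (M := |c|) (L := 0) (fun _ => le_rfl) (by simp)

lemma ZA.add {u v : ℝ → ℝ} (hu : ZA u) (hv : ZA v) : ZA (fun x => u x + v x) := by
  obtain ⟨⟨M, hM⟩, ⟨K, hK⟩, ⟨C, hC⟩⟩ := hu
  obtain ⟨⟨M', hM'⟩, ⟨K', hK'⟩, ⟨C', hC'⟩⟩ := hv
  refine ⟨⟨M + M', fun x => ?_⟩, ⟨K + K', fun x y => ?_⟩, ⟨C + C', fun x h => ?_⟩⟩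
  · exact (abs_add_le _ _).trans (add_le_add (hM x) (hM' x))
  · rw [add_mul, add_sub_add_comm]
    exact (abs_add_le _ _).trans (add_le_add (hK x y) (hK' x y))
  · rw [add_mul]
    refine le_trans (le_of_eq ?_) ((abs_add_le _ _).trans (add_le_add (hC x h) (hC' x h)))
    congr 1; ring

lemma ZA.sum {ι : Type*} (s : Finset ι) {u : ι → ℝ → ℝ} (hu : ∀ i ∈ s, ZA (u i)) :
    ZA (fun x => ∑ i ∈ s, u i x) := by
  classical
  induction s using Finset.induction_on with
  | empty => simpa using ZA.const 0
  | insert a s ha ih =>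
    simp only [Finset.sum_insert ha]
    exact (hu a (by simp)).add (ih fun i hi => hu i (by simp [hi]))

lemma ZA.mul {u v : ℝ → ℝ} (hu : ZA u) (hv : ZA v) : ZA (fun x => u x * v x) := by
  obtain ⟨⟨M, hM⟩, ⟨K, hK⟩, ⟨C, hC⟩⟩ := hu
  obtain ⟨⟨M', hM'⟩, ⟨K', hK'⟩, ⟨C', hC'⟩⟩ := hv
  have hM0 : 0 ≤ M := (abs_nonneg _).trans (hM 0)
  have hM0' : 0 ≤ M' := (abs_nonneg _).trans (hM' 0)
  have hz1 : zmod 1 = 1 := by simp [zmod]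
  have hK0 : 0 ≤ K := by
    have := (abs_nonneg _).trans (hK 1 0); simpa [hz1] using this
  have hK0' : 0 ≤ K' := by
    have := (abs_nonneg _).trans (hK' 1 0); simpa [hz1] using this
  refine ZA.mk' (M := M * M') (K := M * K' + K * M') (C := M * C' + C * M' + 2 * (K * K'))
    (fun x => ?_) (fun x y _ => ?_) (fun x h h1 => ?_)
  · rw [abs_mul]; exact mul_le_mul (hM x) (hM' x) (abs_nonneg _) hM0
  · have e : u x * v x - u y * v y = u x * (v x - v y) + (u x - u y) * v y := by ring
    rw [e]
    refine (abs_add_le _ _).trans ?_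
    rw [abs_mul, abs_mul]
    have a1 : |u x| * |v x - v y| ≤ M * (K' * zmod (x - y)) :=
      mul_le_mul (hM x) (hK' x y) (abs_nonneg _) hM0
    have a2 : |u x - u y| * |v y| ≤ (K * zmod (x - y)) * M' :=
      mul_le_mul (hK x y) (hM' y) (abs_nonneg _) (mul_nonneg hK0 (zmod_nonneg _))
    linarith
  · have e : u (x + h) * v (x + h) - 2 * (u x * v x) + u (x - h) * v (x - h)
      = u x * (v (x + h) - 2 * v x + v (x - h)) + (u (x + h) - 2 * u x + u (x - h)) * v x
        + (u (x + h) - u x) * (v (x + h) - v x) + (u (x - h) - u x) * (v (x - h) - v x) := by ring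
    rw [e]
    have zneg : zmod (-h) = zmod h := by simp [zmod]
    have a1 : |u x * (v (x + h) - 2 * v x + v (x - h))| ≤ M * (C' * |h|) := by
      rw [abs_mul]; exact mul_le_mul (hM x) (hC' x h) (abs_nonneg _) hM0
    have a2 : |(u (x + h) - 2 * u x + u (x - h)) * v x| ≤ C * |h| * M' := by
      rw [abs_mul]
      exact mul_le_mul (hC x h) (hM' x) (abs_nonneg _) ((abs_nonneg _).trans (hC x h))
    have a5 : K * zmod h * (K' * zmod h) ≤ K * K' * |h| := by
      have := mul_le_mul_of_nonneg_left (zmod_sq h1) (mul_nonneg hK0 hK0')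
      linarith
    have a3 : |(u (x + h) - u x) * (v (x + h) - v x)| ≤ K * zmod h * (K' * zmod h) := by
      rw [abs_mul]
      have b1 := hK (x + h) x
      have b2 := hK' (x + h) x
      rw [add_sub_cancel_left] at b1 b2
      exact mul_le_mul b1 b2 (abs_nonneg _) (mul_nonneg hK0 (zmod_nonneg _))
    have a4 : |(u (x - h) - u x) * (v (x - h) - v x)| ≤ K * zmod h * (K' * zmod h) := by
      rw [abs_mul]
      have b1 := hK (x - h) x
      have b2 := hK' (x - h) x
      rw [sub_sub_cancel_left, zneg] at b1 b2
      exact mul_le_mul b1 b2 (abs_nonneg _) (mul_nonneg hK0 (zmod_nonneg _))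
    refine (abs_add_le _ _).trans ?_
    refine (add_le_add_left ((abs_add_le _ _).trans
      (add_le_add_left (abs_add_le _ _) _)) _).trans ?_
    linarith

lemma lip_of_deriv_bdd {u : ℝ → ℝ} {L : ℝ} (hd : Differentiable ℝ u)
    (hL : ∀ x, |deriv u x| ≤ L) (x y : ℝ) : |u x - u y| ≤ L * |x - y| := by
  have := convex_univ.norm_image_sub_le_of_norm_deriv_le (f := u) (C := L) (x := y) (y := x)
    (fun x _ => hd x) (fun x _ => by simpa using hL x) (Set.mem_univ _) (Set.mem_univ _)
  simpa using this

/-- All derivatives of a global Zygmund function are in the algebra. -/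
lemma GlobalZygmund.za {m : ℕ} {g : ℝ → ℝ} (hg : GlobalZygmund m g) {j : ℕ} (hj : j ≤ m) :
    ZA (iteratedDeriv j g) := by
  obtain ⟨hc, hb, C, hC⟩ := hg
  obtain ⟨M, hM⟩ := hb j hj
  rcases hj.lt_or_eq with h | rfl
  · obtain ⟨L, hL⟩ := hb (j + 1) h
    rw [iteratedDeriv_succ] at hL
    exact ZA.of_lip hM (lip_of_deriv_bdd
      (hc.differentiable_iteratedDeriv j (by exact_mod_cast h)) hL)
  · have hC' : ∀ x h : ℝ, |iteratedDeriv j g (x + h) - 2 * iteratedDeriv j g x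
        + iteratedDeriv j g (x - h)| ≤ max C 0 * |h| := by
      intro x h
      by_cases h0 : h = 0
      · subst h0; simp; ring_nf
      · exact (hC x h h0).trans (mul_le_mul_of_nonneg_right (le_max_left _ _) (abs_nonneg _))
    refine ZA.mk' (K := 2 * M + 3 * max C 0) hM (fun x y hxy => ?_) (fun x h _ => hC' x h)
    have := holder_pt (F := iteratedDeriv j g) (x := y) (le_max_right C 0) (fun t _ => hM t)
      (fun t h _ _ _ => hC' t h) (x - y) (by linarith)
    simpa using this

/-- Derivatives of compositions stay in the algebra. -/
lemma ZA.comp_iter (n : ℕ) : ∀ (f g : ℝ → ℝ), ContDiff ℝ n f → ContDiff ℝ n g →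
    (∀ j ≤ n, ZA (iteratedDeriv j f ∘ g)) → (∀ j ≤ n, ZA (iteratedDeriv j g)) →
    ∀ j ≤ n, ZA (iteratedDeriv j (f ∘ g)) := by
  induction n with
  | zero =>
    intro f g _ _ hf _ j hj
    obtain rfl : j = 0 := by omega
    simpa using hf 0 le_rfl
  | succ n ih =>
    intro f g cf cg hf hg j hj
    rcases j with _ | j
    · simpa using hf 0 (by omega)
    have cf' := (contDiff_succ_iff_deriv (n := (n : WithTop ℕ∞))).1 (by exact_mod_cast cf)
    have cg' := (contDiff_succ_iff_deriv (n := (n : WithTop ℕ∞))).1 (by exact_mod_cast cg)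
    have cgn : ContDiff ℝ n g := cg.of_le (by exact_mod_cast Nat.le_succ n)
    have e : deriv (f ∘ g) = (deriv f ∘ g) * deriv g := by
      funext x
      exact deriv_comp x (cf'.1 _) (cg'.1 _)
    have hjn : j ≤ n := by omega
    have hjn' : (j : WithTop ℕ∞) ≤ n := by exact_mod_cast hjn
    have e2 : iteratedDeriv (j + 1) (f ∘ g) = fun x => ∑ i ∈ Finset.range (j + 1),
        (j.choose i : ℝ) * iteratedDeriv i (deriv f ∘ g) x * iteratedDeriv (j - i) (deriv g) x := by
      funext x
      rw [iteratedDeriv_succ', e]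
      exact iteratedDeriv_mul ((cf'.2.2.comp cgn).of_le hjn').contDiffAt
        (cg'.2.2.of_le hjn').contDiffAt
    rw [e2]
    apply ZA.sum
    intro i hi
    have hi' : i ≤ n := by have := Finset.mem_range.1 hi; omega
    refine ((ZA.const _).mul (ih (deriv f) g cf'.2.2 cgn (fun k hk => ?_)
      (fun k hk => hg k (by omega)) i hi')).mul ?_
    · rw [← iteratedDeriv_succ']; exact hf (k + 1) (by omega)
    · rw [← iteratedDeriv_succ']; exact hg (j - i + 1) (by omega)

/-- Composition of a locally Zygmund function with a `C^{1}` function. -/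
lemma ZA.comp_zyg {F g : ℝ → ℝ} (hF : Continuous F)
    (hZ : ∀ K : Set ℝ, IsCompact K → ∃ C : ℝ, ∀ x h : ℝ, x ∈ K → x + h ∈ K → x - h ∈ K → h ≠ 0 →
        |F (x + h) - 2 * F x + F (x - h)| ≤ C * |h|)
    (hd : Differentiable ℝ g) (hg : ZA g) (hg' : ZA (deriv g)) : ZA (F ∘ g) := by
  obtain ⟨R, hR⟩ := hg.bdd
  obtain ⟨L, hL⟩ := hg'.bdd
  obtain ⟨K1, hK1⟩ := hg'.hol
  have hL0 : 0 ≤ L := (abs_nonneg _).trans (hL 0)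
  have hR0 : 0 ≤ R := (abs_nonneg _).trans (hR 0)
  have hz1 : zmod 1 = 1 := by simp [zmod]
  have hK0 : 0 ≤ K1 := by
    have := (abs_nonneg _).trans (hK1 1 0); simpa [hz1] using this
  have hlip := lip_of_deriv_bdd hd hL
  -- the compact set
  set B := R + L + 2 with hB
  obtain ⟨C0, hC0⟩ := hZ (Set.Icc (-B) B) isCompact_Icc
  obtain ⟨M, hM⟩ := isCompact_Icc.exists_bound_of_continuousOn (hF.continuousOn (s := Set.Icc (-B) B))
  have hM' : ∀ t, |t| ≤ B → |F t| ≤ M := fun t ht => by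
    simpa using hM t (abs_le.1 ht)
  set C := max C0 0 with hCdef
  have hC : ∀ t h, |t| ≤ B → |t + h| ≤ B → |t - h| ≤ B →
      |F (t + h) - 2 * F t + F (t - h)| ≤ C * |h| := by
    intro t h h1 h2 h3
    by_cases h0 : h = 0
    · subst h0; simp; ring_nf
    · exact (hC0 t h (abs_le.1 h1) (abs_le.1 h2) (abs_le.1 h3) h0).trans
        (mul_le_mul_of_nonneg_right (le_max_left _ _) (abs_nonneg _))
  have hCnn : 0 ≤ C := le_max_right _ _
  have hMnn : 0 ≤ M := (abs_nonneg _).trans (hM' 0 (by simp; positivity))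
  set K := max (2 * M + 3 * C) (2 * M) with hKdef
  have hKnn : 0 ≤ K := by rw [hKdef]; positivity
  have hH : ∀ s t, |s| ≤ R + L → |t| ≤ R + L → |F s - F t| ≤ K * zmod (s - t) := by
    intro s t hs ht
    rcases le_total |s - t| 2 with h | h
    · have hloc : ∀ r, |r - t| ≤ 2 → |r| ≤ B := by
        intro r hr
        rw [abs_le] at *; constructor <;> linarith
      have := holder_pt (F := F) (x := t) (M := M) hCnn (fun r hr => hM' r (hloc r hr))
        (fun r h h1 h2 h3 => hC r h (hloc _ h1) (hloc _ h2) (hloc _ h3)) (s - t) h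
      rw [add_sub_cancel] at this
      exact this.trans (mul_le_mul_of_nonneg_right (le_max_left _ _) (zmod_nonneg _))
    · have h1 := one_le_zmod (t := s - t) (by linarith)
      have h2 := hM' s (by linarith)
      have h3 := hM' t (by linarith)
      refine le_trans ?_ (mul_le_mul_of_nonneg_right (le_max_right _ _) (zmod_nonneg _))
      have h4 : 2 * M * 1 ≤ 2 * M * zmod (s - t) := by gcongr
      rw [abs_le (b := M)] at h2 h3; rw [abs_le]; constructor <;> linarith
  have taylor : ∀ x h, |g (x + h) - (g x + deriv g x * h)| ≤ K1 * |h * zmod h| := by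
    intro x h
    have hder : ∀ t, HasDerivAt (fun t => g t - deriv g x * t) (deriv g t - deriv g x) t := by
      intro t
      have := (hd t).hasDerivAt.sub ((hasDerivAt_id t).const_mul (deriv g x))
      rw [mul_one] at this
      exact this
    have := (convex_uIcc x (x + h)).norm_image_sub_le_of_norm_hasDerivWithin_le
      (f := fun t => g t - deriv g x * t) (C := K1 * zmod h) (x := x) (y := x + h)
      (fun t _ => (hder t).hasDerivWithinAt) (fun t ht => ?_)
      Set.left_mem_uIcc Set.right_mem_uIcc
    · rw [abs_mul, abs_of_nonneg (zmod_nonneg h)]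
      simp only [Real.norm_eq_abs, add_sub_cancel_left] at this
      refine le_trans (le_of_eq ?_) (this.trans (le_of_eq ?_))
      · congr 1; ring
      · ring
    · rw [Real.norm_eq_abs]
      refine (hK1 t x).trans (mul_le_mul_of_nonneg_left (zmod_mono ?_) hK0)
      have := Set.abs_sub_left_of_mem_uIcc ht
      simpa using this
  have close : ∀ x h, |h| ≤ 1 → |F (g (x + h)) - F (g x + deriv g x * h)|
      ≤ K * zmod K1 * |h| := by
    intro x h h1
    have ha : |deriv g x * h| ≤ L := by
      rw [abs_mul]
      calc |deriv g x| * |h| ≤ L * 1 := mul_le_mul (hL x) h1 (abs_nonneg _) hL0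
        _ = L := mul_one L
    have b1 := hH (g (x + h)) (g x + deriv g x * h) (by linarith [hR (x + h)])
      ((abs_add_le _ _).trans (add_le_add (hR x) ha))
    have b2 : zmod (g (x + h) - (g x + deriv g x * h)) ≤ zmod (K1 * (h * zmod h)) := by
      apply zmod_mono
      rw [abs_mul K1, abs_of_nonneg hK0]
      exact taylor x h
    rw [zmod_mul] at b2
    have b3 := mul_le_mul_of_nonneg_left (zmod_zmod h1) (zmod_nonneg K1)
    have b4 := mul_le_mul_of_nonneg_left (b2.trans b3) hKnn
    linarith
  refine ZA.mk' (M := M) (K := K * zmod L * 1 + K * zmod L) (C := 2 * (K * zmod K1) + C * L)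
    (fun x => hM' _ (by linarith [hR x])) (fun x y _ => ?_) (fun x h h1 => ?_)
  · have b1 := hH (g x) (g y) (by linarith [hR x]) (by linarith [hR y])
    have b2 : zmod (g x - g y) ≤ zmod (L * (x - y)) := by
      apply zmod_mono
      rw [abs_mul, abs_of_nonneg hL0]
      exact hlip x y
    rw [zmod_mul] at b2
    have b3 := mul_le_mul_of_nonneg_left b2 hKnn
    have b4 : 0 ≤ K * (zmod L * zmod (x - y)) :=
      mul_nonneg hKnn (mul_nonneg (zmod_nonneg _) (zmod_nonneg _))
    simp only [Function.comp]
    linarith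
  · have ha : |deriv g x * h| ≤ L * |h| := by
      rw [abs_mul]; exact mul_le_mul_of_nonneg_right (hL x) (abs_nonneg _)
    have ha' : |deriv g x * h| ≤ L := ha.trans (by nlinarith)
    have c1 := close x h h1
    have c2 := close x (-h) (by simpa using h1)
    rw [abs_neg, mul_neg, ← sub_eq_add_neg, ← sub_eq_add_neg] at c2
    have c3 := hC (g x) (deriv g x * h) (by linarith [hR x])
      ((abs_add_le _ _).trans (by linarith [hR x]))
      ((abs_sub _ _).trans (by linarith [hR x]))
    have c4 := mul_le_mul_of_nonneg_left ha hCnn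
    have c5 := c3.trans c4
    simp only [Function.comp]
    rw [abs_le] at c1 c2 c5 ⊢
    constructor <;> linarith

lemma acts_of_zygmund {m : ℕ} (hm : 1 ≤ m) {f g : ℝ → ℝ} (hf : ZygmundClassR m f)
    (hg : GlobalZygmund m g) : GlobalZygmund m (f ∘ g) := by
  have hgd : Differentiable ℝ g := hg.1.differentiable (by
    have : m ≠ 0 := by omega
    exact_mod_cast this)
  have g0 : ZA g := by simpa using hg.za (Nat.zero_le m)
  have g1 : ZA (deriv g) := by simpa [iteratedDeriv_one] using hg.za hm
  have main : ∀ j ≤ m, ZA (iteratedDeriv j (f ∘ g)) := by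
    refine ZA.comp_iter m f g hf.1 hg.1 (fun j hj => ?_) (fun j hj => hg.za hj)
    refine ZA.comp_zyg (hf.1.continuous_iteratedDeriv j (by exact_mod_cast hj)) ?_ hgd g0 g1
    rcases hj.lt_or_eq with h | rfl
    · -- locally Lipschitz
      intro K hK
      obtain ⟨r, hr⟩ := hK.isBounded.subset_closedBall 0
      have hd := hf.1.differentiable_iteratedDeriv j (by exact_mod_cast h)
      have hc : Continuous (deriv (iteratedDeriv j f)) := by
        rw [← iteratedDeriv_succ]
        exact hf.1.continuous_iteratedDeriv (j + 1) (by exact_mod_cast h)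
      obtain ⟨L, hL⟩ := (isCompact_closedBall (0:ℝ) r).exists_bound_of_continuousOn hc.continuousOn
      have lip := fun x hx y hy => (convex_closedBall (0:ℝ) r).norm_image_sub_le_of_norm_deriv_le
        (f := iteratedDeriv j f) (C := L) (x := x) (y := y) (fun x _ => hd x) hL hx hy
      refine ⟨2 * L, fun x h hx h1 h2 _ => ?_⟩
      have a1 := lip x (hr hx) _ (hr h1)
      have a2 := lip x (hr hx) _ (hr h2)
      simp only [Real.norm_eq_abs, add_sub_cancel_left, sub_sub_cancel_left, abs_neg] at a1 a2
      rw [abs_le] at a1 a2 ⊢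
      constructor <;> linarith
    · exact hf.2
  refine ⟨hf.1.comp hg.1, fun j hj => (main j hj).bdd, ?_⟩
  obtain ⟨C, hC⟩ := (main m le_rfl).zyg
  exact ⟨C, fun x h _ => hC x h⟩

lemma exists_cutoff (m : ℕ) (R : ℝ) (hR : 0 < R) :
    ∃ g : ℝ → ℝ, GlobalZygmund m g ∧ ∀ x, |x| ≤ R → g x = x := by
  let φ : ContDiffBump (0 : ℝ) := ⟨R, R + 1, hR, by linarith⟩
  have hs : ∀ n : ℕ, ContDiff ℝ n (fun x => φ x * x) := fun n => φ.contDiff.mul contDiff_id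
  have hcs : HasCompactSupport (fun x => φ x * x) := φ.hasCompactSupport.mul_right
  have hcs' : ∀ j, HasCompactSupport (iteratedDeriv j (fun x => φ x * x)) := by
    intro j
    induction j with
    | zero => simpa using hcs
    | succ j ih => rw [iteratedDeriv_succ]; exact ih.deriv
  have hb : ∀ j, ∃ M : ℝ, ∀ x : ℝ, |iteratedDeriv j (fun x => φ x * x) x| ≤ M := by
    intro j
    obtain ⟨M, hM⟩ := (hcs' j).exists_bound_of_continuous
      ((hs j).continuous_iteratedDeriv j le_rfl)
    exact ⟨M, fun x => by simpa using hM x⟩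
  refine ⟨fun x => φ x * x, ⟨hs m, fun j _ => hb j, ?_⟩, fun x hx => ?_⟩
  · obtain ⟨M, hM⟩ := hb m
    obtain ⟨L, hL⟩ := hb (m + 1)
    rw [iteratedDeriv_succ] at hL
    obtain ⟨C, hC⟩ := (ZA.of_lip hM (lip_of_deriv_bdd
      ((hs (m + 1)).differentiable_iteratedDeriv m (by exact_mod_cast Nat.lt_succ_self m)) hL)).zyg
    exact ⟨C, fun x h _ => hC x h⟩
  · have : φ x = 1 := φ.one_of_mem_closedBall (by simpa using hx)
    simp [this]

lemma zygmund_of_acts {m : ℕ} {f : ℝ → ℝ}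
    (H : ∀ g : ℝ → ℝ, GlobalZygmund m g → GlobalZygmund m (f ∘ g)) : ZygmundClassR m f := by
  have ev : ∀ (R : ℝ) (g : ℝ → ℝ), (∀ x, |x| ≤ R → g x = x) → ∀ x, |x| < R →
      f =ᶠ[nhds x] f ∘ g := by
    intro R g hg x hx
    have : ∀ᶠ y in nhds x, |y| < R := continuous_abs.continuousAt.eventually_lt_const hx
    filter_upwards [this] with y hy
    simp [hg y hy.le]
  constructor
  · rw [contDiff_iff_contDiffAt]
    intro x
    obtain ⟨g, hg, hgx⟩ := exists_cutoff m (|x| + 1) (by positivity)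
    exact (H g hg).1.contDiffAt.congr_of_eventuallyEq (ev _ g hgx x (by linarith))
  · intro K hK
    obtain ⟨r, hr⟩ := hK.isBounded.subset_closedBall 0
    obtain ⟨g, hg, hgx⟩ := exists_cutoff m (|r| + 1) (by positivity)
    have e : ∀ x ∈ K, iteratedDeriv m f x = iteratedDeriv m (f ∘ g) x := by
      intro x hx
      apply Filter.EventuallyEq.iteratedDeriv_eq
      apply ev _ g hgx
      have := hr hx
      simp only [Metric.mem_closedBall, dist_zero_right, Real.norm_eq_abs] at this
      linarith [le_abs_self r]
    obtain ⟨C, hC⟩ := (H g hg).2.2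
    refine ⟨C, fun x h h0 h1 h2 hh => ?_⟩
    rw [e _ h0, e _ h1, e _ h2]
    exact hC x h hh

/-- **Acting condition for the superposition operator.** For `m ≥ 1`, the superposition
operator `g ↦ f ∘ g` maps `Λ_{m+1}(ℝ)` into itself if and only if `f ∈ Z^{m,1}(ℝ)`. -/
theorem superposition_acts_iff_zygmund (m : ℕ) (hm : 1 ≤ m) (f : ℝ → ℝ) :
    (∀ g : ℝ → ℝ, GlobalZygmund m g → GlobalZygmund m (f ∘ g)) ↔ ZygmundClassR m f :=
  ⟨zygmund_of_acts, fun hf _ hg => acts_of_zygmund hm hf hg⟩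
end

section
/- Let m ∈ ℕ and β ∈ (0,1], and set p(β) := ⌈2/β⌉. Let X ⊆ ℝ^d be a closed set with X equal to the closure of its interior X° such that X° has the uniform β-cusp property. Suppose f : X → ℝ satisfies f ∘ c ∈ Z^{m·p(β),1}(ℝ) for every smooth curve c ∈ C^∞(ℝ, ℝ^d) with image contained in X. Then for every multi-index γ with |γ| ≤ m the partial derivative ∂^γ(f|_{X°}) extends continuously from X° to X, and the extension g satisfies g ∘ c ∈ Z^{(m−|γ|)·p(β),1}(ℝ) for every smooth curve c with image in X. -/
/-- Partial derivative of `f` in the `i`-th coordinate direction. -/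
noncomputable def pd (d : ℕ) (i : Fin d) (f : EuclideanSpace ℝ (Fin d) → ℝ) :
    EuclideanSpace ℝ (Fin d) → ℝ :=
  fun x => fderiv ℝ f x (EuclideanSpace.single i 1)

/-- Iterated partial derivative `∂^γ f` for a multi-index `γ`. -/
noncomputable def pdMulti (d : ℕ) (γ : Fin d → ℕ) (f : EuclideanSpace ℝ (Fin d) → ℝ) :
    EuclideanSpace ℝ (Fin d) → ℝ :=
  (List.finRange d).foldr (fun i g => (pd d i)^[γ i] g) f
/-- The model `β`-cusp `Γ = {(x', x_d) : |x'| < r, h (|x'|/r)^β < x_d < h} ⊆ ℝ^{d} × ℝ`. -/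
def cuspSet (d : ℕ) (β r h : ℝ) : Set (EuclideanSpace ℝ (Fin (d + 1))) :=
  {z | Real.sqrt (∑ i : Fin d, z i.castSucc ^ 2) < r ∧
       h * (Real.sqrt (∑ i : Fin d, z i.castSucc ^ 2) / r) ^ β < z (Fin.last d) ∧
       z (Fin.last d) < h}

/-- An open set `Ω ⊆ ℝ^{d+1}` has the uniform `β`-cusp property: for each boundary point `x` of
`X = closure Ω` there are `ε, r, h > 0` and an orthogonal map `A` with `y + AΓ ⊆ Ω` for all
`y ∈ X ∩ B(x, ε)`. -/
def UniformCuspProperty (d : ℕ) (β : ℝ) (Ω : Set (EuclideanSpace ℝ (Fin (d + 1)))) : Prop :=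
  ∀ x ∈ frontier (closure Ω), ∃ ε > (0 : ℝ), ∃ r > (0 : ℝ), ∃ h > (0 : ℝ),
    ∃ A : EuclideanSpace ℝ (Fin (d + 1)) ≃ₗᵢ[ℝ] EuclideanSpace ℝ (Fin (d + 1)),
      ∀ y ∈ closure Ω ∩ Metric.ball x ε, ∀ z ∈ cuspSet d β r h, y + A z ∈ Ω


section Part1
open Set Filter Topology

/-- N-th forward difference -/
noncomputable def dN (N : ℕ) (h : ℝ) {G : Type*} [AddCommGroup G] (U : ℝ → G) : ℝ → G := (fwdDiff h)^[N] U

section diff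
variable {G : Type*} [AddCommGroup G]
theorem dN_zero (h : ℝ) (U : ℝ → G) : dN 0 h U = U := rfl
theorem dN_succ (N : ℕ) (h : ℝ) (U : ℝ → G) (x : ℝ) : dN (N+1) h U x = dN N h U (x+h) - dN N h U x := by
  simp only [dN, Function.iterate_succ_apply', fwdDiff]
theorem dN_succ' (N : ℕ) (h : ℝ) (U : ℝ → G) : dN (N+1) h U = dN N h (fun x => U (x+h) - U x) := by
  simp only [dN, Function.iterate_succ_apply]; rfl
theorem dN_sub (N : ℕ) (h : ℝ) (U V : ℝ → G) (x : ℝ) :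
    dN N h (fun x => U x - V x) x = dN N h U x - dN N h V x := by
  induction N generalizing x with
  | zero => rfl
  | succ N ih => simp only [dN_succ, ih]; abel
theorem dN_shift (N : ℕ) (h a : ℝ) (U : ℝ → G) (x : ℝ) :
    dN N h (fun x => U (x + a)) x = dN N h U (x + a) := by
  induction N generalizing x with
  | zero => rfl
  | succ N ih => simp only [dN_succ, ih]; rw [add_right_comm]
theorem dN_comm (N M : ℕ) (h k : ℝ) (U : ℝ → G) (x : ℝ) :
    dN N h (dN M k U) x = dN M k (dN N h U) x := by
  induction M generalizing x with
  | zero => rfl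
  | succ M ih =>
    have : dN (M+1) k U = fun x => dN M k U (x+k) - dN M k U x := by
      funext x; exact dN_succ _ _ _ _
    rw [this, dN_sub, dN_shift, ih, ih, dN_succ]
theorem dN_add_iter (N M : ℕ) (h : ℝ) (U : ℝ → G) : dN N h (dN M h U) = dN (N+M) h U := by
  simp [dN, Function.iterate_add_apply]
theorem dN_scale (N : ℕ) (g h : ℝ) (U : ℝ → G) (x : ℝ) :
    dN N g (fun x => U (h * x)) x = dN N (h * g) U (h * x) := by
  induction N generalizing x with
  | zero => rfl
  | succ N ih => simp only [dN_succ, ih]; rw [mul_add]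
end diff

theorem dN_cmul (N : ℕ) (h a : ℝ) (U : ℝ → ℝ) (x : ℝ) :
    dN N h (fun x => a * U x) x = a * dN N h U x := by
  induction N generalizing x with
  | zero => rfl
  | succ N ih => simp only [dN_succ, ih]; ring
theorem dN_bound (N : ℕ) (h : ℝ) (U : ℝ → ℝ) (B : ℝ) (hU : ∀ x, |U x| ≤ B) (x : ℝ) :
    |dN N h U x| ≤ 2^N * B := by
  induction N generalizing x with
  | zero => simpa [dN_zero] using hU x
  | succ N ih =>
    rw [dN_succ]
    calc _ ≤ |dN N h U (x+h)| + |dN N h U x| := abs_sub _ _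
      _ ≤ 2^N*B + 2^N*B := add_le_add (ih _) (ih _)
      _ = _ := by ring
theorem dN_cont (N : ℕ) (h : ℝ) (U : ℝ → ℝ) (hU : Continuous U) : Continuous (dN N h U) := by
  induction N with
  | zero => exact hU
  | succ N ih =>
    have : dN (N+1) h U = fun x => dN N h U (x+h) - dN N h U x := by
      funext x; exact dN_succ _ _ _ _
    rw [this]; fun_prop
theorem dN_deriv (N : ℕ) (h : ℝ) (U U' : ℝ → ℝ) (hU : ∀ x, HasDerivAt U (U' x) x) (x : ℝ) :
    HasDerivAt (dN N h U) (dN N h U' x) x := by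
  induction N generalizing x with
  | zero => exact hU x
  | succ N ih =>
    have : dN (N+1) h U = fun x => dN N h U (x+h) - dN N h U x := by
      funext x; exact dN_succ _ _ _ _
    rw [this, dN_succ]
    exact ((ih (x+h)).comp_add_const x h).sub (ih x)

/-- doubling inequality -/
theorem dN_double (m : ℕ) : ∃ c : ℝ, 0 ≤ c ∧ ∀ (V : ℝ → ℝ) (h A : ℝ), (∀ x, |dN (m+1) h V x| ≤ A) →
    ∀ x, |dN m (2*h) V x - 2^m * dN m h V x| ≤ c * A := by
  induction m with
  | zero => exact ⟨0, le_rfl, fun V h A _ x => by simp [dN_zero]⟩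
  | succ m ih =>
    obtain ⟨c, hc, ih⟩ := ih
    refine ⟨4*c+2^m, by positivity, fun V h A hA x => ?_⟩
    set W : ℝ → ℝ := fun x => V (x + 2*h) - V x with hW
    have h1 : ∀ k x, dN k h W x = 2 * dN (k+1) h V x + dN (k+2) h V x := by
      intro k x
      rw [hW, dN_sub, dN_shift, dN_succ (k+1), dN_succ k, dN_succ k]
      rw [show x + h + h = x + 2*h by ring]; ring
    have h2 : ∀ x, |dN (m+1) h W x| ≤ 4 * A := by
      intro x
      rw [h1, dN_succ (m+2), show m+1+1 = m+2 from rfl]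
      have := hA x; have := hA (x+h)
      rw [abs_le] at *
      constructor <;> linarith
    have h3 := ih W h (4*A) h2 x
    rw [dN_succ']
    rw [h1] at h3
    have h4 := hA x
    have : dN m (2*h) W x - 2^(m+1) * dN (m+1) h V x = (dN m (2*h) W x - 2^m * (2 * dN (m+1) h V x + dN (m+2) h V x)) + 2^m * dN (m+2) h V x := by ring
    rw [this]
    calc _ ≤ _ := abs_add_le _ _
      _ ≤ c * (4*A) + 2^m * A := by
        refine add_le_add h3 ?_
        rw [abs_mul, abs_of_nonneg (by positivity : (0:ℝ) ≤ 2^m)]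
        gcongr
      _ = _ := by ring

theorem marchaud_one (m : ℕ) (a : ℝ) (ha : 0 ≤ a) (ham : a < m) : ∃ K : ℝ, 1 ≤ K ∧
    ∀ (U : ℝ → ℝ) (B : ℝ), (∀ x, |U x| ≤ B) → (∀ h, 0 < h → h ≤ 1 → ∀ x, |dN (m+1) h U x| ≤ B * h ^ a) →
    ∀ h, 0 < h → h ≤ 1 → ∀ x, |dN m h U x| ≤ K * B * h^a := by
  obtain ⟨c, hc, hd⟩ := dN_double m
  set q : ℝ := 2 ^ a / 2 ^ m with hq
  have hq0 : 0 < q := by positivity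
  have hq1 : q < 1 := by
    rw [hq, div_lt_one (by positivity), ← Real.rpow_natCast]
    exact Real.rpow_lt_rpow_of_exponent_lt (by norm_num) ham
  set K : ℝ := max (2^m * 2^a) (c / (1-q)) with hK
  have hK1 : 1 ≤ K := by
    refine le_trans ?_ (le_max_left _ _)
    have h1 : (1:ℝ) ≤ 2^m := one_le_pow₀ (by norm_num)
    have h2 : (1:ℝ) ≤ 2^a := Real.one_le_rpow (by norm_num) ha
    nlinarith
  refine ⟨K, hK1, fun U B hB hU => ?_⟩
  have hB0 : 0 ≤ B := (abs_nonneg _).trans (hB 0)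
  have hKc : q * K + c ≤ K := by
    have : c / (1-q) ≤ K := le_max_right _ _
    rw [div_le_iff₀ (by linarith)] at this
    linarith
  have key : ∀ j : ℕ, ∀ h, (1/2)^(j+1) ≤ h → 0 < h → h ≤ 1 → ∀ x, |dN m h U x| ≤ K * B * h^a := by
    intro j
    induction j with
    | zero =>
      intro h h1 h0 h2 x
      have e1 : (1:ℝ) ≤ 2^a * h^a := by
        rw [← Real.mul_rpow (by norm_num) h0.le]
        exact Real.one_le_rpow (by norm_num at h1; linarith) ha
      calc _ ≤ 2^m * B := dN_bound m h U B hB x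
        _ ≤ 2^m*B * (2^a*h^a) := le_mul_of_one_le_right (by positivity) e1
        _ = (2^m*2^a) * B * h^a := by ring
        _ ≤ _ := by gcongr; exact le_max_left _ _
    | succ j ih =>
      intro h h1 h0 h2 x
      by_cases hh : h ≤ 1/2
      · have e1 := ih (2*h) (by rw [pow_succ] at h1; linarith) (by linarith) (by linarith) x
        have e2 := hd U h (B*h^a) (hU h h0 h2) x
        rw [Real.mul_rpow (by norm_num) h0.le] at e1
        have e3 : 2^m * |dN m h U x| ≤ K*B*(2^a*h^a) + c*(B*h^a) := by
          have : 2^m * |dN m h U x| = |2^m * dN m h U x| := by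
            rw [abs_mul, abs_of_nonneg (by positivity : (0:ℝ) ≤ 2^m)]
          rw [this]
          rw [abs_le] at *
          constructor <;> linarith
        have p2 : (1:ℝ) ≤ 2^m := one_le_pow₀ (by norm_num)
        have e4 : |dN m h U x| ≤ (q*K + c) * (B * h^a) := by
          have : 2^m * |dN m h U x| ≤ 2^m * ((q*K + c) * (B * h^a)) := by
            refine e3.trans ?_
            have : (2:ℝ)^m * q = 2^a := by rw [hq]; field_simp
            have h5 : 0 ≤ c * (B*h^a) := by positivity
            rw [← this]
            have h6 := le_mul_of_one_le_left h5 p2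
            calc K * B * (2^m*q*h^a) + c*(B*h^a) ≤ K * B * (2^m*q*h^a) + 2^m * (c*(B*h^a)) := by linarith
              _ = _ := by ring
          exact le_of_mul_le_mul_left this (by positivity)
        refine e4.trans ?_
        rw [mul_assoc]
        gcongr
      · exact ih h (by
          have : (1/2:ℝ)^(j+1) ≤ (1/2)^1 := pow_le_pow_of_le_one (by norm_num) (by norm_num) (by omega)
          linarith) h0 h2 x
  intro h h0 h1 x
  obtain ⟨j, hj⟩ := exists_pow_lt_of_lt_one h0 (by norm_num : (1/2:ℝ) < 1)
  refine key j h ?_ h0 h1 x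
  refine le_trans ?_ hj.le
  exact pow_le_pow_of_le_one (by norm_num) (by norm_num) (by omega)

theorem marchaud (N : ℕ) (hN : 2 ≤ N) (a : ℝ) (ha : 0 ≤ a) (ha2 : a < 2) : ∃ K : ℝ, 1 ≤ K ∧
    ∀ (U : ℝ → ℝ) (B : ℝ), (∀ x, |U x| ≤ B) → (∀ h, 0 < h → h ≤ 1 → ∀ x, |dN N h U x| ≤ B * h ^ a) →
    ∀ h, 0 < h → h ≤ 1 → ∀ x, |dN 2 h U x| ≤ K * B * h^a := by
  induction N, hN using Nat.le_induction with
  | base => exact ⟨1, le_rfl, fun U B _ hU => by simpa using hU⟩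
  | succ N hN ih =>
    obtain ⟨K, hK, ih⟩ := ih
    obtain ⟨K', hK', h1⟩ := marchaud_one N a ha (lt_of_lt_of_le ha2 (by exact_mod_cast hN))
    refine ⟨K * K', by nlinarith, fun U B hB hU => ?_⟩
    have hB0 : 0 ≤ B := (abs_nonneg _).trans (hB 0)
    have := ih U (K'*B) (fun x => (hB x).trans (by nlinarith)) (h1 U B hB hU)
    intro h h0 h1 x
    refine (this h h0 h1 x).trans (le_of_eq (by ring))

end Part1

section Part2
open Set Filter Topology

theorem interp_two (G : ℝ → ℝ) (B : ℝ) (hc : Continuous G) (hB : ∀ x, |G x| ≤ B)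
    (hD : ∀ h, 0 < h → h ≤ 1 → ∀ x, |dN 2 h G x| ≤ B * h ^ (3/2 : ℝ)) :
    ∃ V : ℝ → ℝ, Continuous V ∧ (∀ x, HasDerivAt G (V x) x) ∧ ∀ x, |V x| ≤ 8 * B := by
  have hB0 : 0 ≤ B := (abs_nonneg _).trans (hB 0)
  set D : ℕ → ℝ → ℝ := fun j t => 2^j * (G (t + (1/2)^j) - G t) with hDdef
  set q : ℝ := (1/2)^(1/2:ℝ) with hq
  have hq0 : 0 < q := by positivity
  have hq2 : q ^ 2 = 1/2 := by
    rw [hq, ← Real.rpow_natCast, ← Real.rpow_mul (by norm_num)]; norm_num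
  have hq1 : q ≤ 3/4 := by nlinarith
  have hstep : ∀ j t, |D (j+1) t - D j t| ≤ B * q^j := by
    intro j t
    set g : ℝ := (1/2)^(j+1) with hg
    have hg0 : 0 < g := by positivity
    have e0 : (1/2:ℝ)^j = 2*g := by rw [hg, pow_succ]; ring
    have e1 : (2:ℝ)^j * g = 1/2 := by
      rw [hg, pow_succ, ← mul_assoc, ← mul_pow]; norm_num
    have : D (j+1) t - D j t = - (2^j * dN 2 g G t) := by
      simp only [hDdef, dN_succ, dN_zero]
      rw [← hg, e0, show t + g + g = t + 2*g by ring]; ring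
    rw [this, abs_neg, abs_mul, abs_of_nonneg (by positivity : (0:ℝ) ≤ 2^j)]
    have h1 := hD g hg0 (pow_le_one₀ (by norm_num) (by norm_num)) t
    have h2 : g ^ (3/2:ℝ) = g * q^(j+1) := by
      rw [show (3/2:ℝ) = 1 + 1/2 by norm_num, Real.rpow_add hg0, Real.rpow_one, hq, hg,
        ← Real.rpow_natCast, ← Real.rpow_natCast, ← Real.rpow_mul (by norm_num), ← Real.rpow_mul (by norm_num),
        mul_comm (1/2:ℝ) (((j+1 : ℕ) : ℝ))]
    rw [h2] at h1
    calc 2^j * |dN 2 g G t| ≤ 2^j * (B * (g * q^(j+1))) := by gcongr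
      _ = (2^j*g) * (B * q^(j+1)) := by ring
      _ = 1/2 * (B * (q^j * q)) := by rw [e1, pow_succ]
      _ ≤ B * q^j := by
        have : 0 ≤ B * q^j := by positivity
        nlinarith
  have hsum : Summable (fun j => B * q^j) :=
    (summable_geometric_of_lt_one hq0.le (by linarith)).mul_left B
  set V : ℝ → ℝ := fun t => D 0 t + ∑' j, (D (j+1) t - D j t) with hV
  have hDc : ∀ j, Continuous (D j) := by intro j; simp only [hDdef]; fun_prop
  have hVc : Continuous V := (hDc 0).add (continuous_tsum (fun j => (hDc _).sub (hDc _)) hsum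
    (fun j t => by rw [Real.norm_eq_abs]; exact hstep j t))
  have hunif : TendstoUniformly D V atTop := by
    have := tendstoUniformly_tsum_nat hsum (f := fun j t => D (j+1) t - D j t)
      (fun j t => by rw [Real.norm_eq_abs]; exact hstep j t)
    rw [Metric.tendstoUniformly_iff] at this ⊢
    intro ε hε
    filter_upwards [this ε hε] with n hn t
    have := hn t
    rw [Finset.sum_range_sub (fun j => D j t)] at this
    rw [Real.dist_eq] at this ⊢
    convert this using 2
    simp only [hV]; ring
  refine ⟨V, hVc, ?_, ?_⟩
  · -- derivative
    set P : ℝ → ℝ := fun t => ∫ u in (0:ℝ)..t, G u with hP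
    have hPd : ∀ t, HasDerivAt P (G t) t := fun t => hc.integral_hasStrictDerivAt 0 t |>.hasDerivAt
    intro x
    refine hasDerivAt_of_tendstoUniformly (l := atTop) (f := fun j t => 2^j * (P (t + (1/2)^j) - P t)) hunif ?_ ?_ x
    · filter_upwards with j t
      exact (((hPd _).comp_add_const t _).sub (hPd t)).const_mul _
    · intro t
      have h1 := (hPd t).tendsto_slope_zero_right
      have h2 : Tendsto (fun j : ℕ => (1/2:ℝ)^j) atTop (𝓝[>] 0) := by
        rw [tendsto_nhdsWithin_iff]
        exact ⟨tendsto_pow_atTop_nhds_zero_of_lt_one (by norm_num) (by norm_num), by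
          filter_upwards with j; show (0:ℝ) < _; positivity⟩
      have h3 := h1.comp h2
      refine h3.congr (fun j => ?_)
      simp [smul_eq_mul]
  · intro x
    have h1 : |D 0 x| ≤ 2*B := by
      simp only [hDdef]; simp only [pow_zero, one_mul]
      have := hB (x+1); have := hB x
      rw [abs_le] at *; constructor <;> linarith
    have h2 : |∑' j, (D (j+1) x - D j x)| ≤ ∑' j, B * q^j := by
      have := tsum_of_norm_bounded hsum.hasSum (f := fun j => D (j+1) x - D j x) (fun j => by rw [Real.norm_eq_abs]; exact hstep j x)
      simpa using this
    have h3 : ∑' j, B * q^j ≤ 4 * B := by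
      rw [tsum_mul_left, tsum_geometric_of_lt_one hq0.le (by linarith)]
      have : (1-q)⁻¹ ≤ 4 := by
        rw [inv_le_comm₀ (by linarith) (by norm_num)]; linarith
      nlinarith
    have h4 := abs_add_le (D 0 x) (∑' j, (D (j+1) x - D j x))
    simp only [hV]
    linarith

theorem lemD_one (N : ℕ) (hN : 2 ≤ N) : ∃ K : ℝ, 1 ≤ K ∧
    ∀ (α : ℕ), 2 ≤ α → ∀ (U : ℝ → ℝ) (B : ℝ), Continuous U → (∀ x, |U x| ≤ B) →
      (∀ h, 0 < h → h ≤ 1 → ∀ x, |dN N h U x| ≤ B * h ^ α) →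
      Differentiable ℝ U ∧ Continuous (deriv U) ∧ ∀ x, |deriv U x| ≤ K * B := by
  obtain ⟨K, hK, hM⟩ := marchaud N hN (3/2) (by norm_num) (by norm_num)
  refine ⟨8*K, by linarith, fun α hα U B hc hB hU => ?_⟩
  have hB0 : 0 ≤ B := (abs_nonneg _).trans (hB 0)
  have h1 := hM U B hB (fun h h0 h1 x => (hU h h0 h1 x).trans (by
    gcongr
    rw [← Real.rpow_natCast]
    refine Real.rpow_le_rpow_of_exponent_ge h0 h1 ?_
    have : (2:ℝ) ≤ α := by exact_mod_cast hα
    linarith))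
  obtain ⟨V, hV, hd, hb⟩ := interp_two U (K*B) hc (fun x => (hB x).trans (by nlinarith)) h1
  have : deriv U = V := funext fun x => (hd x).deriv
  refine ⟨fun x => (hd x).differentiableAt, this ▸ hV, fun x => ?_⟩
  rw [this]; exact (hb x).trans (by linarith)

theorem lemD (N : ℕ) (hN : 2 ≤ N) : ∃ K : ℝ, 1 ≤ K ∧
    ∀ (α : ℕ), 1 ≤ α → ∀ (U : ℝ → ℝ) (B : ℝ), Continuous U → (∀ x, |U x| ≤ B) →
      (∀ h, 0 < h → h ≤ 1 → ∀ x, |dN N h U x| ≤ B * h ^ (α+1)) →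
      Differentiable ℝ U ∧ Continuous (deriv U) ∧ (∀ x, |deriv U x| ≤ K * B) ∧
      (∀ h, 0 < h → h ≤ 1 → ∀ x, |dN N h (deriv U) x| ≤ K * B * h ^ α) := by
  obtain ⟨K, hK, hL⟩ := lemD_one N hN
  have h2N : (1:ℝ) ≤ 2^N := one_le_pow₀ (by norm_num)
  refine ⟨K*2^N, by nlinarith, fun α hα U B hc hB hU => ?_⟩
  have hB0 : 0 ≤ B := (abs_nonneg _).trans (hB 0)
  obtain ⟨hd, hc', hb⟩ := hL (α+1) (by omega) U B hc hB hU
  refine ⟨hd, hc', fun x => (hb x).trans ?_, fun h h0 h1 x => ?_⟩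
  · have := mul_le_mul_of_nonneg_left h2N (by positivity : 0 ≤ K*B); linarith
  set G : ℝ → ℝ := fun x => (h^(α+1))⁻¹ * dN N h U (h*x) with hG
  have hp : 0 < h^(α+1) := by positivity
  have g1 : Continuous G := by
    have := dN_cont N h U hc
    simp only [hG]; fun_prop
  have g2 : ∀ x, |G x| ≤ 2^N*B := by
    intro x
    simp only [hG]
    rw [abs_mul, abs_of_nonneg (by positivity : 0 ≤ (h^(α+1))⁻¹), inv_mul_le_iff₀ hp]
    have := hU h h0 h1 (h*x)
    nlinarith [mul_nonneg hB0 hp.le]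
  have g3 : ∀ g, 0 < g → g ≤ 1 → ∀ x, |dN N g G x| ≤ 2^N*B*g^(α+1) := by
    intro g g0 g1 x
    have e : dN N g G x = (h^(α+1))⁻¹ * dN N h (dN N (h*g) U) (h*x) := by
      simp only [hG]
      rw [dN_cmul, dN_scale, dN_comm]
    rw [e, abs_mul, abs_of_nonneg (by positivity : 0 ≤ (h^(α+1))⁻¹), inv_mul_le_iff₀ hp]
    have := dN_bound N h (dN N (h*g) U) (B*(h*g)^(α+1)) (hU (h*g) (by positivity) (by nlinarith)) (h*x)
    refine this.trans (le_of_eq ?_)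
    rw [mul_pow]; ring
  obtain ⟨-, -, h5⟩ := hL (α+1) (by omega) G (2^N*B) g1 g2 g3
  have h6 : HasDerivAt G ((h^(α+1))⁻¹ * (dN N h (deriv U) x * h)) (h⁻¹*x) := by
    have e1 : HasDerivAt (dN N h U) (dN N h (deriv U) x) (h*(h⁻¹*x)) := by
      rw [mul_inv_cancel_left₀ h0.ne']
      exact dN_deriv N h U (deriv U) (fun x => (hd x).hasDerivAt) x
    have e2 : HasDerivAt (fun y => h * y) h (h⁻¹*x) := by
      simpa using (hasDerivAt_id (h⁻¹*x)).const_mul h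
    exact (e1.comp _ e2).const_mul _
  have h7 := h5 (h⁻¹*x)
  rw [h6.deriv, abs_mul, abs_mul, abs_of_pos h0, abs_of_nonneg (by positivity : 0 ≤ (h^(α+1))⁻¹), inv_mul_le_iff₀ hp, pow_succ] at h7
  refine le_of_mul_le_mul_right (h7.trans (le_of_eq ?_)) h0
  ring

theorem lemD_iter (N : ℕ) (hN : 2 ≤ N) (k : ℕ) : ∃ K : ℝ, 1 ≤ K ∧
    ∀ (α : ℕ), 1 ≤ α → ∀ (U : ℝ → ℝ) (B : ℝ), Continuous U → (∀ x, |U x| ≤ B) →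
      (∀ h, 0 < h → h ≤ 1 → ∀ x, |dN N h U x| ≤ B * h ^ (α+k)) →
      ContDiff ℝ k U ∧ (∀ x, |iteratedDeriv k U x| ≤ K * B) ∧
      (∀ h, 0 < h → h ≤ 1 → ∀ x, |dN N h (iteratedDeriv k U) x| ≤ K * B * h ^ α) := by
  induction k with
  | zero =>
    refine ⟨1, le_rfl, fun α _ U B hc hB hU => ?_⟩
    simp only [iteratedDeriv_zero, one_mul]
    exact ⟨by simpa [contDiff_zero] using hc, hB, hU⟩
  | succ k ih =>
    obtain ⟨K, hK, ih⟩ := ih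
    obtain ⟨K', hK', hD⟩ := lemD N hN
    refine ⟨K*K', by nlinarith, fun α hα U B hc hB hU => ?_⟩
    obtain ⟨h1, h2, h3, h4⟩ := hD (α+k) (by omega) U B hc hB (by simpa [add_assoc] using hU)
    obtain ⟨h5, h6, h7⟩ := ih α hα (deriv U) (K'*B) h2 h3 h4
    rw [iteratedDeriv_succ', mul_assoc]
    refine ⟨?_, h6, h7⟩
    push_cast
    rw [contDiff_succ_iff_deriv]
    exact ⟨h1, by simp, h5⟩

end Part2

section Part3
open Set Filter Topology

theorem zyg_of_dN (N : ℕ) (hN : 2 ≤ N) (q : ℕ) (U : ℝ → ℝ) (B : ℝ) (hc : Continuous U)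
    (hB : ∀ x, |U x| ≤ B)
    (hU : ∀ h, 0 < h → h ≤ 1 → ∀ x, |dN N h U x| ≤ B * h ^ (q+1)) : ZygmundClassR q U := by
  obtain ⟨K, hK, hD⟩ := lemD_iter N hN q
  obtain ⟨h1, h2, h3⟩ := hD 1 le_rfl U B hc hB (by simpa [add_comm] using hU)
  refine ⟨h1, fun _ _ => ?_⟩
  obtain ⟨L, hL, hM⟩ := marchaud N hN 1 (by norm_num) (by norm_num)
  have h4 := hM (iteratedDeriv q U) (K*B) h2 (by simpa using h3)
  have hB0 : 0 ≤ K * B := (abs_nonneg _).trans (h2 0)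
  have key : ∀ h, 0 < h → ∀ x, |dN 2 h (iteratedDeriv q U) x| ≤ (4 * L * (K*B)) * h := by
    intro h h0 x
    by_cases hh : h ≤ 1
    · refine (h4 h h0 hh x).trans ?_
      rw [Real.rpow_one]
      have : 0 ≤ L * (K*B) * h := by positivity
      linarith
    · refine (dN_bound 2 h _ _ h2 x).trans ?_
      have a1 : 0 ≤ L * (K*B) := by positivity
      have a2 : K*B ≤ L * (K*B) := le_mul_of_one_le_left hB0 hL
      nlinarith
  refine ⟨4 * L * (K*B), fun x h _ _ _ hh => ?_⟩
  rcases lt_or_gt_of_ne hh with h0 | h0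
  · have := key (-h) (by linarith) (x+h)
    simp only [dN_succ, dN_zero] at this
    rw [abs_of_neg h0]
    convert this using 2
    rw [show x + h + -h = x by ring, show x + -h = x - h by ring]; ring
  · have := key h h0 (x-h)
    simp only [dN_succ, dN_zero] at this
    rw [abs_of_pos h0]
    convert this using 2
    rw [show x - h + h = x by ring]; ring

theorem lemS (N : ℕ) (hN : 2 ≤ N) (n k : ℕ) (hk : k ≤ n) : ∃ K : ℝ, 1 ≤ K ∧
    ∀ (u : ℝ → ℝ) (B h : ℝ), 0 < h → h ≤ 1 → Continuous u → (∀ x, |u x| ≤ B * h^(n+1)) →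
      (∀ g, 0 < g → g ≤ 1 → ∀ x, |dN N g u x| ≤ B * g ^ (n+1)) →
      ∀ x, |iteratedDeriv k u x| ≤ K * B * h^(n+1-k) := by
  obtain ⟨K, hK, hD⟩ := lemD_iter N hN k
  refine ⟨K, hK, fun u B h h0 h1 hc hB hu x => ?_⟩
  have hp : 0 < h^(n+1) := by positivity
  have hB0 : 0 ≤ B := by
    have := (abs_nonneg _).trans (hB 0)
    exact nonneg_of_mul_nonneg_left this hp
  have hcd : ContDiff ℝ k u := by
    refine (hD (n+1-k) (by omega) u B hc (fun x => (hB x).trans ?_) ?_).1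
    · exact mul_le_of_le_one_right hB0 (pow_le_one₀ h0.le h1)
    · rw [show n+1-k+k = n+1 by omega]; exact hu
  set G : ℝ → ℝ := fun x => (h^(n+1))⁻¹ * u (h*x) with hG
  obtain ⟨-, h3, -⟩ := hD (n+1-k) (by omega) G B (by simp only [hG]; fun_prop) (fun x => by
      simp only [hG]
      rw [abs_mul, abs_of_nonneg (by positivity : 0 ≤ (h^(n+1))⁻¹), inv_mul_le_iff₀ hp]
      exact (hB _).trans (le_of_eq (mul_comm _ _))) (fun g g0 g1 x => by
      simp only [hG]
      rw [dN_cmul, dN_scale, abs_mul, abs_of_nonneg (by positivity : 0 ≤ (h^(n+1))⁻¹), inv_mul_le_iff₀ hp,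
        show n+1-k+k = n+1 by omega]
      refine (hu (h*g) (by positivity) (by nlinarith) _).trans (le_of_eq ?_)
      rw [mul_pow]; ring)
  have h4 := h3 (h⁻¹*x)
  have e : iteratedDeriv k G (h⁻¹*x) = (h^(n+1))⁻¹ * (h^k * iteratedDeriv k u x) := by
    simp only [hG]
    rw [iteratedDeriv_const_mul_field, iteratedDeriv_comp_const_mul hcd]
    simp [mul_inv_cancel_left₀ h0.ne']
  rw [e, abs_mul, abs_mul, abs_of_nonneg (by positivity : 0 ≤ (h^(n+1))⁻¹), inv_mul_le_iff₀ hp,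
    abs_of_pos (by positivity : 0 < h^k)] at h4
  have hk0 : 0 < h^k := by positivity
  refine le_of_mul_le_mul_left (h4.trans (le_of_eq ?_)) hk0
  rw [show n+1 = (n+1-k)+k by omega, pow_add]
  rw [show n+1-k+k-k = n+1-k by omega]; ring

theorem dN_iteratedDeriv (N k : ℕ) (h : ℝ) (F : ℝ → ℝ → ℝ) (hF : ∀ t, ContDiff ℝ k (F t)) (t s : ℝ) :
    ContDiff ℝ k (dN N h F t) ∧ 
    iteratedDeriv k (dN N h F t) s = dN N h (fun t => iteratedDeriv k (F t) s) t := by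
  induction N generalizing t with
  | zero => exact ⟨hF t, rfl⟩
  | succ N ih =>
    rw [dN_succ, dN_succ]
    refine ⟨(ih _).1.sub (ih _).1, ?_⟩
    rw [iteratedDeriv_sub (ih _).1.contDiffAt (ih _).1.contDiffAt, (ih _).2, (ih _).2]

theorem dN_apply (N : ℕ) (h : ℝ) (F : ℝ → ℝ → ℝ) (t s : ℝ) :
    dN N h F t s = dN N h (fun t => F t s) t := by
  induction N generalizing t with
  | zero => rfl
  | succ N ih => rw [dN_succ, dN_succ, Pi.sub_apply, ih, ih]

theorem dN_dN (N M : ℕ) (g h : ℝ) (F : ℝ → ℝ → ℝ) (t x : ℝ) :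
    dN M g (dN N h F t) x = dN N h (fun t => dN M g (F t) x) t := by
  induction N generalizing t with
  | zero => rfl
  | succ N ih =>
    rw [dN_succ, dN_succ]
    rw [← ih, ← ih]
    exact dN_sub M g _ _ x

theorem lemB (n : ℕ) (hn : 1 ≤ n) (k : ℕ) (hk : k ≤ n) (F : ℝ → ℝ → ℝ) (B : ℝ)
    (hB : ∀ t s, |F t s| ≤ B) (hct : ∀ s, Continuous (fun t => F t s)) (hcs : ∀ t, Continuous (F t))
    (ht : ∀ h, 0 < h → h ≤ 1 → ∀ t s, |dN (n+2) h (fun t => F t s) t| ≤ B * h^(n+1))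
    (hs : ∀ h, 0 < h → h ≤ 1 → ∀ t s, |dN (n+2) h (F t) s| ≤ B * h^(n+1)) :
    ZygmundClassR (n-k) (fun t => iteratedDeriv k (F t) 0) := by
  have hB0 : 0 ≤ B := (abs_nonneg _).trans (hB 0 0)
  obtain ⟨K, hK, hS⟩ := lemS (n+2) (by omega) n k hk
  set N := n+2 with hN
  have hcd : ∀ t, ContDiff ℝ k (F t) := by
    intro t
    obtain ⟨K', hK', hD⟩ := lemD_iter N (by omega) k
    refine (hD (n+1-k) (by omega) (F t) B (hcs t) (hB t) ?_).1
    rw [show n+1-k+k = n+1 by omega]; intro h h0 h1 x; exact hs h h0 h1 t x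
  have h2N : (1:ℝ) ≤ 2^N := one_le_pow₀ (by norm_num)
  have hbd : ∀ t, |iteratedDeriv k (F t) 0| ≤ K*B := by
    intro t
    have := hS (F t) B 1 one_pos le_rfl (hcs t) (by simpa using hB t) (fun h h0 h1 x => hs h h0 h1 t x) 0
    simpa using this
  refine zyg_of_dN N (by omega) (n-k) _ (K*(2^N*B)) ?_ ?_ ?_
  · -- continuity
    obtain ⟨L, hL, hD⟩ := lemD_iter N (by omega) 1
    have hlip : ∀ t t' s, |F t' s - F t s| ≤ L*B*|t'-t| := by
      intro t t' s
      obtain ⟨h1, h2, -⟩ := hD n hn (fun t => F t s) B (hct s) (fun t => hB t s) (fun h h0 h1 x => ht h h0 h1 x s)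
      have := Convex.norm_image_sub_le_of_norm_deriv_le (f := fun t => F t s) (s := univ) (C := L*B)
        (x := t) (y := t') (fun x _ => (h1.differentiable (by simp)) x) (fun x _ => by
          have := h2 x; rwa [iteratedDeriv_one] at this) convex_univ (mem_univ _) (mem_univ _)
      simpa using this
    rw [Metric.continuous_iff]
    intro t ε hε
    obtain ⟨h, h0, h1, hh⟩ : ∃ h : ℝ, 0 < h ∧ h ≤ 1 ∧ K*(2*(L*B)) * h < ε := by
      have hp : 0 ≤ K*(2*(L*B)) := by positivity
      refine ⟨min 1 (ε / (K*(2*(L*B)) + 1)), lt_min one_pos (by positivity), min_le_left _ _, ?_⟩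
      calc _ ≤ K*(2*(L*B)) * (ε / (K*(2*(L*B)) + 1)) := by gcongr; exact min_le_right _ _
        _ < ε := by
          rw [← mul_div_assoc, div_lt_iff₀ (by positivity)]
          nlinarith
    refine ⟨h^(n+1), by positivity, fun t' htt => ?_⟩
    rw [Real.dist_eq] at *
    have hLB : B ≤ L*B := le_mul_of_one_le_left hB0 hL
    have := hS (fun s => F t' s - F t s) (2*(L*B)) h h0 h1 ((hcs t').sub (hcs t)) (fun s => by
      refine (hlip t t' s).trans ?_
      have a1 : 0 ≤ L*B := by positivity
      have a2 : L*B*|t'-t| ≤ L*B*h^(n+1) := by gcongr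
      have : 0 ≤ L*B*h^(n+1) := by positivity
      linarith) (fun g g0 g1 s => by
      rw [dN_sub]
      have b1 := hs g g0 g1 t' s; have b2 := hs g g0 g1 t s
      have hg : 0 ≤ g^(n+1) := by positivity
      calc _ ≤ _ := abs_sub _ _
        _ ≤ 2 * (B * g^(n+1)) := by linarith
        _ ≤ 2*(L*B) * g^(n+1) := by nlinarith) 0
    rw [iteratedDeriv_fun_sub (hcd t').contDiffAt (hcd t).contDiffAt] at this
    refine this.trans_lt (lt_of_le_of_lt ?_ hh)
    gcongr
    calc h^(n+1-k) ≤ h^1 := pow_le_pow_of_le_one h0.le h1 (by omega)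
      _ = h := pow_one h
  · intro t
    refine (hbd t).trans ?_
    gcongr
    exact le_mul_of_one_le_left hB0 h2N
  · intro h h0 h1 t
    rw [← (dN_iteratedDeriv N k h F hcd t 0).2, show n-k+1 = n+1-k by omega]
    refine hS (dN N h F t) (2^N*B) h h0 h1 ?_ ?_ ?_ 0
    · exact (dN_iteratedDeriv N k h F hcd t 0).1.continuous
    · intro x
      rw [dN_apply]
      refine (ht h h0 h1 t x).trans ?_
      have : 0 ≤ B*h^(n+1) := by positivity
      nlinarith
    · intro g g0 g1 x
      rw [dN_dN, mul_assoc]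
      exact dN_bound N h _ _ (fun t => hs g g0 g1 t x) t

end Part3

section Part4
open Set Filter Topology

theorem dN_le_of_deriv (n : ℕ) (P : ℝ → ℝ) (a b h M : ℝ) (h0 : 0 ≤ h) (hP : ContDiff ℝ n P)
    (hM : ∀ y ∈ Icc a b, |iteratedDeriv n P y| ≤ M) (x : ℝ) (hx : a ≤ x) (hxb : x + n * h ≤ b) :
    |dN n h P x| ≤ h^n * M := by
  induction n generalizing P b M with
  | zero => 
    simp only [Nat.cast_zero, zero_mul, add_zero] at hxb
    simpa [dN_zero] using hM x ⟨hx, hxb⟩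
  | succ n ih =>
    push_cast at hxb
    have hPn : ContDiff ℝ n P := hP.of_le (by exact_mod_cast Nat.le_succ n)
    have hQ : ContDiff ℝ n (fun x => P (x+h)) := hPn.comp (contDiff_id.add contDiff_const)
    rw [dN_succ', pow_succ, mul_assoc]
    refine ih _ (b-h) (h*M) (hQ.sub hPn) ?_ (by linarith)
    intro y hy
    rw [iteratedDeriv_fun_sub hQ.contDiffAt hPn.contDiffAt, iteratedDeriv_comp_add_const]
    have hd : Differentiable ℝ (iteratedDeriv n P) := hP.differentiable_iteratedDeriv' n
    have := Convex.norm_image_sub_le_of_norm_deriv_le (f := iteratedDeriv n P) (s := Icc a b) (C := M)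
        (x := y) (y := y+h) (fun x _ => hd x) (fun x hx => by
          have := hM x hx; rwa [iteratedDeriv_succ] at this) (convex_Icc a b) ⟨hy.1, by linarith [hy.2]⟩
          ⟨by linarith [hy.1], by linarith [hy.2]⟩
    simp only [Real.norm_eq_abs, add_sub_cancel_left, abs_of_nonneg h0] at this
    linarith

theorem dN_of_zyg (n : ℕ) (G : ℝ → ℝ) (hG : ZygmundClassR n G) (a b : ℝ) : ∃ C : ℝ, 0 ≤ C ∧
    ∀ x h, 0 < h → a ≤ x → x + (n+2)*h ≤ b → |dN (n+2) h G x| ≤ C * h^(n+1) := by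
  obtain ⟨hc, hz⟩ := hG
  obtain ⟨C, hC⟩ := hz (Icc a b) isCompact_Icc
  refine ⟨|C|, abs_nonneg _, fun x h h0 hx hxb => ?_⟩
  have e : dN (n+2) h G = dN n h (dN 2 h G) := (dN_add_iter n 2 h G).symm
  rw [e]
  have e2 : dN 2 h G = fun x => (G (x + 2*h) - G (x+h)) - (G (x+h) - G x) := by
    funext x
    simp only [dN_succ, dN_zero]
    rw [show x+h+h = x+2*h by ring]
  have c1 : ∀ a, ContDiff ℝ n (fun x => G (x + a)) := fun a => hc.comp (contDiff_id.add contDiff_const)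
  have := dN_le_of_deriv n (dN 2 h G) a (b-2*h) h (|C| * h) h0.le (by
      rw [e2]; exact ((c1 _).sub (c1 _)).sub ((c1 _).sub hc)) (fun y hy => by
      rw [e2, iteratedDeriv_fun_sub ((c1 _).sub (c1 _)).contDiffAt ((c1 _).sub hc).contDiffAt,
        iteratedDeriv_fun_sub (c1 _).contDiffAt (c1 _).contDiffAt, 
        iteratedDeriv_fun_sub (c1 _).contDiffAt hc.contDiffAt]
      simp only [iteratedDeriv_comp_add_const]
      have h1 := hC (y+h) h ⟨by linarith [hy.1], by linarith [hy.2]⟩ ⟨by linarith [hy.1], by linarith [hy.2]⟩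
        ⟨by linarith [hy.1], by linarith [hy.2]⟩ h0.ne'
      rw [abs_of_pos h0] at h1
      have h2 : C*h ≤ |C| * h := by gcongr; exact le_abs_self C
      refine le_trans (le_of_eq ?_) (h1.trans h2)
      congr 1
      rw [show y+h+h = y+2*h by ring, show y + h - h = y by ring]; ring) x hx (by linarith)
  refine this.trans (le_of_eq (by ring))

/-! gluing -/
section glue
variable {E : Type*} [NormedAddCommGroup E] [NormedSpace ℝ E]

noncomputable def glue (b : ℝ → ℝ) (u : ℕ → E) (τ : ℝ) : E := ∑' j : ℕ, b (8 * (2^j * τ - 1)) • u j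

theorem glue_disj (τ : ℝ) (i j : ℕ) (hi : |8 * (2^i * τ - 1)| < 1) (hj : |8 * (2^j * τ - 1)| < 1) : i = j := by
  wlog hij : i < j generalizing i j
  · rcases lt_trichotomy i j with h | h | h
    · exact this i j hi hj h
    · exact h
    · exact (this j i hj hi h).symm
  exfalso
  obtain ⟨k, rfl⟩ := Nat.exists_eq_add_of_lt hij
  rw [abs_lt] at hi hj
  have h1 : (1:ℝ) ≤ 2^k := one_le_pow₀ (by norm_num)
  have h2 : (2:ℝ)^(i+k+1) * τ = 2 * (2^k * (2^i*τ)) := by rw [pow_succ, pow_add]; ring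
  rw [h2] at hj
  nlinarith

theorem glue_eq (b : ℝ → ℝ) (hb : ∀ σ, 1 ≤ |σ| → b σ = 0) (u : ℕ → E) (τ : ℝ) (j : ℕ)
    (hj : |8 * (2^j * τ - 1)| < 1) : glue b u τ = b (8 * (2^j * τ - 1)) • u j := by
  unfold glue
  refine tsum_eq_single j (fun i hi => ?_)
  rw [hb, zero_smul]
  by_contra h
  exact hi (glue_disj τ i j (not_le.1 h) hj)

theorem glue_zero (b : ℝ → ℝ) (hb : ∀ σ, 1 ≤ |σ| → b σ = 0) (u : ℕ → E) (τ : ℝ)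
    (hj : ∀ j : ℕ, 1 ≤ |8 * (2^j * τ - 1)|) : glue b u τ = 0 := by
  unfold glue
  simp [hb _ (hj _)]

theorem glue_smooth [CompleteSpace E] (b : ℝ → ℝ) (hbs : ContDiff ℝ (⊤ : ℕ∞) b) (hb : ∀ σ, 1 ≤ |σ| → b σ = 0) (u : ℕ → E)
    (C : ℝ) (hu : ∀ j, ‖u j‖ ≤ C * (1/2)^(j^2)) : ContDiff ℝ (⊤ : ℕ∞) (glue b u) := by
  have hC : 0 ≤ C := by simpa using (norm_nonneg _).trans (hu 0)
  have hbd : ∀ k : ℕ, ∃ M, ∀ σ, |iteratedDeriv k b σ| ≤ M := by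
    intro k
    have hcs : HasCompactSupport b := HasCompactSupport.of_support_subset_isCompact (isCompact_Icc (a := -1) (b := 1)) (by
      intro σ hσ
      by_contra h
      refine hσ (hb σ ?_)
      by_contra h2
      rw [not_le, abs_lt] at h2
      exact h ⟨h2.1.le, h2.2.le⟩)
    have h2 : HasCompactSupport (iteratedDeriv k b) := by
      have := hcs.iteratedFDeriv (𝕜 := ℝ) k
      refine this.mono' ?_
      intro σ hσ
      refine subset_tsupport _ ?_
      rw [Function.mem_support] at hσ ⊢
      rw [← norm_ne_zero_iff, norm_iteratedFDeriv_eq_norm_iteratedDeriv]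
      simpa using hσ
    obtain ⟨M, hM⟩ := h2.exists_bound_of_continuous (hbs.continuous_iteratedDeriv k (by exact_mod_cast le_top))
    exact ⟨M, hM⟩
  choose M hM using hbd
  have hM0 : ∀ k, 0 ≤ M k := fun k => (abs_nonneg _).trans (hM k 0)
  refine contDiff_tsum (v := fun k j => (8*2^j)^k * M k * (C * (1/2)^(j^2))) (fun j => ?_) (fun k _ => ?_) (fun k j τ _ => ?_)
  · exact (hbs.comp (by fun_prop)).smul contDiff_const
  · -- summable
    have : (fun j : ℕ => ((8:ℝ)*2^j)^k * M k * (C * (1/2)^(j^2))) = fun j : ℕ => (8^k * M k * C) * ((2^j)^k * (1/2)^(j^2)) := by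
      funext j; rw [mul_pow]; ring
    rw [this]
    refine Summable.mul_left _ ?_
    refine summable_of_ratio_test_tendsto_lt_one (l := 0) (by norm_num) (Eventually.of_forall fun j => by positivity) ?_
    have e : ∀ j : ℕ, ‖((2:ℝ)^(j+1))^k * (1/2)^((j+1)^2)‖ / ‖((2:ℝ)^j)^k * (1/2)^(j^2)‖ = (2^k * (1/2)) * ((1/4))^j := by
      intro j
      rw [Real.norm_of_nonneg (by positivity), Real.norm_of_nonneg (by positivity)]
      rw [div_eq_iff (by positivity)]
      rw [show (1/4:ℝ) = (1/2)^2 by norm_num]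
      rw [show (j+1)^2 = j^2+2*j+1 by ring, pow_succ (2:ℝ) j, mul_pow, pow_add, pow_add, pow_mul (1/2:ℝ) 2 j]
      ring
    refine Tendsto.congr (fun j => (e j).symm) ?_
    have := tendsto_pow_atTop_nhds_zero_of_lt_one (r := (1/4:ℝ)) (by norm_num) (by norm_num)
    simpa using this.const_mul (2^k * (1/2:ℝ))
  · rw [norm_iteratedFDeriv_eq_norm_iteratedDeriv]
    have hk : ContDiff ℝ k b := hbs.of_le (by exact_mod_cast le_top)
    have hk2 : ContDiff ℝ k (fun τ => b (8 * (2^j * τ - 1))) := hk.comp (by fun_prop)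
    rw [iteratedDeriv_smul_const hk2.contDiffAt, norm_smul]
    have e : (fun τ : ℝ => b (8 * (2^j * τ - 1))) = fun τ => (fun y => b (y - 8)) ((8*2^j) * τ) := by
      funext τ; congr 1; ring
    have hk3 : ContDiff ℝ k (fun y => b (y - 8)) := hk.comp (by fun_prop)
    rw [e, iteratedDeriv_comp_const_mul hk3]
    simp only [iteratedDeriv_comp_sub_const]
    rw [norm_mul, Real.norm_of_nonneg (by positivity)]
    refine mul_le_mul ?_ (hu j) (norm_nonneg _) (by have := hM0 k; positivity)
    gcongr
    exact hM _ _
end glue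

end Part4

section Part5
open Set Filter Topology

theorem exists_bump (r R : ℝ) (hr : 0 < r) (hR : r < R) : ∃ b : ℝ → ℝ, ContDiff ℝ (⊤ : ℕ∞) b ∧
    (∀ σ, |σ| ≤ r → b σ = 1) ∧ (∀ σ, R ≤ |σ| → b σ = 0) ∧ ∀ σ, 0 ≤ b σ ∧ b σ ≤ 1 := by
  let f : ContDiffBump (0:ℝ) := ⟨r, R, hr, hR⟩
  refine ⟨f, f.contDiff, fun σ h => f.one_of_mem_closedBall (by simpa using h), fun σ h => 
    f.zero_of_le_dist (by simpa using h), fun σ => ⟨f.nonneg, f.le_one⟩⟩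

section
variable {E : Type*} [NormedAddCommGroup E] [NormedSpace ℝ E]

/-- Local cusp-type condition. -/
def GoodPt (p : ℕ) (X : Set E) (x : E) : Prop :=
  ∃ e : E, ∃ ε > (0:ℝ), ∃ ρ > (0:ℝ), ∀ y ∈ X, ‖y - x‖ < ε → ∀ s : ℝ, |s| ≤ 1 → ∀ w : E,
    ‖w‖ ≤ ρ * |s|^p → y + (s^2) • e + w ∈ X

theorem curve_cont [CompleteSpace E] (p : ℕ) (X : Set E) (x : E) (hx : x ∈ X) (hg : GoodPt p X x) (g : E → ℝ) (r : ℝ)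
    (hr : 0 < r) (hc : ∀ c : ℝ → E, ContDiff ℝ (⊤ : ℕ∞) c → (∀ t, c t ∈ X ∧ ‖c t - x‖ < r) → Continuous (g ∘ c)) :
    ContinuousWithinAt g X x := by
  by_contra hcon
  rw [Metric.continuousWithinAt_iff] at hcon
  push Not at hcon
  obtain ⟨η, hη, hcon⟩ := hcon
  obtain ⟨e, ε, hε, ρ, hρ, hG⟩ := hg
  obtain ⟨κ, hκ0, hκ1, hκ⟩ : ∃ κ : ℝ, 0 < κ ∧ κ ≤ 1 ∧ κ * ‖e‖ < r/2 := by
    refine ⟨min 1 (r/2/(‖e‖+1)), lt_min one_pos (by positivity), min_le_left _ _, ?_⟩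
    calc _ ≤ (r/2/(‖e‖+1)) * ‖e‖ := by gcongr; exact min_le_right _ _
      _ < r/2 := by
        rw [div_mul_eq_mul_div, div_lt_iff₀ (by positivity)]
        nlinarith [norm_nonneg e]
  set s : ℕ → ℝ := fun j => κ * (1/2)^(j^2) with hs
  have hpow1 : ∀ j : ℕ, (1/2:ℝ)^(j^2) ≤ 1 := fun j => pow_le_one₀ (by norm_num) (by norm_num)
  have hs0 : ∀ j, 0 < s j := fun j => by simp only [hs]; positivity
  have hsle : ∀ j, s j ≤ (1/2)^(j^2) := fun j => mul_le_of_le_one_left (by positivity) hκ1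
  have hs1 : ∀ j, s j ≤ 1 := fun j => (hsle j).trans (hpow1 j)
  have hsκ : ∀ j, s j ≤ κ := fun j => mul_le_of_le_one_right hκ0.le (hpow1 j)
  have hsq : ∀ j, s j ^ 2 ≤ s j := fun j => by nlinarith [hs0 j, hs1 j]
  have hex : ∀ j : ℕ, ∃ y ∈ X, ‖y - x‖ < ε ∧ ‖y - x‖ < r/2 ∧ ‖y-x‖ ≤ ρ * s j ^ p ∧ ‖y-x‖ ≤ (1/2)^(j^2) ∧
      η ≤ |g y - g x| := by
    intro j
    obtain ⟨y, hy, h1, h2⟩ := hcon (min (min ε (r/2)) (min (ρ * s j ^ p) ((1/2)^(j^2)))) (by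
      have := hs0 j
      positivity)
    rw [dist_eq_norm] at h1
    rw [Real.dist_eq] at h2
    simp only [lt_min_iff] at h1
    exact ⟨y, hy, h1.1.1, h1.1.2, h1.2.1.le, h1.2.2.le, h2⟩
  choose y hyX hy1 hy2 hy3 hy4 hy5 using hex
  obtain ⟨φ, hφs, hφ1, hφ0, hφb⟩ := exists_bump (1/2) (3/4) (by norm_num) (by norm_num)
  obtain ⟨b1, hb1s, hb11, hb10, hb1b⟩ := exists_bump (1/4) (1/2) (by norm_num) (by norm_num)
  obtain ⟨b2, hb2s, hb21, hb20, hb2b⟩ := exists_bump (3/4) 1 (by norm_num) (by norm_num)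
  set ψ : ℝ → ℝ := fun σ => b2 σ * (1 - b1 σ) with hψ
  have hψb : ∀ σ, 0 ≤ ψ σ ∧ ψ σ ≤ 1 := by
    intro σ
    have h1 := hb1b σ; have h2 := hb2b σ
    exact ⟨mul_nonneg h2.1 (by linarith), mul_le_one₀ h2.2 (by linarith) (by linarith)⟩
  have hψs : ContDiff ℝ (⊤ : ℕ∞) ψ := hb2s.mul (contDiff_const.sub hb1s)
  have hφ0' : ∀ σ, 1 ≤ |σ| → φ σ = 0 := fun σ h => hφ0 σ (by linarith)
  have hψ0' : ∀ σ, 1 ≤ |σ| → (fun σ => ψ σ ^ 2) σ = 0 := fun σ h => by simp [hψ, hb20 σ h]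
  set c : ℝ → E := fun τ => x + glue φ (fun j => y j - x) τ + glue (fun σ => ψ σ ^ 2) (fun j => (s j ^ 2) • e) τ with hcdef
  have hcs : ContDiff ℝ (⊤ : ℕ∞) c := by
    refine (contDiff_const.add (glue_smooth φ hφs hφ0' _ 1 (fun j => by simpa using hy4 j))).add
      (glue_smooth _ (hψs.pow 2) hψ0' _ ‖e‖ (fun j => ?_))
    rw [norm_smul, Real.norm_of_nonneg (by positivity), mul_comm]
    gcongr
    exact (hsq j).trans (hsle j)
  have hceq : ∀ τ j, |8 * (2^j * τ - 1)| < 1 → c τ = x + φ (8 * (2^j * τ - 1)) • (y j - x) + (ψ (8 * (2^j * τ - 1)) * s j)^2 • e := by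
    intro τ j hj
    simp only [hcdef]
    rw [glue_eq φ hφ0' _ τ j hj, glue_eq _ hψ0' _ τ j hj, smul_smul, ← mul_pow]
  have hczero : ∀ τ, (∀ j : ℕ, 1 ≤ |8 * (2^j * τ - 1)|) → c τ = x := by
    intro τ hj
    simp only [hcdef]
    rw [glue_zero φ hφ0' _ τ hj, glue_zero _ hψ0' _ τ hj]; simp
  have hmem : ∀ t, c t ∈ X ∧ ‖c t - x‖ < r := by
    intro t
    by_cases hj : ∃ j : ℕ, |8 * (2^j * t - 1)| < 1
    · obtain ⟨j, hj⟩ := hj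
      rw [hceq t j hj]
      set σ := 8 * (2^j * t - 1)
      have hψσ := hψb σ
      have hφσ := hφb σ
      have habs : |ψ σ * s j| ≤ 1 := by
        rw [abs_of_nonneg (mul_nonneg hψσ.1 (hs0 j).le)]
        exact mul_le_one₀ hψσ.2 (hs0 j).le (hs1 j)
      constructor
      · by_cases hA : |σ| ≤ 1/2
        · rw [hφ1 σ hA, one_smul, add_sub_cancel]
          have := hG (y j) (hyX j) (hy1 j) (ψ σ * s j) habs 0 (by simp; positivity)
          simpa using this
        by_cases hB : 3/4 ≤ |σ|
        · rw [hφ0 σ hB, zero_smul, add_zero]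
          have := hG x hx (by simpa using hε) (ψ σ * s j) habs 0 (by simp; positivity)
          simpa using this
        · have hψ1 : ψ σ = 1 := by
            simp only [hψ]
            rw [hb21 σ (by linarith), hb10 σ (by linarith)]; norm_num
          rw [hψ1, one_mul]
          have := hG x hx (by simpa using hε) (s j) (by rw [abs_of_pos (hs0 j)]; exact hs1 j) (φ σ • (y j - x)) (by
            rw [norm_smul, Real.norm_of_nonneg hφσ.1, abs_of_pos (hs0 j)]
            exact (mul_le_of_le_one_left (norm_nonneg _) hφσ.2).trans (hy3 j))
          convert this using 1
          abel
      · have : x + φ σ • (y j - x) + (ψ σ * s j)^2 • e - x = φ σ • (y j - x) + (ψ σ * s j)^2 • e := by abel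
        rw [this]
        refine (norm_add_le _ _).trans_lt ?_
        rw [norm_smul, norm_smul, Real.norm_of_nonneg hφσ.1, Real.norm_of_nonneg (by positivity)]
        have a1 := (mul_le_of_le_one_left (norm_nonneg (y j - x)) hφσ.2).trans_lt (hy2 j)
        have a2 : (ψ σ * s j)^2 ≤ κ := by
          have : (ψ σ * s j)^2 ≤ (s j)^2 := by
            rw [mul_pow]; exact mul_le_of_le_one_left (by positivity) (pow_le_one₀ hψσ.1 hψσ.2)
          exact this.trans ((hsq j).trans (hsκ j))
        have a3 := (mul_le_mul_of_nonneg_right a2 (norm_nonneg e)).trans_lt hκ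
        linarith
    · push Not at hj
      rw [hczero t hj]
      exact ⟨hx, by simpa using hr⟩
  have hcont := hc c hcs hmem
  have hc0 : c 0 = x := hczero 0 (fun j => by norm_num)
  have hcj : ∀ j : ℕ, c ((1/2)^j) = y j := by
    intro j
    have e0 : (8:ℝ) * (2^j * (1/2)^j - 1) = 0 := by rw [← mul_pow]; norm_num
    rw [hceq _ j (by rw [e0]; norm_num), e0, hφ1 0 (by norm_num)]
    have : ψ 0 = 0 := by simp only [hψ]; rw [hb11 0 (by norm_num)]; norm_num
    rw [this]; simp
  have h1 := (hcont.tendsto 0).comp (tendsto_pow_atTop_nhds_zero_of_lt_one (r := (1/2:ℝ)) (by norm_num) (by norm_num))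
  rw [Metric.tendsto_atTop] at h1
  obtain ⟨J, hJ⟩ := h1 η hη
  have h2 := hJ J le_rfl
  simp only [Function.comp_apply, hcj, hc0, Real.dist_eq] at h2
  linarith [hy5 J]

theorem dN_congr {G : Type*} [AddCommGroup G] (N : ℕ) (h k : ℝ) (U V : ℝ → G) (x y : ℝ)
    (H : ∀ i : ℕ, i ≤ N → U (x + i * h) = V (y + i * k)) : dN N h U x = dN N k V y := by
  induction N generalizing x y with
  | zero => simpa [dN_zero] using H 0 le_rfl
  | succ N ih =>
    rw [dN_succ, dN_succ, ih x y (fun i hi => H i (by omega)), ih (x+h) (y+k) (fun i hi => ?_)]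
    have := H (i+1) (by omega)
    push_cast at this
    convert this using 2 <;> ring

theorem boman_local [CompleteSpace E] (n : ℕ) (F : E → ℝ) (hF : ∀ c : ℝ → E, ContDiff ℝ (⊤ : ℕ∞) c → ZygmundClassR n (F ∘ c))
    (v x₀ : E) : ∃ r > (0:ℝ), ∃ B : ℝ, 0 ≤ B ∧ ∀ x, ‖x - x₀‖ < r → ∀ h, 0 < h → h < r →
      |dN (n+2) h (fun τ => F (x + τ • v)) 0| ≤ B * h^(n+1) := by
  by_contra hcon
  push Not at hcon
  set ε : ℕ → ℝ := fun j => (1/2)^(j^2) with hε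
  have hε0 : ∀ j, 0 < ε j := fun j => by simp only [hε]; positivity
  have hε1 : ∀ j, ε j ≤ 1 := fun j => pow_le_one₀ (by norm_num) (by norm_num)
  have hex := fun j : ℕ => hcon (ε j / (2 * (n+2))) (by have := hε0 j; positivity) (j * ((ε j)⁻¹)^(n+1))
    (by have := hε0 j; positivity)
  choose x hx h h0 hh hbig using hex
  have hhε : ∀ j, (n+2) * (h j / ε j) ≤ 1/2 := by
    intro j
    have := (hh j).le
    rw [le_div_iff₀ (by positivity)] at this
    rw [← mul_div_assoc, div_le_iff₀ (hε0 j)]; linarith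
  obtain ⟨b, hbs, hb1, hb0, hbb⟩ := exists_bump (1/2) 1 (by norm_num) (by norm_num)
  have hb0' : ∀ σ, 1 ≤ |σ| → (fun σ => b σ * σ) σ = 0 := fun σ hσ => by simp [hb0 σ hσ]
  set c : ℝ → E := fun τ => x₀ + glue b (fun j => x j - x₀) τ + glue (fun σ => b σ * σ) (fun j => (ε j) • v) τ with hcdef
  have hcs : ContDiff ℝ (⊤ : ℕ∞) c := by
    refine (contDiff_const.add (glue_smooth b hbs hb0 _ 1 (fun j => ?_))).add
      (glue_smooth _ (hbs.mul contDiff_id) hb0' _ ‖v‖ (fun j => ?_))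
    · rw [one_mul]
      refine (hx j).le.trans (div_le_self (hε0 j).le ?_)
      have : (0:ℝ) ≤ n := by positivity
      linarith
    · rw [norm_smul, Real.norm_of_nonneg (hε0 j).le, mul_comm]
  obtain ⟨C, hC0, hC⟩ := dN_of_zyg n (F ∘ c) (hF c hcs) 0 2
  obtain ⟨j, hj⟩ := exists_nat_ge C
  have h2j : (1:ℝ) ≤ 2^j := one_le_pow₀ (by norm_num)
  have hhε0 : 0 < h j / ε j := div_pos (h0 j) (hε0 j)
  set h' : ℝ := h j / ε j / (8 * 2^j) with hh'
  have hh'0 : 0 < h' := by positivity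
  have hh'1 : h' ≤ h j / ε j := div_le_self hhε0.le (by linarith)
  have key : dN (n+2) h' (F ∘ c) ((1/2)^j) = dN (n+2) (h j) (fun τ => F (x j + τ • v)) 0 := by
    refine dN_congr _ _ _ _ _ _ _ (fun i hi => ?_)
    have e0 : (8:ℝ) * (2^j * ((1/2)^j + i * h') - 1) = i * (h j / ε j) := by
      have : (2:ℝ)^j * (1/2)^j = 1 := by rw [← mul_pow]; norm_num
      rw [mul_add, this, hh']; field_simp; ring
    have hi' : (i:ℝ) ≤ n+2 := by exact_mod_cast hi
    have e1 : |(i:ℝ) * (h j / ε j)| ≤ 1/2 := by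
      rw [abs_of_nonneg (by positivity)]
      exact (mul_le_mul_of_nonneg_right hi' hhε0.le).trans (hhε j)
    simp only [Function.comp_apply, hcdef]
    rw [glue_eq b hb0 _ _ j (by rw [e0]; linarith), glue_eq _ hb0' _ _ j (by rw [e0]; linarith), e0, hb1 _ e1]
    congr 1
    rw [one_smul, one_mul, smul_smul, zero_add, mul_assoc, div_mul_cancel₀ _ (hε0 j).ne']
    abel
  have h1 := hC ((1/2)^j) h' hh'0 (by positivity) (by
    have : (1/2:ℝ)^j ≤ 1 := pow_le_one₀ (by norm_num) (by norm_num)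
    have := hhε j
    have : ((n:ℝ)+2) * h' ≤ (n+2) * (h j / ε j) := by gcongr
    linarith)
  rw [key] at h1
  have h2 := hbig j
  have h3 : C * h'^(n+1) ≤ j * (h j / ε j)^(n+1) := by gcongr
  rw [div_eq_mul_inv, mul_pow] at h3
  nlinarith
end

theorem boman_t (n : ℕ) (F : ℝ → ℝ → ℝ) (R : ℝ) (hR : 0 < R)
    (hF : ∀ c₁ c₂ : ℝ → ℝ, ContDiff ℝ (⊤ : ℕ∞) c₁ → ContDiff ℝ (⊤ : ℕ∞) c₂ → ZygmundClassR n (fun τ => F (c₁ τ) (c₂ τ)))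
    (ht : ∀ t s, R ≤ |t| → F t s = F 0 s) (hs : ∀ t s, R ≤ |s| → F t s = F t 0) :
    ∃ B : ℝ, (∀ t s, |F t s| ≤ B) ∧ (∀ s, Continuous (fun t => F t s)) ∧
    (∀ h, 0 < h → h ≤ 1 → ∀ t s, |dN (n+2) h (fun t => F t s) t| ≤ B * h^(n+1)) := by
  have hF' : ∀ c : ℝ → ℝ × ℝ, ContDiff ℝ (⊤ : ℕ∞) c → ZygmundClassR n ((fun z : ℝ × ℝ => F z.1 z.2) ∘ c) := by
    intro c hc
    exact hF (fun τ => (c τ).1) (fun τ => (c τ).2) hc.fst hc.snd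
  set Fp : ℝ × ℝ → ℝ := fun z : ℝ × ℝ => F z.1 z.2 with hFp
  have hcont : Continuous Fp := by
    rw [continuous_iff_continuousAt]
    intro z
    rw [← continuousWithinAt_univ]
    refine curve_cont 1 univ z (mem_univ _) ⟨0, 1, one_pos, 1, one_pos, fun _ _ _ _ _ _ _ => mem_univ _⟩ Fp 1 one_pos ?_
    intro c hc _
    exact (hF' c hc).1.continuous
  obtain ⟨M, hM⟩ : ∃ M, ∀ t s, |F t s| ≤ M := by
    obtain ⟨M, hM⟩ := ((isCompact_Icc (a := -R) (b := R)).prod (isCompact_Icc (a := -R) (b := R))).exists_bound_of_continuousOn hcont.continuousOn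
    refine ⟨M, fun t s => ?_⟩
    obtain ⟨t', ht', he⟩ : ∃ t' ∈ Icc (-R) R, F t s = F t' s := by
      by_cases h : R ≤ |t|
      · exact ⟨0, ⟨by linarith, hR.le⟩, ht t s h⟩
      · rw [not_le, abs_lt] at h; exact ⟨t, ⟨h.1.le, h.2.le⟩, rfl⟩
    obtain ⟨s', hs', he'⟩ : ∃ s' ∈ Icc (-R) R, F t' s = F t' s' := by
      by_cases h : R ≤ |s|
      · exact ⟨0, ⟨by linarith, hR.le⟩, hs t' s h⟩
      · rw [not_le, abs_lt] at h; exact ⟨s, ⟨h.1.le, h.2.le⟩, rfl⟩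
    rw [he, he']
    exact hM (t', s') ⟨ht', hs'⟩
  have hM0 : 0 ≤ M := (abs_nonneg _).trans (hM 0 0)
  set K : Set (ℝ × ℝ) := Icc (-R-(n+2)) R ×ˢ Icc (-R) R with hK
  have hKc : IsCompact K := isCompact_Icc.prod isCompact_Icc
  have hKb : ∃ r > (0:ℝ), ∃ B : ℝ, 0 ≤ B ∧ ∀ x ∈ K, ∀ h, 0 < h → h < r →
      |dN (n+2) h (fun τ => Fp (x + τ • ((1:ℝ),(0:ℝ)))) 0| ≤ B * h^(n+1) := by
    refine hKc.induction_on (p := fun K => ∃ r > (0:ℝ), ∃ B : ℝ, 0 ≤ B ∧ ∀ x ∈ K, ∀ h, 0 < h → h < r →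
      |dN (n+2) h (fun τ => Fp (x + τ • ((1:ℝ),(0:ℝ)))) 0| ≤ B * h^(n+1)) ?_ ?_ ?_ ?_
    · exact ⟨1, one_pos, 0, le_rfl, fun x hx => hx.elim⟩
    · rintro s t hst ⟨r, hr, B, hB, H⟩
      exact ⟨r, hr, B, hB, fun x hx => H x (hst hx)⟩
    · rintro s t ⟨r, hr, B, hB, H⟩ ⟨r', hr', B', hB', H'⟩
      refine ⟨min r r', lt_min hr hr', B + B', by positivity, fun x hx h h0 hh => ?_⟩
      have hp : 0 < h^(n+1) := by positivity
      rcases hx with hx | hx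
      · refine (H x hx h h0 (hh.trans_le (min_le_left _ _))).trans ?_
        nlinarith
      · refine (H' x hx h h0 (hh.trans_le (min_le_right _ _))).trans ?_
        nlinarith
    · intro x₀ _
      obtain ⟨r, hr, B, hB, H⟩ := boman_local n Fp hF' ((1:ℝ),(0:ℝ)) x₀
      refine ⟨Metric.ball x₀ r, mem_nhdsWithin_of_mem_nhds (Metric.ball_mem_nhds _ hr), r, hr, B, hB, fun x hx => H x ?_⟩
      rwa [mem_ball_iff_norm] at hx
  obtain ⟨r, hr, B, hB, H⟩ := hKb
  set B' : ℝ := B + 2^(n+2) * M / r^(n+1) with hB'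
  have h2n : (0:ℝ) ≤ 2^(n+2) * M / r^(n+1) := by positivity
  refine ⟨M + B', fun t s => (hM t s).trans (by linarith), fun s => ?_, fun h h0 h1 t s => ?_⟩
  · exact hcont.comp (continuous_id.prodMk continuous_const)
  have hp : 0 < h^(n+1) := by positivity
  suffices h3 : ∀ t, |dN (n+2) h (fun t => F t s) t| ≤ B' * h^(n+1) by
    refine (h3 t).trans ?_
    nlinarith
  intro t
  have hB'0 : 0 ≤ B' := by positivity
  wlog hsR : |s| < R generalizing s
  · have e : (fun t => F t s) = fun t => F t 0 := funext fun t => hs t s (not_lt.1 hsR)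
    rw [e]
    exact this 0 (by simpa using hR)
  have hconst : (∀ i : ℕ, i ≤ n+2 → R ≤ |t + i*h|) → dN (n+2) h (fun t => F t s) t = 0 := by
    intro H
    rw [dN_congr (n+2) h 0 (fun t => F t s) (fun _ => F 0 s) t 0 (fun i hi => ht _ _ (H i hi)), dN_succ]
    have := dN_shift (n+1) 0 0 (fun _ => F 0 s) 0
    rw [← this, sub_self]
  by_cases hA : R ≤ t
  · rw [hconst (fun i hi => ?_)]
    · simp; positivity
    · have : 0 ≤ i*h := by positivity
      exact le_trans (by linarith) (le_abs_self _)
  by_cases hA' : t ≤ -R-(n+2)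
  · rw [hconst (fun i hi => ?_)]
    · simp; positivity
    · have hi' : (i:ℝ) ≤ n+2 := by exact_mod_cast hi
      have : i*h ≤ n+2 := (mul_le_of_le_one_right (by positivity) h1).trans hi'
      exact le_trans (by linarith) (neg_le_abs _)
  by_cases hhr : h < r
  · have hm : ((t,s) : ℝ × ℝ) ∈ K := by
      rw [abs_lt] at hsR
      exact ⟨⟨by simp only; linarith, by simp only; linarith⟩, ⟨hsR.1.le, hsR.2.le⟩⟩
    have := H (t,s) hm h h0 hhr
    rw [← dN_congr (n+2) h h (fun t => F t s) _ t 0 (fun i hi => by simp [hFp])] at this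
    refine this.trans ?_
    nlinarith
  · refine (dN_bound (n+2) h _ M (fun t => hM t s) t).trans ?_
    have h4 : r^(n+1) ≤ h^(n+1) := by gcongr; linarith
    have h5 : 2^(n+2)*M ≤ 2^(n+2) * M / r^(n+1) * h^(n+1) := by
      rw [div_mul_eq_mul_div, le_div_iff₀ (by positivity)]
      gcongr
    have : 0 ≤ B * h^(n+1) := by positivity
    rw [hB']; linarith

theorem boman_plane (n : ℕ) (hn : 1 ≤ n) (k : ℕ) (hk : k ≤ n) (F : ℝ → ℝ → ℝ) (R : ℝ) (hR : 0 < R)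
    (hF : ∀ c₁ c₂ : ℝ → ℝ, ContDiff ℝ (⊤ : ℕ∞) c₁ → ContDiff ℝ (⊤ : ℕ∞) c₂ → ZygmundClassR n (fun τ => F (c₁ τ) (c₂ τ)))
    (ht : ∀ t s, R ≤ |t| → F t s = F 0 s) (hs : ∀ t s, R ≤ |s| → F t s = F t 0) :
    ZygmundClassR (n-k) (fun t => iteratedDeriv k (F t) 0) := by
  obtain ⟨B, h1, h2, h3⟩ := boman_t n F R hR hF ht hs
  obtain ⟨B', h1', h2', h3'⟩ := boman_t n (fun s t => F t s) R hR (fun c₁ c₂ h₁ h₂ => hF c₂ c₁ h₂ h₁)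
    (fun t s => hs s t) (fun t s => ht s t)
  refine lemB n hn k hk F (max B B') (fun t s => (h1 t s).trans (le_max_left _ _)) h2 h2' ?_ ?_
  · intro h h0 hh t s
    refine (h3 h h0 hh t s).trans ?_
    gcongr; exact le_max_left _ _
  · intro h h0 hh t s
    refine (h3' h h0 hh s t).trans ?_
    gcongr; exact le_max_right _ _

end Part5

section Part6
open Set Filter Topology

theorem zyg_sub (q : ℕ) (U V : ℝ → ℝ) (hU : ZygmundClassR q U) (hV : ZygmundClassR q V) :
    ZygmundClassR q (fun t => U t - V t) := by
  refine ⟨hU.1.sub hV.1, fun K hK => ?_⟩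
  obtain ⟨C, hC⟩ := hU.2 K hK
  obtain ⟨D, hD⟩ := hV.2 K hK
  refine ⟨C + D, fun x h h1 h2 h3 h4 => ?_⟩
  have e : ∀ x, iteratedDeriv q (fun t => U t - V t) x = iteratedDeriv q U x - iteratedDeriv q V x := fun x =>
    iteratedDeriv_fun_sub hU.1.contDiffAt hV.1.contDiffAt
  rw [e, e, e]
  have a := abs_le.1 (hC x h h1 h2 h3 h4)
  have b := abs_le.1 (hD x h h1 h2 h3 h4)
  rw [abs_le]
  constructor <;> nlinarith

theorem zyg_cmul (q : ℕ) (a : ℝ) (U : ℝ → ℝ) (hU : ZygmundClassR q U) :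
    ZygmundClassR q (fun t => a * U t) := by
  refine ⟨contDiff_const.mul hU.1, fun K hK => ?_⟩
  obtain ⟨C, hC⟩ := hU.2 K hK
  refine ⟨|a| * C, fun x h h1 h2 h3 h4 => ?_⟩
  have e : ∀ x, iteratedDeriv q (fun t => a * U t) x = a * iteratedDeriv q U x := fun x => by
    rw [iteratedDeriv_const_mul_field]
  rw [e, e, e]
  have : a * iteratedDeriv q U (x + h) - 2 * (a * iteratedDeriv q U x) + a * iteratedDeriv q U (x - h) =
    a * (iteratedDeriv q U (x + h) - 2 * iteratedDeriv q U x + iteratedDeriv q U (x - h)) := by ring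
  rw [this, abs_mul, mul_assoc]
  gcongr
  exact hC x h h1 h2 h3 h4

theorem zyg_shift (q : ℕ) (a : ℝ) (U : ℝ → ℝ) (hU : ZygmundClassR q U) :
    ZygmundClassR q (fun t => U (t - a)) := by
  refine ⟨hU.1.comp (contDiff_id.sub contDiff_const), fun K hK => ?_⟩
  obtain ⟨C, hC⟩ := hU.2 ((fun t => t - a) '' K) (hK.image (by fun_prop))
  refine ⟨C, fun x h h1 h2 h3 h4 => ?_⟩
  have e : ∀ x, iteratedDeriv q (fun t => U (t - a)) x = iteratedDeriv q U (x - a) := fun x => by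
    rw [iteratedDeriv_comp_sub_const]
  rw [e, e, e]
  have := hC (x - a) h ⟨x, h1, rfl⟩ ⟨x+h, h2, by ring⟩ ⟨x-h, h3, by ring⟩ h4
  rw [show x + h - a = x - a + h by ring, show x - h - a = x - a - h by ring]
  exact this

theorem zyg_local (q : ℕ) (G : ℝ → ℝ) (H : ∀ t₀, ∃ V, ZygmundClassR q V ∧ V =ᶠ[𝓝 t₀] G) : ZygmundClassR q G := by
  have hG : ContDiff ℝ q G := by
    rw [contDiff_iff_contDiffAt]
    intro t₀
    obtain ⟨V, hV, h⟩ := H t₀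
    exact hV.1.contDiffAt.congr_of_eventuallyEq h.symm
  refine ⟨hG, fun K hK => ?_⟩
  have hl : ∃ δ > (0:ℝ), ∃ C : ℝ, 0 ≤ C ∧ ∀ x ∈ K, ∀ h : ℝ, |h| < δ →
      |iteratedDeriv q G (x + h) - 2 * iteratedDeriv q G x + iteratedDeriv q G (x - h)| ≤ C * |h| := by
    refine hK.induction_on (p := fun K => ∃ δ > (0:ℝ), ∃ C : ℝ, 0 ≤ C ∧ ∀ x ∈ K, ∀ h : ℝ, |h| < δ →
      |iteratedDeriv q G (x + h) - 2 * iteratedDeriv q G x + iteratedDeriv q G (x - h)| ≤ C * |h|) ?_ ?_ ?_ ?_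
    · exact ⟨1, one_pos, 0, le_rfl, fun x hx => hx.elim⟩
    · rintro s t hst ⟨r, hr, B, hB, H⟩
      exact ⟨r, hr, B, hB, fun x hx => H x (hst hx)⟩
    · rintro s t ⟨r, hr, B, hB, H⟩ ⟨r', hr', B', hB', H'⟩
      refine ⟨min r r', lt_min hr hr', B + B', by positivity, fun x hx h hh => ?_⟩
      have hp : 0 ≤ |h| := by positivity
      rcases hx with hx | hx
      · refine (H x hx h (hh.trans_le (min_le_left _ _))).trans ?_
        nlinarith
      · refine (H' x hx h (hh.trans_le (min_le_right _ _))).trans ?_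
        nlinarith
    · intro t₀ _
      obtain ⟨V, hV, h⟩ := H t₀
      obtain ⟨r, hr, hb⟩ := Metric.eventually_nhds_iff_ball.1 h.eventuallyEq_nhds
      obtain ⟨C, hC⟩ := hV.2 (Metric.closedBall t₀ r) (isCompact_closedBall _ _)
      refine ⟨Metric.ball t₀ (r/2), mem_nhdsWithin_of_mem_nhds (Metric.ball_mem_nhds _ (by linarith)), r/2, by linarith, |C|, abs_nonneg _, fun x hx k hk => ?_⟩
      have e : ∀ y ∈ Metric.ball t₀ r, iteratedDeriv q G y = iteratedDeriv q V y := fun y hy =>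
        ((hb y hy).iteratedDeriv_eq q).symm
      rw [Metric.mem_ball, Real.dist_eq, abs_lt] at hx
      rw [abs_lt] at hk
      have m1 : x + k ∈ Metric.ball t₀ r := by
        rw [Metric.mem_ball, Real.dist_eq, abs_lt]; constructor <;> linarith
      have m2 : x ∈ Metric.ball t₀ r := by
        rw [Metric.mem_ball, Real.dist_eq, abs_lt]; constructor <;> linarith
      have m3 : x - k ∈ Metric.ball t₀ r := by
        rw [Metric.mem_ball, Real.dist_eq, abs_lt]; constructor <;> linarith
      rw [e _ m1, e _ m2, e _ m3]
      by_cases hk0 : k = 0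
      · subst hk0; simp; ring
      refine (hC x k (Metric.ball_subset_closedBall m2) (Metric.ball_subset_closedBall m1) (Metric.ball_subset_closedBall m3) hk0).trans ?_
      gcongr
      exact le_abs_self _
  obtain ⟨δ, hδ, C, hC, hl⟩ := hl
  obtain ⟨M, hM⟩ := hK.exists_bound_of_continuousOn (hG.continuous_iteratedDeriv q le_rfl).continuousOn
  refine ⟨C + 4 * |M| / δ, fun x h h1 h2 h3 h4 => ?_⟩
  have hq : 0 ≤ 4 * |M| / δ := by positivity
  by_cases hh : |h| < δ
  · refine (hl x h1 h hh).trans ?_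
    nlinarith [abs_nonneg h]
  · have a1 := (hM _ h1).trans (le_abs_self M)
    have a2 := (hM _ h2).trans (le_abs_self M)
    have a3 := (hM _ h3).trans (le_abs_self M)
    rw [Real.norm_eq_abs, abs_le] at a1 a2 a3
    have : 4 * |M| ≤ 4 * |M| / δ * |h| := by
      rw [div_mul_eq_mul_div, le_div_iff₀ hδ]
      have := abs_nonneg M
      have := not_lt.1 hh
      nlinarith
    have h5 : 0 ≤ C * |h| := by positivity
    rw [abs_le]; constructor <;> nlinarith

/-- Smooth cutoff of the identity. -/
theorem exists_chi (δ : ℝ) (hδ : 0 < δ) : ∃ χ : ℝ → ℝ, ContDiff ℝ (⊤ : ℕ∞) χ ∧ (∀ t, |t| ≤ δ/2 → χ t = t) ∧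
    (∀ t, δ ≤ |t| → χ t = 0) ∧ ∀ t, |χ t| ≤ δ := by
  obtain ⟨b, h1, h2, h3, h4⟩ := exists_bump (δ/2) δ (by linarith) (by linarith)
  refine ⟨fun t => t * b t, contDiff_id.mul h1, fun t ht => by simp [h2 t ht], fun t ht => by simp [h3 t ht], fun t => ?_⟩
  by_cases ht : δ ≤ |t|
  · simp [h3 t ht, hδ.le]
  · rw [abs_mul, abs_of_nonneg (h4 t).1]
    exact (mul_le_of_le_one_right (abs_nonneg _) (h4 t).2).trans (not_le.1 ht).le

section
variable {E : Type*} [NormedAddCommGroup E] [NormedSpace ℝ E]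

theorem lemQ (n : ℕ) (hn : 1 ≤ n) (k : ℕ) (hk : k ≤ n) (X : Set E) (f : E → ℝ)
    (hf : ∀ c : ℝ → E, ContDiff ℝ (⊤ : ℕ∞) c → (∀ t, c t ∈ X) → ZygmundClassR n (f ∘ c))
    (P : ℝ → E) (hP : ContDiff ℝ (⊤ : ℕ∞) P) (hP0 : P 0 = 0) (R : ℝ) (hR : 0 < R) (hPR : ∀ s, R ≤ |s| → P s = 0)
    (W : Set E) (hW : IsOpen W) (hPX : ∀ y ∈ X, y ∈ W → ∀ s, y + P s ∈ X)
    (c : ℝ → E) (hc : ContDiff ℝ (⊤ : ℕ∞) c) (hcX : ∀ t, c t ∈ X) (t₀ : ℝ) (ht₀ : c t₀ ∈ W) :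
    ∃ V, ZygmundClassR (n-k) V ∧ V =ᶠ[𝓝 t₀] fun t => iteratedDeriv k (fun s => f (c t + P s)) 0 := by
  obtain ⟨δ, hδ, hb⟩ := Metric.eventually_nhds_iff_ball.1 (hc.continuous.continuousAt.preimage_mem_nhds (hW.mem_nhds ht₀))
  obtain ⟨χ, h1, h2, h3, h4⟩ := exists_chi (δ/2) (by linarith)
  have hcW : ∀ t, c (t₀ + χ t) ∈ W := fun t => hb _ (by
    rw [Metric.mem_ball, Real.dist_eq, add_sub_cancel_left]; linarith [h4 t])
  have key := boman_plane n hn k hk (fun t s => f (c (t₀ + χ t) + P s)) (max (δ/2) R) (lt_max_of_lt_right hR) ?_ ?_ ?_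
  · refine ⟨_, zyg_shift _ t₀ _ key, ?_⟩
    filter_upwards [Metric.ball_mem_nhds t₀ (show 0 < δ/2/2 by linarith)] with t ht
    rw [Metric.mem_ball, Real.dist_eq] at ht
    rw [h2 _ ht.le, add_sub_cancel]
  · intro c₁ c₂ hc₁ hc₂
    refine hf (fun τ => c (t₀ + χ (c₁ τ)) + P (c₂ τ)) ?_ (fun τ => hPX _ (hcX _) (hcW _) _)
    exact (hc.comp (contDiff_const.add (h1.comp hc₁))).add (hP.comp hc₂)
  · intro t s ht
    rw [h3 t ((le_max_left _ _).trans ht), h2 0 (by simp; linarith)]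
  · intro t s hs
    rw [hPR s ((le_max_right _ _).trans hs), hP0]
end

end Part6

section Part7
open Set Filter Topology

theorem goodPt_all (d : ℕ) (β : ℝ) (hβ : β ∈ Set.Ioc (0 : ℝ) 1)
    (X : Set (EuclideanSpace ℝ (Fin (d + 1)))) (hXcl : IsClosed X)
    (hX : X = closure (interior X)) (hcusp : UniformCuspProperty d β (interior X)) :
    ∀ x ∈ X, GoodPt ⌈2 / β⌉₊ X x := by
  intro x hx
  obtain ⟨hβ0, hβ1⟩ := hβ
  set p := ⌈2 / β⌉₊ with hp
  have hpβ : 2 ≤ p * β := by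
    have := Nat.le_ceil (2 / β)
    rwa [div_le_iff₀ hβ0] at this
  have hp2 : 2 ≤ p := by
    have : (2:ℝ) ≤ p := by
      have : (0:ℝ) ≤ p := by positivity
      nlinarith
    exact_mod_cast this
  by_cases hxi : x ∈ interior X
  · obtain ⟨r, hr, hb⟩ := Metric.isOpen_iff.1 isOpen_interior x hxi
    refine ⟨0, r/2, by linarith, r/2, by linarith, fun y hy hyx s hs w hw => ?_⟩
    apply interior_subset
    apply hb
    rw [mem_ball_iff_norm, smul_zero, add_zero]
    have e : y + w - x = (y - x) + w := by abel
    rw [e]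
    have h1 : |s|^p ≤ 1 := pow_le_one₀ (abs_nonneg _) hs
    have := norm_add_le (y - x) w
    nlinarith
  · have hfr : x ∈ frontier (closure (interior X)) := by
      rw [← hX]
      exact ⟨subset_closure hx, hxi⟩
    obtain ⟨ε, hε, r, hr, h, hh, A, hA⟩ := hcusp x hfr
    rw [← hX] at hA
    set q : ℝ := (1/4 : ℝ)^(1/β) with hq
    have hq0 : 0 < q := by positivity
    have hqβ : q^β = 1/4 := by
      rw [hq, ← Real.rpow_mul (by norm_num), one_div_mul_cancel hβ0.ne', Real.rpow_one]
    refine ⟨A (EuclideanSpace.single (Fin.last d) (h/2)), ε, hε, min (h/8) (min (r/2) (r*q)), by positivity, ?_⟩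
    intro y hy hyx s hs w hw
    set ρ := min (h/8) (min (r/2) (r*q)) with hρ
    have hρ0 : 0 < ρ := by positivity
    have hρ1 : ρ ≤ h/8 := min_le_left _ _
    have hρ2 : ρ ≤ r/2 := (min_le_right _ _).trans (min_le_left _ _)
    have hρ3 : ρ ≤ r*q := (min_le_right _ _).trans (min_le_right _ _)
    by_cases hs0 : s = 0
    · subst hs0
      rw [abs_zero, zero_pow (by omega), mul_zero] at hw
      have hw0 : w = 0 := norm_le_zero_iff.1 hw
      simpa [hw0] using hy
    have hsp : 0 < |s| := abs_pos.2 hs0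
    have hs2 : |s|^p ≤ s^2 := by
      rw [← sq_abs]; exact pow_le_pow_of_le_one (abs_nonneg _) hs hp2
    have hsq1 : s^2 ≤ 1 := by rw [← sq_abs]; exact pow_le_one₀ (abs_nonneg _) hs
    have hsq0 : 0 < s^2 := by positivity
    set u := A.symm w with hu
    have hun : ‖u‖ ≤ ρ * |s|^p := by rw [hu, LinearIsometryEquiv.norm_map]; exact hw
    have hus : ‖u‖ ≤ ρ * s^2 := hun.trans (by gcongr)
    have hnorm : ‖u‖^2 = (∑ i : Fin d, u i.castSucc ^ 2) + u (Fin.last d)^2 := by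
      rw [EuclideanSpace.norm_sq_eq, Fin.sum_univ_castSucc]; simp
    have hlast : |u (Fin.last d)| ≤ ‖u‖ := by
      refine abs_le_of_sq_le_sq ?_ (norm_nonneg _)
      rw [hnorm]
      have : 0 ≤ ∑ i : Fin d, u i.castSucc ^ 2 := Finset.sum_nonneg fun i _ => sq_nonneg _
      linarith
    have hsq : Real.sqrt (∑ i : Fin d, u i.castSucc ^ 2) ≤ ‖u‖ := by
      rw [← Real.sqrt_sq (norm_nonneg u), hnorm]
      apply Real.sqrt_le_sqrt
      nlinarith [sq_nonneg (u (Fin.last d))]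
    set z : EuclideanSpace ℝ (Fin (d+1)) := s^2 • EuclideanSpace.single (Fin.last d) (h/2) + u with hz
    have hAz : y + s^2 • A (EuclideanSpace.single (Fin.last d) (h/2)) + w = y + A z := by
      rw [hz, map_add, map_smul, hu, LinearIsometryEquiv.apply_symm_apply]; abel
    rw [hAz]
    apply interior_subset
    refine hA y ⟨hy, by rwa [mem_ball_iff_norm]⟩ z ?_
    have hzc : ∀ i : Fin d, z i.castSucc = u i.castSucc := by
      intro i
      simp [hz, (Fin.castSucc_lt_last i).ne]
    have hzl : z (Fin.last d) = s^2 * (h/2) + u (Fin.last d) := by simp [hz]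
    simp only [cuspSet, mem_ofPred_eq, hzc, hzl]
    set Q := Real.sqrt (∑ i : Fin d, u i.castSucc ^ 2) with hQ
    have hQ0 : 0 ≤ Q := Real.sqrt_nonneg _
    have hl := abs_le.1 (hlast.trans hus)
    have b1 : ρ * s^2 ≤ h/8 * s^2 := by gcongr
    have b2 : ρ * s^2 ≤ ρ := mul_le_of_le_one_right hρ0.le hsq1
    have b3 : (Q/r)^β ≤ 1/4 * s^2 := by
      have c1 : Q / r ≤ q * |s|^p := by
        rw [div_le_iff₀ hr]
        calc Q ≤ ρ * |s|^p := hsq.trans hun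
          _ ≤ r * q * |s|^p := by gcongr
          _ = _ := by ring
      calc (Q/r)^β ≤ (q * |s|^p)^β := by gcongr
        _ = q^β * (|s|^p)^β := Real.mul_rpow hq0.le (by positivity)
        _ = 1/4 * |s|^((p:ℝ)*β) := by rw [hqβ, Real.rpow_natCast_mul (abs_nonneg _)]
        _ ≤ 1/4 * |s|^(2:ℝ) := by
          gcongr 1/4 * ?_
          exact Real.rpow_le_rpow_of_exponent_ge hsp hs hpβ
        _ = 1/4 * s^2 := by norm_num
    refine ⟨by linarith [hsq.trans hus], ?_, ?_⟩
    · have : h * (Q/r)^β ≤ h * (1/4 * s^2) := by gcongr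
      nlinarith
    · nlinarith

end Part7

section Part8
open Set Filter Topology Asymptotics

theorem peano_zero (p : ℕ) (G : ℝ → ℝ) (hG : ContDiff ℝ p G) (ho : G =o[𝓝 0] fun s => s^p) (k : ℕ) (hk : k ≤ p) :
    iteratedDeriv k G 0 = 0 := by
  induction k using Nat.strong_induction_on with
  | _ k ih =>
  have h1 := taylor_isLittleO_univ (x₀ := 0) (hG.of_le (show (k : WithTop ℕ∞) ≤ p by exact_mod_cast hk))
  have h2 : (fun s : ℝ => s^p) =O[𝓝 0] fun s : ℝ => s^k := by
    refine IsBigO.of_bound 1 ?_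
    filter_upwards [Metric.ball_mem_nhds (0:ℝ) one_pos] with s hs
    rw [Metric.mem_ball, dist_zero_right, Real.norm_eq_abs] at hs
    rw [one_mul, norm_pow, norm_pow]
    exact pow_le_pow_of_le_one (norm_nonneg _) hs.le hk
  simp only [sub_zero] at h1
  have h3 := (ho.trans_isBigO h2).sub h1
  have h4 : (fun x => G x - (G x - taylorWithinEval G k univ 0 x)) = fun x => ((k.factorial:ℝ)⁻¹ * iteratedDeriv k G 0) * x^k := by
    funext x
    rw [sub_sub_cancel, taylor_within_apply, Finset.sum_range_succ, Finset.sum_eq_zero]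
    · simp [iteratedDerivWithin_univ]; ring
    · intro j hj
      have := Finset.mem_range.1 hj
      rw [iteratedDerivWithin_univ, ih j this (by omega), smul_zero]
  rw [h4] at h3
  by_contra hne
  rw [isLittleO_const_mul_left_iff (by positivity)] at h3
  refine isLittleO_irrefl ?_ h3
  have : ∃ᶠ x : ℝ in 𝓝[≠] 0, x^k ≠ 0 := by
    apply Eventually.frequently
    filter_upwards [self_mem_nhdsWithin] with x hx
    exact pow_ne_zero _ hx
  exact this.filter_mono nhdsWithin_le_nhds

theorem peano_coeff (p : ℕ) (H : ℝ → ℝ) (hH : ContDiff ℝ p H) (L : ℝ) (ho : (fun s => H s - L * s^p) =o[𝓝 0] fun s => s^p) :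
    iteratedDeriv p H 0 = p.factorial * L := by
  have h1 : ContDiff ℝ p (fun s : ℝ => L * s^p) := contDiff_const.mul (contDiff_id.pow p)
  have h := peano_zero p _ (hH.sub h1) ho p le_rfl
  rw [iteratedDeriv_fun_sub hH.contDiffAt h1.contDiffAt, iteratedDeriv_const_mul_field, iteratedDeriv_fun_pow_zero] at h
  simp at h
  linarith

theorem frechet_of_partials (n : ℕ) (U : Set (EuclideanSpace ℝ (Fin n))) (hU : IsOpen U) (f : EuclideanSpace ℝ (Fin n) → ℝ)
    (g : Fin n → EuclideanSpace ℝ (Fin n) → ℝ) (hg : ∀ i, ContinuousOn (g i) U)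
    (hd : ∀ i, ∀ y ∈ U, HasDerivAt (fun s : ℝ => f (y + s • EuclideanSpace.single i (1:ℝ))) (g i y) 0) (y : EuclideanSpace ℝ (Fin n)) (hy : y ∈ U) :
    HasFDerivAt f (∑ i, g i y • (EuclideanSpace.proj i : EuclideanSpace ℝ (Fin n) →L[ℝ] ℝ)) y := by
  have main : ∀ S : Finset (Fin n), ∀ ε > (0:ℝ), ∃ δ > (0:ℝ), ∀ z w : EuclideanSpace ℝ (Fin n), ‖z - y‖ < δ → ‖w - y‖ < δ →
      (∀ i ∉ S, w i = z i) → |f w - f z - ∑ i, g i y * (w i - z i)| ≤ ε * ‖w - z‖ := by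
    intro S
    induction S using Finset.induction_on with
    | empty =>
      intro ε hε
      refine ⟨1, one_pos, fun z w _ _ h => ?_⟩
      have : w = z := by ext i; exact h i (by simp)
      subst this; simp
    | insert j S hj ih =>
      intro ε hε
      obtain ⟨δ₁, hδ₁, H₁⟩ := ih (ε/4) (by linarith)
      obtain ⟨δ₂, hδ₂, H₂⟩ := Metric.isOpen_iff.1 hU y hy
      obtain ⟨δ₃, hδ₃, H₃⟩ := Metric.continuousWithinAt_iff.1 (hg j y hy) (ε/2) (by linarith)
      refine ⟨min δ₁ (min δ₂ δ₃) / 3, by positivity, fun z w hz hw hS => ?_⟩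
      set δ := min δ₁ (min δ₂ δ₃) / 3 with hδ
      have hm1 : 3 * δ ≤ δ₁ := by rw [hδ]; linarith [min_le_left δ₁ (min δ₂ δ₃)]
      have hm2 : 3 * δ ≤ δ₂ := by rw [hδ]; linarith [min_le_right δ₁ (min δ₂ δ₃), min_le_left δ₂ δ₃]
      have hm3 : 3 * δ ≤ δ₃ := by rw [hδ]; linarith [min_le_right δ₁ (min δ₂ δ₃), min_le_right δ₂ δ₃]
      set a := w j - z j with ha
      set w' := w - a • EuclideanSpace.single j (1:ℝ) with hw'
      have haw : |a| ≤ ‖w - z‖ := by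
        have := PiLp.norm_apply_le (w - z) j
        simpa [ha] using this
      have hwz : ‖w - z‖ ≤ ‖w - y‖ + ‖z - y‖ := by
        rw [← norm_neg (z - y), show w - z = (w - y) + -(z - y) by abel]; exact norm_add_le _ _
      have hn1 : ∀ s : ℝ, ‖s • EuclideanSpace.single j (1:ℝ)‖ = |s| := by intro s; simp [norm_smul]
      have hseg : ∀ s : ℝ, |s - a| ≤ |a| → ‖w' + s • EuclideanSpace.single j (1:ℝ) - y‖ < 3 * δ := by
        intro s hs
        have : w' + s • EuclideanSpace.single j (1:ℝ) - y = (w - y) + (s - a) • EuclideanSpace.single j (1:ℝ) := by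
          rw [hw', sub_smul _ a]; abel
        rw [this]
        refine (norm_add_le _ _).trans_lt ?_
        rw [hn1]; linarith
      have hw'y : ‖w' - y‖ < 3 * δ := by simpa using hseg 0 (by simp)
      have hw'z : ‖w' - z‖ ≤ 2 * ‖w - z‖ := by
        have : w' - z = (w - z) + (-a) • EuclideanSpace.single j (1:ℝ) := by rw [hw', neg_smul]; abel
        rw [this]
        refine (norm_add_le _ _).trans ?_
        rw [hn1, abs_neg]; linarith
      have hw'j : ∀ i, w' i = w i - if i = j then a else 0 := by
        intro i; simp [hw']
      have e1 := H₁ z w' (by linarith) (by linarith) (fun i hi => by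
        rw [hw'j]
        split_ifs with hij
        · subst hij; simp [ha]
        · rw [sub_zero]; exact hS i (by simp [hij, hi]))
      have e2 : |f w - f w' - g j y * a| ≤ ε/2 * |a| := by
        have hD : ∀ s ∈ uIcc 0 a, HasDerivWithinAt (fun s : ℝ => f (w' + s • EuclideanSpace.single j (1:ℝ)) - g j y * s)
            (g j (w' + s • EuclideanSpace.single j (1:ℝ)) - g j y * 1) (uIcc 0 a) s := by
          intro s hs
          have hs' : |s - a| ≤ |a| := by
            have := abs_sub_right_of_mem_uIcc hs
            simpa [abs_sub_comm] using this
          have := hd j (w' + s • EuclideanSpace.single j (1:ℝ)) (H₂ (by rw [mem_ball_iff_norm]; linarith [hseg s hs']))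
          have h2 : HasDerivAt (fun s : ℝ => f (w' + s • EuclideanSpace.single j (1:ℝ))) (g j (w' + s • EuclideanSpace.single j (1:ℝ))) s := by
            have h3 := HasDerivAt.comp_sub_const s s (f := fun σ : ℝ => f (w' + s • EuclideanSpace.single j (1:ℝ) + σ • EuclideanSpace.single j (1:ℝ)))
              (f' := g j (w' + s • EuclideanSpace.single j (1:ℝ))) (by rw [sub_self]; exact this)
            have h4 : (fun x : ℝ => f (w' + s • EuclideanSpace.single j (1:ℝ) + (x - s) • EuclideanSpace.single j (1:ℝ))) =
                fun x : ℝ => f (w' + x • EuclideanSpace.single j (1:ℝ)) := by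
              funext x
              rw [add_assoc, ← add_smul, add_sub_cancel]
            rw [h4] at h3
            exact h3
          exact (h2.sub ((hasDerivAt_id s).const_mul (g j y))).hasDerivWithinAt
        have := Convex.norm_image_sub_le_of_norm_hasDerivWithin_le hD (C := ε/2) (fun s hs => by
          have hs' : |s - a| ≤ |a| := by
            have := abs_sub_right_of_mem_uIcc hs
            simpa [abs_sub_comm] using this
          have h5 := hseg s hs'
          have := H₃ (H₂ (show w' + s • EuclideanSpace.single j (1:ℝ) ∈ Metric.ball y δ₂ by rw [mem_ball_iff_norm]; linarith)) (by rw [dist_eq_norm]; linarith)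
          rw [mul_one, Real.norm_eq_abs, ← Real.dist_eq]; exact this.le) (convex_uIcc 0 a) left_mem_uIcc right_mem_uIcc
        have h6 : w' + a • EuclideanSpace.single j (1:ℝ) = w := by rw [hw']; abel
        rw [h6] at this
        simp only [zero_smul, add_zero, mul_zero, sub_zero, Real.norm_eq_abs] at this
        convert this using 2; ring
      have e3 : ∑ i, g i y * (w i - z i) = ∑ i, g i y * (w' i - z i) + g j y * a := by
        have : ∀ i, g i y * (w i - z i) = g i y * (w' i - z i) + if i = j then g i y * a else 0 := by
          intro i; rw [hw'j]; split_ifs <;> ring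
        rw [Finset.sum_congr rfl fun i _ => this i, Finset.sum_add_distrib]; simp
      rw [e3]
      rw [abs_le] at e1 e2 ⊢
      constructor <;> nlinarith
  rw [hasFDerivAt_iff_isLittleO, isLittleO_iff]
  intro ε hε
  obtain ⟨δ, hδ, H⟩ := main Finset.univ ε hε
  filter_upwards [Metric.ball_mem_nhds y hδ] with w hw
  rw [mem_ball_iff_norm] at hw
  have := H y w (by simpa using hδ) hw (by simp)
  simpa [sum_apply] using this

end Part8

section Part9
open Set Filter Topology Asymptotics

section
variable {N : ℕ}

theorem c1_interior (n : ℕ) (hn : 1 ≤ n) (p : ℕ) (X : Set (EuclideanSpace ℝ (Fin N))) (hgood : ∀ x ∈ X, GoodPt p X x)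
    (f : EuclideanSpace ℝ (Fin N) → ℝ)
    (hf : ∀ c : ℝ → EuclideanSpace ℝ (Fin N), ContDiff ℝ (⊤ : ℕ∞) c → (∀ t, c t ∈ X) → ZygmundClassR n (f ∘ c)) :
    ∀ y ∈ interior X, HasStrictFDerivAt f (fderiv ℝ f y) y := by
  set G : Fin N → EuclideanSpace ℝ (Fin N) → ℝ := fun i y => deriv (fun s : ℝ => f (y + s • EuclideanSpace.single i (1:ℝ))) 0 with hG
  have loc : ∀ i, ∀ x ∈ interior X, ContinuousWithinAt (G i) X x ∧
      HasDerivAt (fun s : ℝ => f (x + s • EuclideanSpace.single i (1:ℝ))) (G i x) 0 := by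
    intro i x hx
    obtain ⟨r, hr, hb⟩ := Metric.isOpen_iff.1 isOpen_interior x hx
    obtain ⟨χ, h1, h2, h3, h4⟩ := exists_chi (r/2) (by linarith)
    set P : ℝ → EuclideanSpace ℝ (Fin N) := fun s => χ s • EuclideanSpace.single i (1:ℝ) with hP
    have hPs : ContDiff ℝ (⊤ : ℕ∞) P := h1.smul contDiff_const
    have hP0 : P 0 = 0 := by simp [hP, h2 0 (by simp; linarith)]
    have hPX : ∀ y ∈ X, y ∈ Metric.ball x (r/2) → ∀ s, y + P s ∈ X := by
      intro y _ hy s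
      apply interior_subset
      apply hb
      rw [mem_ball_iff_norm] at hy ⊢
      have e : y + P s - x = (y - x) + P s := by abel
      have hn : ‖P s‖ ≤ r/2 := by
        simp only [hP, norm_smul]
        simpa using h4 s
      rw [e]
      linarith [norm_add_le (y - x) (P s)]
    have hev : ∀ y : EuclideanSpace ℝ (Fin N), (fun s : ℝ => f (y + s • EuclideanSpace.single i (1:ℝ))) =ᶠ[𝓝 0] fun s => f (y + P s) := by
      intro y
      filter_upwards [Metric.ball_mem_nhds (0:ℝ) (show 0 < r/2/2 by linarith)] with s hs
      rw [Metric.mem_ball, dist_zero_right, Real.norm_eq_abs] at hs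
      simp only [hP, h2 s hs.le]
    have hGP : ∀ y, G i y = iteratedDeriv 1 (fun s => f (y + P s)) 0 := by
      intro y
      rw [iteratedDeriv_one]
      exact (hev y).deriv_eq
    constructor
    · refine curve_cont p X x (interior_subset hx) (hgood x (interior_subset hx)) (G i) (r/2) (by linarith) ?_
      intro c hc hcX
      rw [continuous_iff_continuousAt]
      intro t₀
      obtain ⟨V, hV, hVe⟩ := lemQ n hn 1 hn X f hf P hPs hP0 (r/2) (by linarith) (fun s hs => by simp [hP, h3 s hs])
        (Metric.ball x (r/2)) Metric.isOpen_ball hPX c hc (fun t => (hcX t).1) t₀ (by rw [mem_ball_iff_norm]; exact (hcX t₀).2)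
      have : G i ∘ c = fun t => iteratedDeriv 1 (fun s => f (c t + P s)) 0 := funext fun t => hGP (c t)
      rw [this]
      exact hV.1.continuous.continuousAt.congr hVe
    · have hz := hf (fun s => x + P s) (contDiff_const.add hPs) (fun s => hPX x (interior_subset hx) (Metric.mem_ball_self (by linarith)) s)
      have hd : DifferentiableAt ℝ (fun s => f (x + P s)) 0 :=
        (hz.1.differentiable (by exact_mod_cast (show n ≠ 0 by omega))) 0
      exact (hd.congr_of_eventuallyEq (hev x)).hasDerivAt
  have hGc : ∀ i, ContinuousOn (G i) (interior X) := fun i x hx => ((loc i x hx).1).mono interior_subset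
  have hFD : ∀ y ∈ interior X, HasFDerivAt f (∑ i, G i y • (EuclideanSpace.proj i : EuclideanSpace ℝ (Fin N) →L[ℝ] ℝ)) y :=
    fun y hy => frechet_of_partials N (interior X) isOpen_interior f G hGc (fun i y hy => (loc i y hy).2) y hy
  intro y hy
  rw [(hFD y hy).fderiv]
  refine hasStrictFDerivAt_of_hasFDerivAt_of_continuousAt (f' := fun y => ∑ i, G i y • (EuclideanSpace.proj i : EuclideanSpace ℝ (Fin N) →L[ℝ] ℝ)) ?_ ?_
  · filter_upwards [isOpen_interior.mem_nhds hy] with z hz using hFD z hz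
  · refine tendsto_finsetSum _ fun i _ => ?_
    exact Tendsto.smul_const ((hGc i).continuousAt (isOpen_interior.mem_nhds hy)) _

theorem local_ext (n p : ℕ) (hp : 1 ≤ p) (hn : p ≤ n) (X : Set (EuclideanSpace ℝ (Fin N))) (hgood : ∀ x ∈ X, GoodPt p X x)
    (f : EuclideanSpace ℝ (Fin N) → ℝ)
    (hf : ∀ c : ℝ → EuclideanSpace ℝ (Fin N), ContDiff ℝ (⊤ : ℕ∞) c → (∀ t, c t ∈ X) → ZygmundClassR n (f ∘ c))
    (i : Fin N) (x : EuclideanSpace ℝ (Fin N)) (hx : x ∈ X) :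
    ∃ D : EuclideanSpace ℝ (Fin N) → ℝ, ∃ ε > (0:ℝ),
      (∀ c : ℝ → EuclideanSpace ℝ (Fin N), ContDiff ℝ (⊤ : ℕ∞) c → (∀ t, c t ∈ X) → ∀ t₀, c t₀ ∈ Metric.ball x ε →
        ∃ V, ZygmundClassR (n-p) V ∧ V =ᶠ[𝓝 t₀] fun t => D (c t)) ∧
      ∀ y ∈ interior X, y ∈ Metric.ball x ε → D y = pd N i f y := by
  obtain ⟨e, ε, hε, ρ, hρ, hG⟩ := hgood x hx
  obtain ⟨χ, h1, h2, h3, h4⟩ := exists_chi 1 one_pos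
  have hχ0 : χ 0 = 0 := h2 0 (by norm_num)
  set v : EuclideanSpace ℝ (Fin N) := ρ • EuclideanSpace.single i (1:ℝ) with hv
  have hvn : ‖v‖ = ρ := by simp [hv, norm_smul, abs_of_pos hρ]
  set P : ℝ → EuclideanSpace ℝ (Fin N) := fun s => (χ s)^2 • e + (χ s)^p • v with hP
  set P' : ℝ → EuclideanSpace ℝ (Fin N) := fun s => (χ s)^2 • e with hP'
  have hPs : ContDiff ℝ (⊤ : ℕ∞) P := ((h1.pow 2).smul contDiff_const).add ((h1.pow p).smul contDiff_const)
  have hPs' : ContDiff ℝ (⊤ : ℕ∞) P' := (h1.pow 2).smul contDiff_const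
  have hp0 : p ≠ 0 := by omega
  have hPz : ∀ s, χ s = 0 → P s = 0 := fun s hs => by simp [hP, hs, hp0]
  have hPz' : ∀ s, χ s = 0 → P' s = 0 := fun s hs => by simp [hP', hs]
  have hPX : ∀ y ∈ X, y ∈ Metric.ball x ε → ∀ s, y + P s ∈ X := by
    intro y hy hyx s
    rw [mem_ball_iff_norm] at hyx
    have := hG y hy hyx (χ s) (h4 s) ((χ s)^p • v) (by
      rw [norm_smul, norm_pow, Real.norm_eq_abs, hvn, mul_comm])
    rwa [add_assoc] at this
  have hPX' : ∀ y ∈ X, y ∈ Metric.ball x ε → ∀ s, y + P' s ∈ X := by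
    intro y hy hyx s
    rw [mem_ball_iff_norm] at hyx
    have := hG y hy hyx (χ s) (h4 s) 0 (by simp; positivity)
    rwa [add_zero] at this
  refine ⟨fun y => ((p.factorial : ℝ) * ρ)⁻¹ * (iteratedDeriv p (fun s => f (y + P s)) 0 - iteratedDeriv p (fun s => f (y + P' s)) 0), ε, hε, ?_, ?_⟩
  · intro c hc hcX t₀ ht₀
    obtain ⟨V, hV, hVe⟩ := lemQ n (by omega) p hn X f hf P hPs (hPz 0 hχ0) 1 one_pos (fun s hs => hPz s (h3 s hs))
      (Metric.ball x ε) Metric.isOpen_ball hPX c hc hcX t₀ ht₀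
    obtain ⟨V', hV', hVe'⟩ := lemQ n (by omega) p hn X f hf P' hPs' (hPz' 0 hχ0) 1 one_pos (fun s hs => hPz' s (h3 s hs))
      (Metric.ball x ε) Metric.isOpen_ball hPX' c hc hcX t₀ ht₀
    refine ⟨_, zyg_cmul _ ((p.factorial : ℝ) * ρ)⁻¹ _ (zyg_sub _ V V' hV hV'), ?_⟩
    filter_upwards [hVe, hVe'] with t h h'
    rw [h, h']
  · intro y hy hyx
    have hstr := c1_interior n (by omega) p X hgood f hf y hy
    have hyX := interior_subset hy
    have hn' : (p : WithTop ℕ∞) ≤ n := by exact_mod_cast hn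
    have hz : ContDiff ℝ p (fun s => f (y + P s)) := (hf (fun s => y + P s) (contDiff_const.add hPs) (hPX y hyX hyx)).1.of_le hn'
    have hz' : ContDiff ℝ p (fun s => f (y + P' s)) := (hf (fun s => y + P' s) (contDiff_const.add hPs') (hPX' y hyX hyx)).1.of_le hn'
    have key := peano_coeff p (fun s => f (y + P s) - f (y + P' s)) (hz.sub hz') (fderiv ℝ f y v) ?_
    · rw [iteratedDeriv_fun_sub hz.contDiffAt hz'.contDiffAt] at key
      have hpd : fderiv ℝ f y v = ρ * pd N i f y := by
        rw [hv, map_smul, smul_eq_mul]; rfl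
      beta_reduce
      rw [key, hpd]
      have : (p.factorial : ℝ) ≠ 0 := by positivity
      field_simp
    · have h5 : Tendsto (fun s => (y + P s, y + P' s)) (𝓝 0) (𝓝 (y, y)) := by
        have : Continuous (fun s => (y + P s, y + P' s)) :=
          (continuous_const.add hPs.continuous).prodMk (continuous_const.add hPs'.continuous)
        have := this.tendsto 0
        simpa [hPz 0 hχ0, hPz' 0 hχ0] using this
      have h6 := hstr.isLittleO.comp_tendsto h5
      have h7 : ∀ᶠ s : ℝ in 𝓝 0, χ s = s := by
        filter_upwards [Metric.ball_mem_nhds (0:ℝ) (show (0:ℝ) < 1/2 by norm_num)] with s hs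
        rw [Metric.mem_ball, dist_zero_right, Real.norm_eq_abs] at hs
        exact h2 s hs.le
      have h8 : (fun s : ℝ => s^p • v) =O[𝓝 0] fun s : ℝ => s^p := by
        refine IsBigO.of_bound ‖v‖ (Eventually.of_forall fun s => ?_)
        rw [norm_smul, mul_comm]
      have h9 : ∀ s, (y + P s) - (y + P' s) = (χ s)^p • v := fun s => by simp [hP, hP']
      refine (h6.congr' ?_ ?_).trans_isBigO h8
      · filter_upwards [h7] with s hs
        simp only [Function.comp_apply, h9, hs, map_smul, smul_eq_mul]
        ring
      · filter_upwards [h7] with s hs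
        simp only [Function.comp_apply, h9, hs]

theorem step_ext (n p : ℕ) (hp : 1 ≤ p) (hn : p ≤ n) (X : Set (EuclideanSpace ℝ (Fin N))) (hX : X = closure (interior X))
    (hgood : ∀ x ∈ X, GoodPt p X x)
    (f : EuclideanSpace ℝ (Fin N) → ℝ)
    (hf : ∀ c : ℝ → EuclideanSpace ℝ (Fin N), ContDiff ℝ (⊤ : ℕ∞) c → (∀ t, c t ∈ X) → ZygmundClassR n (f ∘ c))
    (i : Fin N) :
    ∃ g : EuclideanSpace ℝ (Fin N) → ℝ, ContinuousOn g X ∧ (∀ x ∈ interior X, g x = pd N i f x) ∧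
      ∀ c : ℝ → EuclideanSpace ℝ (Fin N), ContDiff ℝ (⊤ : ℕ∞) c → (∀ t, c t ∈ X) → ZygmundClassR (n-p) (g ∘ c) := by
  have hL := local_ext n p hp hn X hgood f hf i
  choose! D ε hε hD1 hD2 using hL
  have hXc : X ⊆ closure (interior X) := hX.subset
  have hlim : ∀ x ∈ X, ∀ x' ∈ X, x' ∈ Metric.ball x (ε x) → Tendsto (pd N i f) (𝓝[interior X] x') (𝓝 (D x x')) := by
    intro x hx x' hx' hb
    have hc : ContinuousWithinAt (D x) X x' := by
      refine curve_cont p X x' hx' (hgood x' hx') (D x) (ε x - dist x' x) (by rw [Metric.mem_ball] at hb; linarith) ?_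
      intro c hc hcX
      rw [continuous_iff_continuousAt]
      intro t₀
      obtain ⟨V, hV, hVe⟩ := hD1 x hx c hc (fun t => (hcX t).1) t₀ (by
        have h1 := (hcX t₀).2
        rw [← dist_eq_norm] at h1
        rw [Metric.mem_ball]
        linarith [dist_triangle (c t₀) x' x])
      exact hV.1.continuous.continuousAt.congr hVe
    have h1 : Tendsto (D x) (𝓝[interior X] x') (𝓝 (D x x')) := hc.tendsto.mono_left (nhdsWithin_mono _ interior_subset)
    refine h1.congr' ?_
    filter_upwards [self_mem_nhdsWithin, mem_nhdsWithin_of_mem_nhds (Metric.isOpen_ball.mem_nhds hb)] with y hy hy'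
    exact hD2 x hx y hy hy'
  have hgD : ∀ x ∈ X, ∀ x' ∈ X, x' ∈ Metric.ball x (ε x) → extendFrom (interior X) (pd N i f) x' = D x x' :=
    fun x hx x' hx' hb => extendFrom_eq (hXc hx') (hlim x hx x' hx' hb)
  refine ⟨extendFrom (interior X) (pd N i f), ?_, ?_, ?_⟩
  · exact continuousOn_extendFrom hXc fun x hx => ⟨_, hlim x hx x hx (Metric.mem_ball_self (hε x hx))⟩
  · intro x hx
    have hx' := interior_subset hx
    rw [hgD x hx' x hx' (Metric.mem_ball_self (hε x hx'))]
    exact hD2 x hx' x hx (Metric.mem_ball_self (hε x hx'))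
  · intro c hc hcX
    apply zyg_local
    intro t₀
    obtain ⟨V, hV, hVe⟩ := hD1 (c t₀) (hcX t₀) c hc hcX t₀ (Metric.mem_ball_self (hε _ (hcX t₀)))
    refine ⟨V, hV, ?_⟩
    filter_upwards [hVe, hc.continuous.continuousAt.preimage_mem_nhds (Metric.ball_mem_nhds _ (hε _ (hcX t₀)))] with t h1 h2
    rw [h1, Function.comp_apply, hgD _ (hcX t₀) _ (hcX t) h2]
end

end Part9

section Part10
open Set Filter Topology

theorem pd_word (N : ℕ) (γ : Fin N → ℕ) (l : List (Fin N)) : ∃ w : List (Fin N), w.length = (l.map γ).sum ∧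
    ∀ f, l.foldr (fun i g => (pd N i)^[γ i] g) f = w.foldl (fun g i => pd N i g) f := by
  induction l with
  | nil => exact ⟨[], by simp, fun f => rfl⟩
  | cons a t ih =>
    obtain ⟨w, hw, h⟩ := ih
    refine ⟨w ++ List.replicate (γ a) a, by simp [hw, add_comm], fun f => ?_⟩
    rw [List.foldr_cons, h, List.foldl_append]
    generalize List.foldl (fun g i => pd N i g) f w = g
    induction γ a generalizing g with
    | zero => rfl
    | succ k ih => rw [Function.iterate_succ_apply, ih, List.replicate_succ, List.foldl_cons]

theorem pd_congr (N : ℕ) (U : Set (EuclideanSpace ℝ (Fin N))) (hU : IsOpen U) (w : List (Fin N)) (f g : EuclideanSpace ℝ (Fin N) → ℝ)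
    (h : EqOn f g U) : EqOn (w.foldl (fun g i => pd N i g) f) (w.foldl (fun g i => pd N i g) g) U := by
  induction w generalizing f g with
  | nil => exact h
  | cons a t ih =>
    refine ih _ _ fun x hx => ?_
    have : f =ᶠ[𝓝 x] g := by filter_upwards [hU.mem_nhds hx] with y hy using h hy
    simp only [pd, this.fderiv_eq]

theorem main_ind (N p : ℕ) (hp : 1 ≤ p) (X : Set (EuclideanSpace ℝ (Fin N))) (hX : X = closure (interior X))
    (hgood : ∀ x ∈ X, GoodPt p X x) (m : ℕ)
    (f : EuclideanSpace ℝ (Fin N) → ℝ)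
    (hf : ∀ c : ℝ → EuclideanSpace ℝ (Fin N), ContDiff ℝ (⊤ : ℕ∞) c → (∀ t, c t ∈ X) → ZygmundClassR (m*p) (f ∘ c)) :
    ContDiffOn ℝ m f (interior X) ∧ ∀ w : List (Fin N), w.length ≤ m →
      ∃ g : EuclideanSpace ℝ (Fin N) → ℝ, ContinuousOn g X ∧
      (∀ x ∈ interior X, g x = w.foldl (fun g i => pd N i g) f x) ∧
      ∀ c : ℝ → EuclideanSpace ℝ (Fin N), ContDiff ℝ (⊤ : ℕ∞) c → (∀ t, c t ∈ X) → ZygmundClassR ((m-w.length)*p) (g ∘ c) := by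
  induction m generalizing f with
  | zero =>
    have hc : ContinuousOn f X := fun x hx => curve_cont p X x hx (hgood x hx) f 1 one_pos
      (fun c hc hcX => (hf c hc fun t => (hcX t).1).1.continuous)
    refine ⟨?_, fun w hw => ?_⟩
    · exact contDiffOn_zero.2 (hc.mono interior_subset)
    · have : w = [] := List.length_eq_zero_iff.1 (by omega)
      subst this
      exact ⟨f, hc, fun _ _ => rfl, by simpa using hf⟩
  | succ m ih =>
    have hc : ContinuousOn f X := fun x hx => curve_cont p X x hx (hgood x hx) f 1 one_pos
      (fun c hc hcX => (hf c hc fun t => (hcX t).1).1.continuous)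
    have hn : p ≤ (m+1)*p := by nlinarith
    have hnp : (m+1)*p - p = m*p := by rw [add_mul, one_mul, Nat.add_sub_cancel]
    have hst := step_ext ((m+1)*p) p hp hn X hX hgood f hf
    rw [hnp] at hst
    choose g hg1 hg2 hg3 using hst
    refine ⟨?_, fun w hw => ?_⟩
    · push_cast
      rw [contDiffOn_succ_iff_fderiv_of_isOpen isOpen_interior]
      refine ⟨fun y hy => (c1_interior _ (hp.trans hn) p X hgood f hf y hy).hasFDerivAt.differentiableAt.differentiableWithinAt, by simp, ?_⟩
      have e : ∀ y ∈ interior X, fderiv ℝ f y = ∑ i, g i y • (EuclideanSpace.proj i : EuclideanSpace ℝ (Fin N) →L[ℝ] ℝ) := by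
        intro y hy
        ext v
        have hv : v = ∑ i, v i • EuclideanSpace.single i (1:ℝ) := by
          ext j; simp [Finset.sum_apply, Pi.single_apply]
        conv_lhs => rw [hv, map_sum]
        simp only [sum_apply, map_smul, smul_eq_mul]
        refine Finset.sum_congr rfl fun i _ => ?_
        rw [hg2 i y hy]
        simp [pd, mul_comm]
      refine ContDiffOn.congr (ContDiffOn.sum fun i _ => ?_) e
      exact ((ih (g i) (hg3 i)).1).smul contDiffOn_const
    · cases w with
      | nil => exact ⟨f, hc, fun _ _ => rfl, by simpa using hf⟩
      | cons i w =>
        simp only [List.length_cons] at hw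
        obtain ⟨g', h1, h2, h3⟩ := (ih (g i) (hg3 i)).2 w (by omega)
        refine ⟨g', h1, fun x hx => ?_, ?_⟩
        · rw [h2 x hx]
          exact pd_congr N _ isOpen_interior w _ _ (hg2 i) hx
        · simp only [List.length_cons, Nat.add_sub_add_right]
          exact h3


end Part10

/-- **Theorem 4.9.** Let `β ∈ (0,1]`, `p(β) = ⌈2/β⌉`, and let `X ⊆ ℝ^{d+1}` be closed with
`X = closure (interior X)` and the uniform `β`-cusp property. If `f ∘ c ∈ Z^{m p(β),1}(ℝ)` for
all smooth curves `c` with image in `X`, then `f` is `C^m` on the interior of `X` and, for every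
multi-index `γ` with `|γ| ≤ m`, the partial derivative `∂^γ f` extends continuously from the
interior of `X` to `X`, the extension `g` satisfying `g ∘ c ∈ Z^{(m-|γ|) p(β),1}(ℝ)` for all
smooth curves `c` with image in `X`. -/
theorem zygmund_arc_smooth_cusps (d m : ℕ) (β : ℝ) (hβ : β ∈ Set.Ioc (0 : ℝ) 1)
    (X : Set (EuclideanSpace ℝ (Fin (d + 1)))) (hXcl : IsClosed X)
    (hX : X = closure (interior X)) (hcusp : UniformCuspProperty d β (interior X))
    (f : EuclideanSpace ℝ (Fin (d + 1)) → ℝ)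
    (hf : ∀ c : ℝ → EuclideanSpace ℝ (Fin (d + 1)), ContDiff ℝ (⊤ : ℕ∞) c →
      (∀ t, c t ∈ X) → ZygmundClassR (m * ⌈2 / β⌉₊) (f ∘ c)) :
    ContDiffOn ℝ m f (interior X) ∧
      ∀ γ : Fin (d + 1) → ℕ, (∑ i, γ i) ≤ m →
        ∃ g : EuclideanSpace ℝ (Fin (d + 1)) → ℝ,
          ContinuousOn g X ∧
          (∀ x ∈ interior X, g x = pdMulti (d + 1) γ f x) ∧
          ∀ c : ℝ → EuclideanSpace ℝ (Fin (d + 1)), ContDiff ℝ (⊤ : ℕ∞) c →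
            (∀ t, c t ∈ X) → ZygmundClassR ((m - ∑ i, γ i) * ⌈2 / β⌉₊) (g ∘ c) := by
  have hp : 1 ≤ ⌈2 / β⌉₊ := Nat.one_le_iff_ne_zero.2 (Nat.ceil_pos.2 (div_pos two_pos hβ.1)).ne'
  obtain ⟨h1, h2⟩ := main_ind (d+1) _ hp X hX (goodPt_all d β hβ X hXcl hX hcusp) m f hf
  refine ⟨h1, fun γ hγ => ?_⟩
  obtain ⟨w, hw, hw'⟩ := pd_word (d+1) γ (List.finRange (d+1))
  rw [← Fin.sum_univ_def] at hw
  obtain ⟨g, h3, h4, h5⟩ := h2 w (by omega)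
  refine ⟨g, h3, fun x hx => ?_, ?_⟩
  · rw [h4 x hx, pdMulti, hw']
  · rw [← hw]; exact h5
end
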